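/- Let α ∈ (0,1) be irrational with bounded continued fraction coefficients (equivalently, α is badly approximable: there exists c > 0 with ‖qα‖ ≥ c/q for all q ∈ ℕ, where ‖x‖ denotes the distance from x to the nearest integer). Then the spectrum of the Schrödinger operator H_{V_{α,β,θ}} is a Cantor set of Lebesgue measure zero for every β ∈ (0,1) and every θ ∈ (0,1). -/

import Mathlib

open Filter MeasureTheory Set

noncomputable section

/-- `SL(2,ℝ)`. -/
abbrev SL2 : Type := Matrix.SpecialLinearGroup (Fin 2) ℝ

/-- The left shift on two-sided sequences. -/
def shift (𝒜 : Type*) : (ℤ → 𝒜) → ℤ → 𝒜 := fun ω n => ω (n + 1)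

/-- A subshift: a closed, shift-invariant set of two-sided sequences. -/
def IsSubshift {𝒜 : Type*} [TopologicalSpace 𝒜] (Ω : Set (ℤ → 𝒜)) : Prop :=
  IsClosed Ω ∧ shift 𝒜 '' Ω = Ω

/-- A minimal subshift: every two-sided orbit is dense. -/
def IsMinimalSubshift {𝒜 : Type*} [TopologicalSpace 𝒜] (Ω : Set (ℤ → 𝒜)) : Prop :=
  IsSubshift Ω ∧ ∀ ω ∈ Ω, Ω ⊆ closure (Set.range fun k : ℤ => fun n : ℤ => ω (n + k))

/-- An aperiodic subshift: no nontrivial shift fixes a point of `Ω`. -/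
def IsAperiodicSubshift {𝒜 : Type*} (Ω : Set (ℤ → 𝒜)) : Prop :=
  ∀ ω ∈ Ω, ∀ n : ℤ, n ≠ 0 → (fun m => ω (m + n)) ≠ ω

/-- The word `w` occurs in `ω` starting at position `k`. -/
def OccursAt {𝒜 : Type*} (ω : ℤ → 𝒜) (w : List 𝒜) (k : ℤ) : Prop :=
  ∀ i : Fin w.length, ω (k + i) = w.get i

/-- `w` belongs to `𝒲(Ω)`, the set of finite words of the subshift `Ω`. -/
def IsWordOf {𝒜 : Type*} (Ω : Set (ℤ → 𝒜)) (w : List 𝒜) : Prop :=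
  ∃ ω ∈ Ω, ∃ k : ℤ, OccursAt ω w k

/-- `V_w = {ω ∈ Ω : ω(1)⋯ω(|w|) = w}`. -/
def Vset {𝒜 : Type*} (Ω : Set (ℤ → 𝒜)) (w : List 𝒜) : Set (ℤ → 𝒜) :=
  {ω ∈ Ω | OccursAt ω w 1}

/-- `U_w = {ω ∈ Ω : w occurs in ω around position one}`. -/
def Uset {𝒜 : Type*} (Ω : Set (ℤ → 𝒜)) (w : List 𝒜) : Set (ℤ → 𝒜) :=
  {ω ∈ Ω | ∃ n : ℕ, n < w.length ∧ OccursAt ω w (1 - n)}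

/-- Boshernitzan's condition (B): there are an ergodic probability measure `ν` (concentrated
on `Ω`), a constant `C > 0` and lengths `l n → ∞` with `|w| ν(V_w) ≥ C` whenever `|w| = l n`;
equivalently `limsup n η_ν(n) > 0`. -/
def CondB {𝒜 : Type*} [MeasurableSpace 𝒜] (Ω : Set (ℤ → 𝒜)) : Prop :=
  ∃ ν : Measure (ℤ → 𝒜), IsProbabilityMeasure ν ∧ ν Ωᶜ = 0 ∧ Ergodic (shift 𝒜) ν ∧
    ∃ C > (0 : ℝ), ∃ l : ℕ → ℕ, Tendsto l atTop atTop ∧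
      ∀ n : ℕ, ∀ w : List 𝒜, IsWordOf Ω w → w.length = l n →
        C ≤ (w.length : ℝ) * (ν (Vset Ω w)).toReal

/-- Condition (B'): there are an ergodic probability measure `ν` (concentrated on `Ω`),
a constant `C' > 0` and lengths `l n → ∞` with `ν(U_w) ≥ C'` whenever `|w| = l n`. -/
def CondB' {𝒜 : Type*} [MeasurableSpace 𝒜] (Ω : Set (ℤ → 𝒜)) : Prop :=
  ∃ ν : Measure (ℤ → 𝒜), IsProbabilityMeasure ν ∧ ν Ωᶜ = 0 ∧ Ergodic (shift 𝒜) ν ∧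
    ∃ C > (0 : ℝ), ∃ l : ℕ → ℕ, Tendsto l atTop atTop ∧
      ∀ n : ℕ, ∀ w : List 𝒜, IsWordOf Ω w → w.length = l n →
        C ≤ (ν (Uset Ω w)).toReal

/-- Unique ergodicity: there is exactly one shift-invariant Borel probability measure
concentrated on `Ω`. -/
def UniquelyErgodicSubshift {𝒜 : Type*} [MeasurableSpace 𝒜] (Ω : Set (ℤ → 𝒜)) : Prop :=
  ∃! ν : Measure (ℤ → 𝒜),
    IsProbabilityMeasure ν ∧ ν Ωᶜ = 0 ∧ MeasurePreserving (shift 𝒜) ν ν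

/-- A function on sequences is locally constant (on `Ω`) if its value only depends on
the coordinates `ω(−N)⋯ω(N)` for some `N`. -/
def LocConstOn {𝒜 β : Type*} (Ω : Set (ℤ → 𝒜)) (A : (ℤ → 𝒜) → β) : Prop :=
  ∃ N : ℕ, ∀ ω ∈ Ω, ∀ ρ ∈ Ω, (∀ i : ℤ, |i| ≤ (N : ℤ) → ω i = ρ i) → A ω = A ρ

/-- The cocycle `A(n,ω) = A(T^{n−1}ω)⋯A(ω)`. -/
def cocycle {𝒜 G : Type*} [Monoid G] (A : (ℤ → 𝒜) → G) : ℕ → (ℤ → 𝒜) → G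
  | 0, _ => 1
  | n + 1, ω => A ((shift 𝒜)^[n] ω) * cocycle A n ω

/-- A concrete norm on 2×2 real matrices (the Frobenius norm). -/
def matNorm (M : Matrix (Fin 2) (Fin 2) ℝ) : ℝ :=
  Real.sqrt (∑ i : Fin 2, ∑ j : Fin 2, (M i j) ^ 2)

/-- `A : Ω → SL(2,ℝ)` is uniform: `(1/n) log‖A(n,ω)‖` converges, uniformly on `Ω`,
to a constant `Λ(A)`. -/
def IsUniformOn {𝒜 : Type*} (Ω : Set (ℤ → 𝒜)) (A : (ℤ → 𝒜) → SL2) : Prop :=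
  ∃ Λ : ℝ, TendstoUniformlyOn
    (fun (n : ℕ) (ω : ℤ → 𝒜) =>
      (n : ℝ)⁻¹ * Real.log (matNorm ((cocycle A n ω : SL2) : Matrix (Fin 2) (Fin 2) ℝ)))
    (fun _ => Λ) atTop Ω

/-- Property (P): every locally constant `SL(2,ℝ)`-valued function on `Ω` is uniform. -/
def PropP {𝒜 : Type*} (Ω : Set (ℤ → 𝒜)) : Prop :=
  ∀ A : (ℤ → 𝒜) → SL2, LocConstOn Ω A → IsUniformOn Ω A

/-- The word `ω(1)⋯ω(n)`. -/
def wordOf {𝒜 : Type*} (ω : ℤ → 𝒜) (n : ℕ) : List 𝒜 :=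
  (List.range n).map fun i => ω (1 + i)

/-- A subadditive function on the words of `Ω`. -/
def SubadditiveOn {𝒜 : Type*} (Ω : Set (ℤ → 𝒜)) (F : List 𝒜 → ℝ) : Prop :=
  ∀ x y : List 𝒜, IsWordOf Ω x → IsWordOf Ω y → IsWordOf Ω (x ++ y) →
    F (x ++ y) ≤ F x + F y

/-- The complexity function `p(n) = #{w ∈ 𝒲(Ω) : |w| = n}`. -/
def complexity {𝒜 : Type*} (Ω : Set (ℤ → 𝒜)) (n : ℕ) : ℕ :=
  Set.ncard {w : List 𝒜 | IsWordOf Ω w ∧ w.length = n}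

/-- A right-special word. -/
def RightSpecial {𝒜 : Type*} (Ω : Set (ℤ → 𝒜)) (w : List 𝒜) : Prop :=
  ∃ a b : 𝒜, a ≠ b ∧ IsWordOf Ω (w ++ [a]) ∧ IsWordOf Ω (w ++ [b])

/-- A left-special word. -/
def LeftSpecial {𝒜 : Type*} (Ω : Set (ℤ → 𝒜)) (w : List 𝒜) : Prop :=
  ∃ a b : 𝒜, a ≠ b ∧ IsWordOf Ω (a :: w) ∧ IsWordOf Ω (b :: w)

/-- `σ ∈ ℬ^ℤ` is the image of `ω ∈ 𝒜^ℤ` under the substitution `S`, with `S(ω(0))`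
starting at position `0`. -/
def IsSubstImage {𝒜 ℬ : Type*} (S : 𝒜 → List ℬ) (ω : ℤ → 𝒜) (σ : ℤ → ℬ) : Prop :=
  ∃ c : ℤ → ℤ, c 0 = 0 ∧ (∀ k : ℤ, c (k + 1) = c k + (S (ω k)).length) ∧
    ∀ k : ℤ, ∀ j : Fin (S (ω k)).length, σ (c k + j) = (S (ω k)).get j

/-- `Ω(S) = {T^k S(ω) : ω ∈ Ω, k ∈ ℤ}`. -/
def SubstSubshift {𝒜 ℬ : Type*} (S : 𝒜 → List ℬ) (Ω : Set (ℤ → 𝒜)) : Set (ℤ → ℬ) :=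
  {τ | ∃ ω ∈ Ω, ∃ σ : ℤ → ℬ, IsSubstImage S ω σ ∧ ∃ k : ℤ, τ = fun n => σ (n + k)}

/-- `S` is recognizable with respect to `(Ω,T)`: there is a locally constant
`S̃ : Ω(S) → Ω × ℤ` with `S̃(T^k S(ω)) = (ω,k)` for `0 ≤ k ≤ |S(ω(0))|`. -/
def Recognizable {𝒜 ℬ : Type*} (S : 𝒜 → List ℬ) (Ω : Set (ℤ → 𝒜)) : Prop :=
  ∃ St : (ℤ → ℬ) → (ℤ → 𝒜) × ℤ, LocConstOn (SubstSubshift S Ω) St ∧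
    ∀ ω ∈ Ω, ∀ σ : ℤ → ℬ, IsSubstImage S ω σ →
      ∀ k : ℕ, k ≤ (S (ω 0)).length → St (fun n => σ (n + k)) = (ω, (k : ℤ))

/-- A Cantor set: compact, empty interior, no isolated points. -/
def IsCantorSet (S : Set ℝ) : Prop :=
  IsCompact S ∧ interior S = ∅ ∧ ∀ x ∈ S, AccPt x (Filter.principal S)

/-- `H` is the Schrödinger operator on `ℓ²(ℤ)` with potential `V`:
`(Hu)(n) = u(n+1) + u(n−1) + V(n)u(n)`. -/
def IsSchrodingerOp (V : ℤ → ℝ)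
    (H : lp (fun _ : ℤ => ℝ) 2 →L[ℝ] lp (fun _ : ℤ => ℝ) 2) : Prop :=
  ∀ u : lp (fun _ : ℤ => ℝ) 2, ∀ n : ℤ,
    (H u : ∀ _ : ℤ, ℝ) n = (u : ∀ _ : ℤ, ℝ) (n + 1) + (u : ∀ _ : ℤ, ℝ) (n - 1)
      + V n * (u : ∀ _ : ℤ, ℝ) n

/-- The circle map potential `V_{α,β,θ}(n) = χ_{[1−β,1)}(nα + θ mod 1)`. -/
def circleV (α β θ : ℝ) : ℤ → ℝ := fun n =>
  (Set.Ico (1 - β) 1).indicator (fun _ => (1 : ℝ)) (Int.fract (n * α + θ))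

/-- The coding `v_n(α,β,θ) = χ_{[0,β)}(nα + θ mod 1)` of the rotation by `α`. -/
def circleSeq (α β θ : ℝ) : ℤ → Bool := fun n =>
  if Int.fract (n * α + θ) < β then true else false

/-- The circle map subshift `Ω_{α,β}`. -/
def circleSubshift (α β : ℝ) : Set (ℤ → Bool) :=
  closure {ω | ∃ θ : ℝ, 0 ≤ θ ∧ θ < 1 ∧ ω = circleSeq α β θ}

/-- The one-step transfer matrix `M^E(ω)`. -/
def transferMat (E : ℝ) (ω : ℤ → ℝ) : Matrix (Fin 2) (Fin 2) ℝ :=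
  !![E - ω 1, -1; 1, 0]

/-- The Lyapunov exponent `γ(E) = inf_{n ≥ 1} (1/n) ∫ log‖M^E(n,ω)‖ dμ(ω)`. -/
def lyapunov (μ : Measure (ℤ → ℝ)) (E : ℝ) : ℝ :=
  ⨅ n : ℕ+, ((n : ℕ) : ℝ)⁻¹ *
    ∫ ω, Real.log (matNorm (cocycle (transferMat E) (n : ℕ) ω)) ∂μ

end

namespace CircleMap

/-- The function on the circle generating the circle map potential. -/
noncomputable def codingFn (β x : ℝ) : ℝ :=
  (Set.Ico (1 - β) 1).indicator (fun _ => (1 : ℝ)) (Int.fract x)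

lemma codingFn_eq_floor {β : ℝ} (hβ : β ∈ Set.Ioo (0 : ℝ) 1) (x : ℝ) :
    codingFn β x = ((⌊x + β⌋ - ⌊x⌋ : ℤ) : ℝ) := by
  obtain ⟨h0, h1⟩ := hβ
  have hx := Int.fract_add_floor x
  have hf0 := Int.fract_nonneg x
  have hf1 := Int.fract_lt_one x
  unfold codingFn
  by_cases h : 1 - β ≤ Int.fract x
  · rw [indicator_of_mem (by exact ⟨h, hf1⟩)]
    have : ⌊x + β⌋ = ⌊x⌋ + 1 := by
      rw [Int.floor_eq_iff]; push_cast; constructor <;> linarith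
    rw [this]; push_cast; ring
  · rw [indicator_of_notMem (by exact fun h' => h h'.1)]
    have : ⌊x + β⌋ = ⌊x⌋ := by
      rw [Int.floor_eq_iff]; constructor <;> linarith
    rw [this]; simp

lemma codingFn_mem (β x : ℝ) : codingFn β x = 0 ∨ codingFn β x = 1 := by
  unfold codingFn
  by_cases h : Int.fract x ∈ Set.Ico (1 - β) 1 <;> simp [indicator, h]

lemma codingFn_sub_int (β x : ℝ) (j : ℤ) : codingFn β (x - j) = codingFn β x := by
  simp [codingFn]

lemma exists_break_of_ne {β : ℝ} (hβ : β ∈ Set.Ioo (0 : ℝ) 1) {x y : ℝ} (hxy : x ≤ y)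
    (h : codingFn β x ≠ codingFn β y) :
    ∃ j : ℤ, (x < j ∧ (j : ℝ) ≤ y) ∨ (x < j - β ∧ (j : ℝ) - β ≤ y) := by
  rw [codingFn_eq_floor hβ, codingFn_eq_floor hβ] at h
  by_cases h1 : ⌊x⌋ = ⌊y⌋
  · have h2 : ⌊x + β⌋ ≠ ⌊y + β⌋ := by
      intro h2; rw [h1, h2] at h; exact h rfl
    have h3 : ⌊x + β⌋ < ⌊y + β⌋ := lt_of_le_of_ne (Int.floor_mono (by linarith)) h2
    refine ⟨⌊y + β⌋, Or.inr ⟨?_, ?_⟩⟩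
    · have := Int.floor_lt.1 h3; linarith
    · have := Int.floor_le (y + β); linarith
  · have h3 : ⌊x⌋ < ⌊y⌋ := lt_of_le_of_ne (Int.floor_mono hxy) h1
    exact ⟨⌊y⌋, Or.inl ⟨Int.floor_lt.1 h3, Int.floor_le y⟩⟩

/-- `α` is badly approximable with constant `c`. -/
def BadlyApprox (c α : ℝ) : Prop := ∀ k : ℤ, k ≠ 0 → ∀ j : ℤ, c / |(k : ℝ)| ≤ |k * α - j|

lemma badlyApprox_of_round {c α : ℝ}
    (h : ∀ q : ℕ, 0 < q → c / (q : ℝ) ≤ |(q : ℝ) * α - (round ((q : ℝ) * α) : ℝ)|) :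
    BadlyApprox c α := by
  intro k hk j
  have hq : 0 < k.natAbs := Int.natAbs_pos.2 hk
  have h1 := h _ hq
  have h2 : ((k.natAbs : ℕ) : ℝ) = |(k : ℝ)| := by
    rw [← Int.cast_abs, Int.abs_eq_natAbs]; simp
  rw [h2] at h1
  refine h1.trans ?_
  rcases le_or_gt 0 k with hk0 | hk0
  · have : |(k : ℝ)| = k := abs_of_nonneg (by exact_mod_cast hk0)
    rw [this]
    exact round_le _ j
  · have : |(k : ℝ)| = -k := abs_of_neg (by exact_mod_cast hk0)
    rw [this]
    refine (round_le _ (-j)).trans (le_of_eq ?_)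
    rw [← abs_neg]; congr 1; push_cast; ring

lemma exists_near {c α : ℝ} (hc : 0 < c) (h : BadlyApprox c α) (Q : ℕ) (hQ : 0 < Q)
    (b : ℤ) (φ : ℝ) :
    ∃ m : ℤ, b ≤ m ∧ m < b + Q ∧ ∃ j : ℤ, |m * α - φ - j| ≤ (2 + 1 / c) / Q := by
  obtain ⟨r, hr, hrQ⟩ := Real.exists_rat_abs_sub_le_and_den_le α hQ
  set q : ℕ := r.den with hq
  have hq0 : 0 < q := r.den_pos
  have hq0' : (0 : ℝ) < q := by exact_mod_cast hq0
  have hQ0 : (0 : ℝ) < Q := by exact_mod_cast hQ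
  have hrq : (r : ℝ) = r.num / q := by exact_mod_cast (Rat.num_div_den r).symm
  have hap : |(q : ℝ) * α - r.num| ≤ 1 / (Q + 1) := by
    have : (q : ℝ) * α - r.num = q * (α - r) := by rw [hrq]; field_simp
    rw [this, abs_mul, abs_of_pos hq0']
    calc (q : ℝ) * |α - r| ≤ q * (1 / ((Q + 1) * q)) := by gcongr
      _ = 1 / (Q + 1) := by field_simp
  have hcq : c / q ≤ 1 / Q := by
    have h1 := h q (by exact_mod_cast hq0.ne') r.num
    push_cast at h1
    rw [abs_of_pos hq0'] at h1
    refine h1.trans (hap.trans ?_)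
    gcongr; linarith
  have hcop : IsCoprime r.num (q : ℤ) := by
    rw [Int.isCoprime_iff_nat_coprime]; simpa using r.reduced
  obtain ⟨u, v, huv⟩ := hcop
  set ψ := φ - b * α with hψ
  set k := round ((q : ℝ) * ψ) with hk
  have hkψ : |(q : ℝ) * ψ - k| ≤ 1 / 2 := abs_sub_round _
  set m0 : ℤ := (k * u) % q with hm0
  have hm1 : 0 ≤ m0 := Int.emod_nonneg _ (by exact_mod_cast hq0.ne')
  have hm2 : m0 < q := Int.emod_lt_of_pos _ (by exact_mod_cast hq0)
  obtain ⟨j, hj⟩ : ∃ j : ℤ, m0 * r.num - k = q * j := by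
    have e1 : m0 = k * u - q * ((k * u) / q) := by
      rw [hm0, Int.emod_def]
    refine ⟨-k * v - ((k * u) / q) * r.num, ?_⟩
    rw [e1]
    linear_combination k * huv
  refine ⟨b + m0, by omega, by have : (q : ℤ) ≤ Q := (by exact_mod_cast hrQ); omega, j, ?_⟩
  have hjR : (m0 : ℝ) * r.num - k = q * j := by exact_mod_cast hj
  have key : ((b + m0 : ℤ) : ℝ) * α - φ - j =
      (m0 / q) * (q * α - r.num) - (1 / q) * (q * ψ - k) := by
    have : (j : ℝ) = (m0 * r.num - k) / q := by rw [hjR]; field_simp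
    rw [this, hψ]; push_cast; field_simp; ring
  rw [key]
  have hm0q : (m0 : ℝ) / q ≤ 1 := by
    rw [div_le_one hq0']; exact_mod_cast hm2.le
  have hm0q' : (0 : ℝ) ≤ m0 / q := div_nonneg (by exact_mod_cast hm1) hq0'.le
  have h1q : 1 / (q : ℝ) ≤ 1 / c / Q := by
    rw [div_le_div_iff₀ hq0' hQ0] at hcq
    rw [div_div, div_le_div_iff₀ hq0' (by positivity)]
    linarith
  have hQ1 : 1 / ((Q : ℝ) + 1) ≤ 1 / Q := by gcongr; linarith
  calc |(m0 : ℝ) / q * (q * α - r.num) - 1 / q * (q * ψ - k)|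
      ≤ |(m0 : ℝ) / q * (q * α - r.num)| + |1 / (q : ℝ) * (q * ψ - k)| := abs_sub _ _
    _ = (m0 : ℝ) / q * |q * α - r.num| + 1 / (q : ℝ) * |q * ψ - k| := by
        rw [abs_mul, abs_mul, abs_of_nonneg hm0q', abs_of_pos (by positivity : 0 < 1 / (q : ℝ))]
    _ ≤ 1 * (1 / Q) + (1 / c / Q) * (1 / 2) := by
        gcongr
        exact hap.trans hQ1
    _ ≤ (2 + 1 / c) / Q := by
        rw [add_div]
        have : 0 ≤ 1 / c / Q := by positivity
        have : 0 ≤ 1 / (Q : ℝ) := by positivity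
        have : (2 : ℝ) / Q = 1 / Q + 1 / Q := by ring
        linarith

/-- At scale `l`, break points of words of length `l` are either equal or `2 t / l` apart. -/
def GoodScale (t α β : ℝ) (l : ℕ) : Prop :=
  ∀ k : ℤ, |k| < l → ∀ j : ℤ,
    (k ≠ 0 → 2 * t / l ≤ |k * α - j|) ∧ (β - k * α - j = 0 ∨ 2 * t / l ≤ |β - k * α - j|)

lemma BadlyApprox.le_half {c α : ℝ} (h : BadlyApprox c α) : c ≤ 1 / 2 := by
  have h1 := h 1 one_ne_zero (round α)
  simp only [Int.cast_one, abs_one, div_one, one_mul] at h1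
  exact h1.trans (abs_sub_round α)

lemma BadlyApprox.le_of_le {c α : ℝ} (hc : 0 < c) (h : BadlyApprox c α) {k j : ℤ} (hk : k ≠ 0)
    {r : ℝ} (hr : |(k : ℝ)| ≤ r) : c / r ≤ |k * α - j| := by
  have : 0 < |(k : ℝ)| := abs_pos.2 (by exact_mod_cast hk)
  exact (by gcongr : c / r ≤ c / |(k : ℝ)|).trans (h k hk j)

lemma exists_goodScale {c α : ℝ} (hc : 0 < c) (h : BadlyApprox c α) (β : ℝ) (L : ℕ) :
    ∃ l : ℕ, L ≤ l ∧ 0 < l ∧ GoodScale (c / 16) α β l := by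
  have hc2 := h.le_half
  have g1 : ∀ l : ℕ, 0 < l → ∀ k : ℤ, |k| < l → ∀ j : ℤ, k ≠ 0 →
      2 * (c / 16) / l ≤ |k * α - j| := by
    intro l hl k hk j hk0
    have hl' : (0 : ℝ) < l := by exact_mod_cast hl
    refine le_trans ?_ (h.le_of_le hc hk0 (r := l) (by exact_mod_cast hk.le))
    gcongr; linarith
  have small : ∀ l : ℕ, 0 < l → 2 * (c / 16) / (l : ℝ) ≤ 1 / 2 := by
    intro l hl
    have : (1 : ℝ) ≤ l := by exact_mod_cast hl
    rw [div_le_iff₀ (by linarith)]; linarith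
  by_cases hB : ∃ k0 j0 : ℤ, β = k0 * α + j0
  · obtain ⟨k0, j0, hβ⟩ := hB
    set l := max (L + 1) (k0.natAbs) with hl
    have hl0 : 0 < l := lt_of_lt_of_le (Nat.succ_pos L) (le_max_left _ _)
    have hl' : (0 : ℝ) < l := by exact_mod_cast hl0
    refine ⟨l, by omega, hl0, fun k hk j => ⟨g1 l hl0 k hk j, ?_⟩⟩
    have e : β - k * α - j = ((k0 - k : ℤ) : ℝ) * α - ((j - j0 : ℤ) : ℝ) := by
      rw [hβ]; push_cast; ring
    rw [e]
    by_cases hkk : k0 - k = 0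
    · rw [hkk]
      by_cases hjj : j - j0 = 0
      · left; rw [hjj]; simp
      · right
        refine (small l hl0).trans ?_
        have : (1 : ℝ) ≤ |((j - j0 : ℤ) : ℝ)| := by exact_mod_cast Int.one_le_abs hjj
        simp only [Int.cast_zero, zero_mul, zero_sub, abs_neg]
        linarith
    · right
      refine le_trans ?_ (h.le_of_le hc hkk (r := 2 * l) ?_)
      · rw [div_le_div_iff₀ hl' (by positivity)]; nlinarith
      · have : |k0 - k| ≤ 2 * (l : ℤ) := by
          have h1 : |k0| ≤ l := by
            rw [Int.abs_eq_natAbs]; exact_mod_cast le_max_right _ _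
          have := abs_sub k0 k
          omega
        exact_mod_cast this
  · push Not at hB
    by_cases hW : GoodScale (c / 16) α β (L + 1)
    · exact ⟨L + 1, by omega, by omega, hW⟩
    · have : ∃ k1 : ℤ, |k1| < (L + 1 : ℕ) ∧ ∃ j1 : ℤ,
          |β - k1 * α - j1| < 2 * (c / 16) / (L + 1 : ℕ) := by
        by_contra hcon
        push Not at hcon
        exact hW fun k hk j => ⟨g1 _ (by omega) k hk j, Or.inr (hcon k hk j)⟩
      obtain ⟨k1, hk1, j1, hj1⟩ := this
      set ε := |β - k1 * α - j1| with hε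
      have hε0 : 0 < ε := abs_pos.2 (fun h0 => hB k1 j1 (by linarith))
      have hL1 : (0 : ℝ) < ((L + 1 : ℕ) : ℝ) := by positivity
      set X := c / (4 * ε) with hX
      have hXL : ((L + 1 : ℕ) : ℝ) < X := by
        rw [lt_div_iff₀ hL1] at hj1
        rw [hX, lt_div_iff₀ (by positivity)]
        nlinarith
      set l := ⌊X⌋₊ with hl
      have hlL : L + 1 ≤ l := Nat.le_floor hXL.le
      have hlX : (l : ℝ) ≤ X := Nat.floor_le (by positivity)
      have hXl : X < l + 1 := Nat.lt_floor_add_one X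
      have hl0 : 0 < l := by omega
      have hl' : (1 : ℝ) ≤ l := by exact_mod_cast hl0
      have hεl : ε * l ≤ c / 4 := by
        rw [hX, le_div_iff₀ (by positivity)] at hlX; linarith
      have hεl' : c / 8 ≤ ε * l := by
        rw [hX, div_lt_iff₀ (by positivity)] at hXl; nlinarith
      refine ⟨l, by omega, hl0, fun k hk j => ⟨g1 l hl0 k hk j, Or.inr ?_⟩⟩
      rw [div_le_iff₀ (by linarith)]
      by_cases hkk : k1 - k = 0
      · by_cases hjj : j1 - j = 0
        · have e1 : k = k1 := by omega
          have e2 : j = j1 := by omega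
          rw [e1, e2, ← hε]; linarith
        · have : (1 : ℝ) ≤ |((j1 - j : ℤ) : ℝ)| := by exact_mod_cast Int.one_le_abs hjj
          have e : ((j1 - j : ℤ) : ℝ) = (β - k * α - j) - (β - k1 * α - j1) := by
            have e1 : k = k1 := by omega
            rw [e1]; push_cast; ring
          have h2 := abs_sub (β - k * α - j) (β - k1 * α - j1)
          rw [← e, ← hε] at h2
          nlinarith
      · have h1 := h.le_of_le hc hkk (j := j - j1) (r := 2 * l) ?_
        · have e : ((k1 - k : ℤ) : ℝ) * α - ((j - j1 : ℤ) : ℝ) =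
              (β - k * α - j) - (β - k1 * α - j1) := by push_cast; ring
          have h2 := abs_sub (β - k * α - j) (β - k1 * α - j1)
          rw [← e, ← hε] at h2
          have h3 := h1.trans h2
          rw [div_le_iff₀ (by positivity)] at h3
          nlinarith
        · have : |k1 - k| ≤ 2 * (l : ℤ) := by
            have := abs_sub k1 k
            omega
          exact_mod_cast this

lemma word_const_side {t α β : ℝ} (hβ : β ∈ Set.Ioo (0 : ℝ) 1) {l : ℕ} (hl : 0 < l)
    (ht1 : 2 * t ≤ 1) (ht0 : 0 < t) (hg : GoodScale t α β l) (x : ℝ) :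
    (∀ y, x ≤ y → y ≤ x + t / l → ∀ i : ℕ, i < l →
      codingFn β (y + i * α) = codingFn β (x + i * α)) ∨
    (∀ y, x - t / l ≤ y → y ≤ x → ∀ i : ℕ, i < l →
      codingFn β (y + i * α) = codingFn β (x + i * α)) := by
  have hl' : (1 : ℝ) ≤ l := by exact_mod_cast hl
  by_contra hcon
  push Not at hcon
  obtain ⟨⟨y, hxy, hyt, i, hi, hne⟩, ⟨y', hy't, hy'x, i', hi', hne'⟩⟩ := hcon
  obtain ⟨j, hj⟩ := exists_break_of_ne hβ (by linarith : x + i * α ≤ y + i * α) hne.symm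
  obtain ⟨j', hj'⟩ := exists_break_of_ne hβ (by linarith : y' + i' * α ≤ x + i' * α) hne'
  have hk : |(i' : ℤ) - i| < l := by rw [abs_lt]; omega
  have h2t : 2 * t / l = t / l + t / l := by ring
  rcases hj with ⟨ha, hb⟩ | ⟨ha, hb⟩ <;> rcases hj' with ⟨ha', hb'⟩ | ⟨ha', hb'⟩
  · have hd0 : 0 < ((i' : ℤ) - i : ℤ) * α - ((j' - j : ℤ) : ℝ) := by push_cast; linarith
    have hd1 : ((i' : ℤ) - i : ℤ) * α - ((j' - j : ℤ) : ℝ) < 2 * t / l := by push_cast; linarith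
    by_cases hk0 : (i' : ℤ) - i = 0
    · rw [hk0] at hd0 hd1
      have h3 : 2 * t / l ≤ 1 := by rw [div_le_one (by linarith)]; linarith
      have a1 : (0 : ℝ) < ((j - j' : ℤ) : ℝ) := by push_cast at hd0 ⊢; linarith
      have a2 : ((j - j' : ℤ) : ℝ) < 1 := by push_cast at hd1 ⊢; linarith
      have a1' : 0 < j - j' := by exact_mod_cast a1
      have a2' : j - j' < 1 := by exact_mod_cast a2
      omega
    · have := (hg _ hk (j' - j)).1 hk0
      rw [abs_of_pos hd0] at this
      linarith
  · rcases (hg (-((i' : ℤ) - i)) (by rwa [abs_neg]) (j' - j)).2 with h0 | h0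
    · push_cast at h0; linarith
    · rw [abs_of_pos (by push_cast; linarith)] at h0
      push_cast at h0; linarith
  · rcases (hg (((i' : ℤ) - i)) hk (j - j')).2 with h0 | h0
    · push_cast at h0; linarith
    · rw [abs_of_neg (by push_cast; linarith)] at h0
      push_cast at h0; linarith
  · have hd0 : 0 < ((i' : ℤ) - i : ℤ) * α - ((j' - j : ℤ) : ℝ) := by push_cast; linarith
    have hd1 : ((i' : ℤ) - i : ℤ) * α - ((j' - j : ℤ) : ℝ) < 2 * t / l := by push_cast; linarith
    by_cases hk0 : (i' : ℤ) - i = 0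
    · rw [hk0] at hd0 hd1
      have h3 : 2 * t / l ≤ 1 := by rw [div_le_one (by linarith)]; linarith
      have a1 : (0 : ℝ) < ((j - j' : ℤ) : ℝ) := by push_cast at hd0 ⊢; linarith
      have a2 : ((j - j' : ℤ) : ℝ) < 1 := by push_cast at hd1 ⊢; linarith
      have a1' : 0 < j - j' := by exact_mod_cast a1
      have a2' : j - j' < 1 := by exact_mod_cast a2
      omega
    · have := (hg _ hk (j' - j)).1 hk0
      rw [abs_of_pos hd0] at this
      linarith

/-- Linear recurrence of words along a sequence of lengths. -/
def RecurrentAtScales (C : ℕ) (V : ℤ → ℝ) : Prop :=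
  ∀ L : ℕ, ∃ l : ℕ, L ≤ l ∧ 0 < l ∧ ∀ a b : ℤ, ∃ m : ℤ, b ≤ m ∧ m ≤ b + C * l ∧
    ∀ i : ℕ, i < l → V (m + i) = V (a + i)

/-- Arbitrarily long words can be continued in two different ways. -/
def HasRightSpecial (V : ℤ → ℝ) : Prop :=
  ∀ L : ℕ, ∃ a a' : ℤ, (∀ i : ℕ, i < L → V (a + i) = V (a' + i)) ∧ V (a + L) ≠ V (a' + L)

lemma exists_recurrentAtScales {c α β : ℝ} (hc : 0 < c) (h : BadlyApprox c α)
    (hβ : β ∈ Set.Ioo (0 : ℝ) 1) (θ : ℝ) :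
    ∃ C : ℕ, RecurrentAtScales C (fun n => codingFn β (n * α + θ)) := by
  set C : ℕ := ⌈2 * (2 + 1 / c) / (c / 16)⌉₊ with hC
  have hCpos : 0 < C := Nat.ceil_pos.2 (by positivity)
  refine ⟨C, fun L => ?_⟩
  obtain ⟨l, hLl, hl, hg⟩ := exists_goodScale hc h β L
  have hl' : (1 : ℝ) ≤ l := by exact_mod_cast hl
  have hc2 := h.le_half
  refine ⟨l, hLl, hl, fun a b => ?_⟩
  have hdist : (2 + 1 / c) / ((C * l : ℕ) : ℝ) ≤ (c / 16) / l / 2 := by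
    have h1 : 2 * (2 + 1 / c) / (c / 16) ≤ C := Nat.le_ceil _
    rw [div_le_iff₀ (by positivity)] at h1
    rw [div_le_iff₀ (by positivity)]
    push_cast
    have : c / 16 / l / 2 * (C * l) = C * (c / 16) / 2 := by field_simp
    rw [this]; linarith
  set x := a * α + θ with hx
  have fin : ∀ φ : ℝ, ∃ m : ℤ, b ≤ m ∧ m ≤ b + C * l ∧ ∃ j : ℤ,
      |m * α + θ - j - φ| ≤ (c / 16) / l / 2 := by
    intro φ
    obtain ⟨m, h1, h2, j, hj⟩ := exists_near hc h (C * l) (Nat.mul_pos hCpos hl) b (φ - θ)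
    refine ⟨m, h1, by push_cast at h2; omega, j, ?_⟩
    have e : m * α + θ - j - φ = m * α - (φ - θ) - j := by ring
    rw [e]; exact hj.trans hdist
  have conv : ∀ m j : ℤ, (∀ i : ℕ, i < l →
      codingFn β ((m * α + θ - j) + i * α) = codingFn β (x + i * α)) →
      ∀ i : ℕ, i < l → codingFn β (((m + i : ℤ) : ℝ) * α + θ) =
        codingFn β (((a + i : ℤ) : ℝ) * α + θ) := by
    intro m j hh i hi
    have h1 := hh i hi
    have e1 : (m * α + θ - j) + i * α = (((m + i : ℤ) : ℝ) * α + θ) - j := by push_cast; ring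
    have e2 : x + i * α = (((a + i : ℤ) : ℝ) * α + θ) := by rw [hx]; push_cast; ring
    rw [e1, codingFn_sub_int, e2] at h1
    exact h1
  rcases word_const_side hβ hl (by linarith) (by positivity) hg x with hs | hs
  · obtain ⟨m, h1, h2, j, hj⟩ := fin (x + (c / 16) / l / 2)
    rw [abs_le] at hj
    exact ⟨m, h1, h2, conv m j (hs _ (by linarith [hj.1]) (by linarith [hj.2]))⟩
  · obtain ⟨m, h1, h2, j, hj⟩ := fin (x - (c / 16) / l / 2)
    rw [abs_le] at hj
    exact ⟨m, h1, h2, conv m j (hs _ (by linarith [hj.1]) (by linarith [hj.2]))⟩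

lemma eventually_floor_eq {x : ℝ} (hx : ∀ j : ℤ, x ≠ j) : ∀ᶠ y in nhds x, ⌊y⌋ = ⌊x⌋ := by
  have h1 : (⌊x⌋ : ℝ) < x := lt_of_le_of_ne (Int.floor_le x) (hx _).symm
  filter_upwards [Ioo_mem_nhds h1 (Int.lt_floor_add_one x)] with y hy
  exact Int.floor_eq_iff.2 ⟨hy.1.le, hy.2⟩

lemma eventually_codingFn_eq {β : ℝ} (hβ : β ∈ Set.Ioo (0 : ℝ) 1) {x : ℝ}
    (hx : ∀ j : ℤ, x ≠ j) (hx' : ∀ j : ℤ, x ≠ j - β) :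
    ∀ᶠ s in nhds (0 : ℝ), codingFn β (x + s) = codingFn β x := by
  have t1 : Tendsto (fun s : ℝ => x + s) (nhds 0) (nhds x) := by
    have : Continuous (fun s : ℝ => x + s) := by fun_prop
    simpa using this.tendsto 0
  have t2 : Tendsto (fun s : ℝ => x + s + β) (nhds 0) (nhds (x + β)) := by
    have : Continuous (fun s : ℝ => x + s + β) := by fun_prop
    simpa using this.tendsto 0
  filter_upwards [t1.eventually (eventually_floor_eq hx),
    t2.eventually (eventually_floor_eq (x := x + β) (fun j hj => hx' j (by linarith)))] with s h1 h2
  rw [codingFn_eq_floor hβ, codingFn_eq_floor hβ, h1, h2]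

lemma hasRightSpecial {c α β : ℝ} (hc : 0 < c) (h : BadlyApprox c α)
    (hβ : β ∈ Set.Ioo (0 : ℝ) 1) (θ : ℝ) :
    HasRightSpecial (fun n => codingFn β (n * α + θ)) := by
  intro L
  obtain ⟨hβ0, hβ1⟩ := hβ
  have irr : ∀ k : ℤ, k ≠ 0 → ∀ j : ℤ, k * α ≠ j := by
    intro k hk j hkj
    have := h k hk j
    rw [hkj, sub_self, abs_zero] at this
    have : 0 < c / |(k : ℝ)| := div_pos hc (abs_pos.2 (by exact_mod_cast hk))
    linarith
  obtain ⟨e, he, hjump⟩ : ∃ e : ℝ, (∀ j : ℕ, 0 < j → (∀ m : ℤ, e - j * α ≠ m) ∧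
      (∀ m : ℤ, e - j * α ≠ m - β)) ∧ ∃ η > 0, ∀ s s' : ℝ, 0 < s → s < η → 0 < s' → s' < η →
        codingFn β (e + s) ≠ codingFn β (e - s') := by
    have J0 : ∃ η > 0, ∀ s s' : ℝ, 0 < s → s < η → 0 < s' → s' < η →
        codingFn β (0 + s) ≠ codingFn β (0 - s') := by
      refine ⟨min β (1 - β), by simp [hβ0, hβ1], fun s s' h1 h2 h3 h4 => ?_⟩
      rw [lt_min_iff] at h2 h4
      rw [codingFn_eq_floor ⟨hβ0, hβ1⟩, codingFn_eq_floor ⟨hβ0, hβ1⟩,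
        (Int.floor_eq_iff (z := 0)).2, (Int.floor_eq_iff (z := 0)).2,
        (Int.floor_eq_iff (z := 0)).2, (Int.floor_eq_iff (z := -1)).2]
      · simp
      all_goals { push_cast; constructor <;> linarith }
    have J1 : ∃ η > 0, ∀ s s' : ℝ, 0 < s → s < η → 0 < s' → s' < η →
        codingFn β (-β + s) ≠ codingFn β (-β - s') := by
      refine ⟨min β (1 - β), by simp [hβ0, hβ1], fun s s' h1 h2 h3 h4 => ?_⟩
      rw [lt_min_iff] at h2 h4
      rw [codingFn_eq_floor ⟨hβ0, hβ1⟩, codingFn_eq_floor ⟨hβ0, hβ1⟩,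
        (Int.floor_eq_iff (z := 0)).2, (Int.floor_eq_iff (z := -1)).2,
        (Int.floor_eq_iff (z := -1)).2, (Int.floor_eq_iff (z := -1)).2]
      · simp
      all_goals { push_cast; constructor <;> linarith }
    by_cases H0 : ∀ j : ℕ, 0 < j → (∀ m : ℤ, (0 : ℝ) - j * α ≠ m) ∧
      (∀ m : ℤ, (0 : ℝ) - j * α ≠ m - β)
    · exact ⟨0, H0, J0⟩
    by_cases H1 : ∀ j : ℕ, 0 < j → (∀ m : ℤ, -β - j * α ≠ m) ∧
      (∀ m : ℤ, -β - j * α ≠ m - β)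
    · exact ⟨-β, H1, J1⟩
    exfalso
    push Not at H0 H1
    obtain ⟨j0, hj0, H0⟩ := H0
    obtain ⟨j1, hj1, H1⟩ := H1
    obtain ⟨m0, hm0⟩ := H0 (fun m hm => irr j0 (by omega) (-m) (by push_cast; linarith))
    have H1' : ∃ m : ℤ, -β - j1 * α = m := by
      by_contra hno
      push Not at hno
      obtain ⟨m, hm⟩ := H1 hno
      exact irr j1 (by omega) (-m) (by push_cast; linarith)
    obtain ⟨m1, hm1⟩ := H1'
    exact irr (j0 + j1) (by omega) (-(m0 + m1)) (by push_cast; linarith)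
  obtain ⟨η1, hη1, hjump⟩ := hjump
  have hev : ∀ᶠ s in nhds (0 : ℝ), ∀ i ∈ Finset.range L,
      codingFn β (e - ((L - i : ℕ) : ℝ) * α + s) = codingFn β (e - ((L - i : ℕ) : ℝ) * α) := by
    rw [Filter.eventually_all_finset]
    intro i hi
    have hi' := Finset.mem_range.1 hi
    have := he (L - i) (by omega)
    exact eventually_codingFn_eq ⟨hβ0, hβ1⟩ this.1 this.2
  obtain ⟨η2, hη2, hev⟩ := Metric.eventually_nhds_iff.1 hev
  set η := min η1 η2 with hη
  have hη0 : 0 < η := lt_min hη1 hη2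
  set Q : ℕ := ⌈4 * (2 + 1 / c) / η⌉₊ with hQ
  have hQ0 : 0 < Q := Nat.ceil_pos.2 (by positivity)
  have hQη : (2 + 1 / c) / Q ≤ η / 4 := by
    have h1 : 4 * (2 + 1 / c) / η ≤ Q := Nat.le_ceil _
    have : (0 : ℝ) < Q := by exact_mod_cast hQ0
    rw [div_le_iff₀ hη0] at h1
    rw [div_le_iff₀ this]; linarith
  have key : ∀ m j : ℤ, ∀ i : ℕ, i ≤ L → codingFn β (((m + i : ℤ) : ℝ) * α + θ) =
      codingFn β (e - ((L - i : ℕ) : ℝ) * α + (m * α - (e - L * α - θ) - j)) := by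
    intro m j i hi
    rw [← codingFn_sub_int β _ j]
    congr 1
    push_cast [Nat.cast_sub hi]; ring
  obtain ⟨m, -, -, j, hj⟩ := exists_near hc h Q hQ0 0 (e - L * α - θ + η / 2)
  obtain ⟨m', -, -, j', hj'⟩ := exists_near hc h Q hQ0 0 (e - L * α - θ - η / 2)
  have hj := abs_le.1 (hj.trans hQη)
  have hj' := abs_le.1 (hj'.trans hQη)
  set s := m * α - (e - L * α - θ) - j with hs
  set s' := m' * α - (e - L * α - θ) - j' with hs'
  have s1 : 0 < s := by linarith [hj.1]
  have s2 : s < η := by linarith [hj.2]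
  have s3 : 0 < -s' := by linarith [hj'.2]
  have s4 : -s' < η := by linarith [hj'.1]
  refine ⟨m, m', fun i hi => ?_, ?_⟩
  · simp only
    rw [key m j i hi.le, key m' j' i hi.le, hev (y := s) ?_ i (Finset.mem_range.2 hi),
      hev (y := s') ?_ i (Finset.mem_range.2 hi)]
    · rw [Real.dist_0_eq_abs, abs_of_neg (by linarith)]
      exact lt_of_lt_of_le s4 (min_le_right _ _)
    · rw [Real.dist_0_eq_abs, abs_of_pos (by linarith)]
      exact lt_of_lt_of_le s2 (min_le_right _ _)
  · have k1 := key m j L le_rfl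
    have k2 := key m' j' L le_rfl
    have := hjump s (-s') s1 (lt_of_lt_of_le s2 (min_le_left _ _)) s3
      (lt_of_lt_of_le s4 (min_le_left _ _))
    simp only
    rw [k1, k2]
    simpa using this

/-- The entrywise `ℓ¹` norm on 2×2 matrices. -/
def entryNorm (M : Matrix (Fin 2) (Fin 2) ℝ) : ℝ := |M 0 0| + |M 0 1| + |M 1 0| + |M 1 1|

/-- The `ℓ¹` norm on the plane. -/
def planeNorm (v : Fin 2 → ℝ) : ℝ := |v 0| + |v 1|

lemma planeNorm_nonneg (v : Fin 2 → ℝ) : 0 ≤ planeNorm v := by unfold planeNorm; positivity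

lemma entryNorm_nonneg (M : Matrix (Fin 2) (Fin 2) ℝ) : 0 ≤ entryNorm M := by
  unfold entryNorm; positivity

lemma planeNorm_add_le (v w : Fin 2 → ℝ) : planeNorm (v + w) ≤ planeNorm v + planeNorm w := by
  simp only [planeNorm, Pi.add_apply]
  linarith [abs_add_le (v 0) (w 0), abs_add_le (v 1) (w 1)]

lemma abs_dot_le (a b c d : ℝ) : |a * b + c * d| ≤ |a| * |b| + |c| * |d| := by
  rw [← abs_mul, ← abs_mul]; exact abs_add_le _ _

lemma planeNorm_mulVec_le (M : Matrix (Fin 2) (Fin 2) ℝ) (v : Fin 2 → ℝ) :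
    planeNorm (M.mulVec v) ≤ entryNorm M * planeNorm v := by
  simp only [planeNorm, entryNorm, Matrix.mulVec, dotProduct, Fin.sum_univ_two]
  have h1 := abs_dot_le (M 0 0) (v 0) (M 0 1) (v 1)
  have h2 := abs_dot_le (M 1 0) (v 0) (M 1 1) (v 1)
  have : 0 ≤ |M 0 0| * |v 1| + |M 0 1| * |v 0| + |M 1 0| * |v 1| + |M 1 1| * |v 0| := by positivity
  nlinarith

lemma entryNorm_mul_le (M N : Matrix (Fin 2) (Fin 2) ℝ) :
    entryNorm (M * N) ≤ entryNorm M * entryNorm N := by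
  simp only [entryNorm, Matrix.mul_apply, Fin.sum_univ_two]
  have h1 := abs_dot_le (M 0 0) (N 0 0) (M 0 1) (N 1 0)
  have h2 := abs_dot_le (M 0 0) (N 0 1) (M 0 1) (N 1 1)
  have h3 := abs_dot_le (M 1 0) (N 0 0) (M 1 1) (N 1 0)
  have h4 := abs_dot_le (M 1 0) (N 0 1) (M 1 1) (N 1 1)
  have : 0 ≤ |M 0 0| * (|N 1 0| + |N 1 1|) + |M 0 1| * (|N 0 0| + |N 0 1|)
    + |M 1 0| * (|N 1 0| + |N 1 1|) + |M 1 1| * (|N 0 0| + |N 0 1|) := by positivity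
  nlinarith

lemma one_le_entryNorm {M : Matrix (Fin 2) (Fin 2) ℝ} (h : M.det = 1) : 1 ≤ entryNorm M := by
  rw [Matrix.det_fin_two] at h
  have h1 : 1 ≤ |M 0 0| * |M 1 1| + |M 0 1| * |M 1 0| := by
    rw [← abs_mul, ← abs_mul, ← h]
    have := abs_sub (M 0 0 * M 1 1) (M 0 1 * M 1 0)
    exact (le_abs_self _).trans this
  have h2 : 0 ≤ entryNorm M := entryNorm_nonneg M
  have : (1 : ℝ) ≤ entryNorm M ^ 2 := by
    unfold entryNorm
    nlinarith [abs_nonneg (M 0 0), abs_nonneg (M 0 1), abs_nonneg (M 1 0), abs_nonneg (M 1 1),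
      sq_nonneg (|M 0 0| ), sq_nonneg (|M 0 1|), sq_nonneg (|M 1 0|), sq_nonneg (|M 1 1|),
      mul_nonneg (abs_nonneg (M 0 0)) (abs_nonneg (M 0 1)),
      mul_nonneg (abs_nonneg (M 0 0)) (abs_nonneg (M 1 0)),
      mul_nonneg (abs_nonneg (M 0 0)) (abs_nonneg (M 1 1)),
      mul_nonneg (abs_nonneg (M 0 1)) (abs_nonneg (M 1 0)),
      mul_nonneg (abs_nonneg (M 0 1)) (abs_nonneg (M 1 1)),
      mul_nonneg (abs_nonneg (M 1 0)) (abs_nonneg (M 1 1))]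
  nlinarith

lemma entryNorm_adjugate (M : Matrix (Fin 2) (Fin 2) ℝ) :
    entryNorm M.adjugate = entryNorm M := by
  simp only [entryNorm, Matrix.adjugate_fin_two]
  simp; ring

/-- If the product `Q P` is much larger than both factors, every vector is expanded either
by `Q` or by the adjugate of `P`. -/
lemma entryNorm_mul_planeNorm_le (P Q : Matrix (Fin 2) (Fin 2) ℝ) (v : Fin 2 → ℝ) :
    entryNorm (Q * P) * planeNorm v ≤
      2 * (planeNorm (Q.mulVec v) * entryNorm P +
          entryNorm Q * planeNorm (P.adjugate.mulVec v)) := by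
  rcases (planeNorm_nonneg v).eq_or_lt with h0 | h0
  · rw [← h0, mul_zero]
    have := planeNorm_nonneg (Q.mulVec v)
    have := planeNorm_nonneg (P.adjugate.mulVec v)
    have := entryNorm_nonneg P
    have := entryNorm_nonneg Q
    positivity
  set w : Fin 2 → ℝ := ![-v 1, v 0] with hw
  have hwv : planeNorm w = planeNorm v := by simp [planeNorm, hw]; ring
  set X := Q.mulVec v with hX
  set Y := Q.mulVec w with hY
  set p := P.transpose.mulVec v with hp
  set q := P.transpose.mulVec w with hq
  have hq' : planeNorm q = planeNorm (P.adjugate.mulVec v) := by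
    have q0 : q 0 = -(P.adjugate.mulVec v) 1 := by
      simp [hq, hw, Matrix.adjugate_fin_two, Matrix.mulVec, dotProduct, Fin.sum_univ_two]
    have q1 : q 1 = (P.adjugate.mulVec v) 0 := by
      simp [hq, hw, Matrix.adjugate_fin_two, Matrix.mulVec, dotProduct, Fin.sum_univ_two]
      ring
    rw [planeNorm, planeNorm, q0, q1, abs_neg, add_comm]
  have hp' : planeNorm p ≤ entryNorm P * planeNorm v := by
    have := planeNorm_mulVec_le P.transpose v
    have e : entryNorm P.transpose = entryNorm P := by
      simp only [entryNorm, Matrix.transpose_apply]; ring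
    rwa [e] at this
  have hY' : planeNorm Y ≤ entryNorm Q * planeNorm v := hwv ▸ planeNorm_mulVec_le Q w
  have hent : ∀ i j, (v 0 ^ 2 + v 1 ^ 2) * (Q * P) i j = X i * p j + Y i * q j := by
    intro i j
    simp only [hX, hY, hp, hq, hw, Matrix.mulVec, dotProduct, Fin.sum_univ_two, Matrix.mul_apply,
      Matrix.transpose_apply, Matrix.cons_val_zero, Matrix.cons_val_one, Matrix.cons_val_fin_one]
    ring
  have habs : ∀ i j, (v 0 ^ 2 + v 1 ^ 2) * |(Q * P) i j| ≤ |X i| * |p j| + |Y i| * |q j| := by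
    intro i j
    have h1 : (0 : ℝ) ≤ v 0 ^ 2 + v 1 ^ 2 := by positivity
    calc (v 0 ^ 2 + v 1 ^ 2) * |(Q * P) i j| = |(v 0 ^ 2 + v 1 ^ 2) * (Q * P) i j| := by
          rw [abs_mul, abs_of_nonneg h1]
      _ ≤ _ := by rw [hent]; exact abs_dot_le _ _ _ _
  have hsum : (v 0 ^ 2 + v 1 ^ 2) * entryNorm (Q * P) ≤
      planeNorm X * planeNorm p + planeNorm Y * planeNorm q := by
    unfold planeNorm
    rw [entryNorm]
    linarith [habs 0 0, habs 0 1, habs 1 0, habs 1 1]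
  have hcs : planeNorm v ^ 2 ≤ 2 * (v 0 ^ 2 + v 1 ^ 2) := by
    unfold planeNorm
    nlinarith [sq_abs (v 0), sq_abs (v 1), sq_nonneg (|v 0| - |v 1|)]
  have h1 : planeNorm v ^ 2 * entryNorm (Q * P) ≤
      2 * (planeNorm X * (entryNorm P * planeNorm v) +
        entryNorm Q * planeNorm v * planeNorm q) := by
    have a1 : planeNorm X * planeNorm p ≤ planeNorm X * (entryNorm P * planeNorm v) :=
      mul_le_mul_of_nonneg_left hp' (planeNorm_nonneg _)
    have a2 : planeNorm Y * planeNorm q ≤ entryNorm Q * planeNorm v * planeNorm q :=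
      mul_le_mul_of_nonneg_right hY' (planeNorm_nonneg _)
    have a3 := mul_le_mul_of_nonneg_right hcs (entryNorm_nonneg (Q * P))
    linarith
  rw [← hq']
  refine le_of_mul_le_mul_left ?_ h0
  linarith

/-- The one-step transfer matrix at site `n`. -/
def stepMat (V : ℤ → ℝ) (E : ℝ) (n : ℤ) : Matrix (Fin 2) (Fin 2) ℝ := !![E - V n, -1; 1, 0]

/-- The transfer matrix over `n` sites starting at `a`. -/
def transferProd (V : ℤ → ℝ) (E : ℝ) (a : ℤ) : ℕ → Matrix (Fin 2) (Fin 2) ℝ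
  | 0 => 1
  | n + 1 => stepMat V E (a + n) * transferProd V E a n

lemma transferProd_add (V : ℤ → ℝ) (E : ℝ) (a : ℤ) (n m : ℕ) :
    transferProd V E a (n + m) = transferProd V E (a + n) m * transferProd V E a n := by
  induction m with
  | zero => simp [transferProd]
  | succ m ih =>
    rw [← add_assoc, transferProd, ih, transferProd, Matrix.mul_assoc]
    congr 2; push_cast; ring

lemma transferProd_congr {V : ℤ → ℝ} {E : ℝ} {a b : ℤ} {n : ℕ}
    (h : ∀ i : ℕ, i < n → V (a + i) = V (b + i)) :
    transferProd V E a n = transferProd V E b n := by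
  induction n with
  | zero => rfl
  | succ n ih =>
    rw [transferProd, transferProd, ih fun i hi => h i (by omega), stepMat, stepMat,
      h n (by omega)]

lemma det_transferProd (V : ℤ → ℝ) (E : ℝ) (a : ℤ) (n : ℕ) : (transferProd V E a n).det = 1 := by
  induction n with
  | zero => simp [transferProd]
  | succ n ih => rw [transferProd, Matrix.det_mul, ih, stepMat, Matrix.det_fin_two]; simp

lemma entryNorm_stepMat_le {V : ℤ → ℝ} (hV : ∀ n, |V n| ≤ 1) (E : ℝ) (n : ℤ) :
    entryNorm (stepMat V E n) ≤ |E| + 3 := by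
  simp only [entryNorm, stepMat]
  simp
  have := abs_sub E (V n)
  linarith [hV n]

lemma entryNorm_transferProd_le {V : ℤ → ℝ} (hV : ∀ n, |V n| ≤ 1) (E : ℝ) (a : ℤ) (n : ℕ) :
    entryNorm (transferProd V E a n) ≤ 2 * (|E| + 3) ^ n := by
  induction n with
  | zero => simp [transferProd, entryNorm]; norm_num
  | succ n ih =>
    rw [transferProd, pow_succ]
    refine (entryNorm_mul_le _ _).trans ?_
    have := entryNorm_stepMat_le hV E (a + n)
    have h0 := entryNorm_nonneg (transferProd V E a n)
    have : 0 ≤ |E| + 3 := by positivity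
    calc _ ≤ (|E| + 3) * (2 * (|E| + 3) ^ n) := by gcongr
      _ = _ := by ring

lemma one_le_entryNorm_transferProd (V : ℤ → ℝ) (E : ℝ) (a : ℤ) (n : ℕ) :
    1 ≤ entryNorm (transferProd V E a n) := one_le_entryNorm (det_transferProd V E a n)

/-- The largest logarithmic growth of transfer matrices of length `n`. -/
noncomputable def growth (V : ℤ → ℝ) (E : ℝ) (n : ℕ) : ℝ :=
  ⨆ a : ℤ, Real.log (entryNorm (transferProd V E a n))

lemma bddAbove_log_entryNorm {V : ℤ → ℝ} (hV : ∀ n, |V n| ≤ 1) (E : ℝ) (n : ℕ) :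
    BddAbove (range fun a : ℤ => Real.log (entryNorm (transferProd V E a n))) := by
  refine ⟨Real.log (2 * (|E| + 3) ^ n), ?_⟩
  rintro _ ⟨a, rfl⟩
  exact Real.log_le_log (by linarith [one_le_entryNorm_transferProd V E a n])
    (entryNorm_transferProd_le hV E a n)

lemma log_entryNorm_le_growth {V : ℤ → ℝ} (hV : ∀ n, |V n| ≤ 1) (E : ℝ) (a : ℤ) (n : ℕ) :
    Real.log (entryNorm (transferProd V E a n)) ≤ growth V E n :=
  le_ciSup (bddAbove_log_entryNorm hV E n) a

lemma growth_nonneg {V : ℤ → ℝ} (hV : ∀ n, |V n| ≤ 1) (E : ℝ) (n : ℕ) : 0 ≤ growth V E n :=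
  (Real.log_nonneg (one_le_entryNorm_transferProd V E 0 n)).trans
    (log_entryNorm_le_growth hV E 0 n)

lemma log_entryNorm_add_le (V : ℤ → ℝ) (E : ℝ) (a : ℤ) (n m : ℕ) :
    Real.log (entryNorm (transferProd V E a (n + m))) ≤
      Real.log (entryNorm (transferProd V E a n)) +
      Real.log (entryNorm (transferProd V E (a + n) m)) := by
  have h1 := one_le_entryNorm_transferProd V E a n
  have h2 := one_le_entryNorm_transferProd V E (a + n) m
  rw [← Real.log_mul (by linarith) (by linarith), transferProd_add, mul_comm (entryNorm _)]
  refine Real.log_le_log ?_ (entryNorm_mul_le _ _)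
  rw [← transferProd_add]
  linarith [one_le_entryNorm_transferProd V E a (n + m)]

lemma subadditive_growth {V : ℤ → ℝ} (hV : ∀ n, |V n| ≤ 1) (E : ℝ) : Subadditive (growth V E) := by
  intro m n
  refine ciSup_le fun a => (log_entryNorm_add_le V E a m n).trans ?_
  exact add_le_add (log_entryNorm_le_growth hV E _ _) (log_entryNorm_le_growth hV E _ _)

lemma bddBelow_growth {V : ℤ → ℝ} (hV : ∀ n, |V n| ≤ 1) (E : ℝ) :
    BddBelow (range fun n => growth V E n / n) := by
  refine ⟨0, ?_⟩
  rintro _ ⟨n, rfl⟩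
  exact div_nonneg (growth_nonneg hV E n) (Nat.cast_nonneg n)

/-- Positive exponential growth at `E` together with recurrence produces uniform expansion. -/
lemma exists_expansion {V : ℤ → ℝ} (hV : ∀ n, |V n| ≤ 1) {C : ℕ}
    (hR : RecurrentAtScales C V) (E : ℝ)
    (hΛ : 0 < (subadditive_growth hV E).lim) :
    ∃ p q : ℕ, ∀ x : ℤ, ∀ v : Fin 2 → ℝ, 3 * planeNorm v ≤
      planeNorm ((transferProd V E x q).mulVec v) +
      planeNorm ((transferProd V E (x - p) p).adjugate.mulVec v) := by
  set Λ := (subadditive_growth hV E).lim with hΛdef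
  set ε := Λ / (4 * (C + 1)) with hε
  have hε0 : 0 < ε := by positivity
  obtain ⟨K, hK0, hK⟩ : ∃ K : ℝ, 0 ≤ K ∧ ∀ n, growth V E n ≤ (Λ + ε) * n + K := by
    have ht := (subadditive_growth hV E).tendsto_lim (bddBelow_growth hV E)
    have hev := ht.eventually (gt_mem_nhds (show Λ < Λ + ε by linarith))
    obtain ⟨N, hN⟩ := eventually_atTop.1 hev
    refine ⟨∑ n ∈ Finset.range (N + 1), growth V E n,
      Finset.sum_nonneg fun n _ => growth_nonneg hV E n, fun n => ?_⟩
    have hs : 0 ≤ ∑ n ∈ Finset.range (N + 1), growth V E n :=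
      Finset.sum_nonneg fun n _ => growth_nonneg hV E n
    by_cases hn : n < N + 1
    · have h1 := Finset.single_le_sum (f := growth V E) (fun n _ => growth_nonneg hV E n)
        (Finset.mem_range.2 hn)
      have : 0 ≤ (Λ + ε) * n := by positivity
      linarith
    · have h1 := hN n (by omega)
      have hn0 : (0 : ℝ) < n := by exact_mod_cast (by omega : 0 < n)
      rw [div_lt_iff₀ hn0] at h1
      linarith
  obtain ⟨L, hL⟩ := exists_nat_gt ((3 + 3 * K + 1 + (Λ + ε)) / (Λ / 4))
  obtain ⟨l, hLl, hl, hrec⟩ := hR L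
  have hl1 : 3 + 3 * K + 1 + (Λ + ε) ≤ Λ / 4 * l := by
    rw [div_lt_iff₀ (by positivity)] at hL
    have : (L : ℝ) ≤ l := by exact_mod_cast hLl
    nlinarith
  have hlow : ∀ a : ℤ, Λ * l - ε * C * l - 2 * K - 1 ≤
      Real.log (entryNorm (transferProd V E a l)) := by
    intro a
    set n := C * l + l with hn
    have hn0 : n ≠ 0 := by omega
    have h1 := (subadditive_growth hV E).lim_le_div (bddBelow_growth hV E) hn0
    rw [← hΛdef, le_div_iff₀ (by positivity)] at h1
    obtain ⟨b, hb⟩ := exists_lt_of_lt_ciSup (show growth V E n - 1 < growth V E n by linarith)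
    obtain ⟨m, hm1, hm2, hm3⟩ := hrec a b
    obtain ⟨d, rfl⟩ : ∃ d : ℕ, m = b + d := ⟨(m - b).toNat, by omega⟩
    have hd : d ≤ C * l := by zify; linarith
    obtain ⟨r, hr⟩ : ∃ r, C * l = d + r := ⟨C * l - d, by omega⟩
    have hn' : n = d + (l + r) := by omega
    have e1 := log_entryNorm_add_le V E b d (l + r)
    have e2 := log_entryNorm_add_le V E (b + d) l r
    rw [transferProd_congr (a := b + d) (b := a) hm3] at e2
    have e3 := (log_entryNorm_le_growth hV E b d).trans (hK d)
    have e4 := (log_entryNorm_le_growth hV E (b + d + l) r).trans (hK r)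
    rw [← hn'] at e1
    have hC : (C : ℝ) * l = d + r := by exact_mod_cast hr
    have hnR : (n : ℝ) = C * l + l := by rw [hn]; push_cast; ring
    rw [hnR] at h1
    have : (Λ + ε) * (d + r) = (Λ + ε) * (C * l) := by rw [hC]
    nlinarith
  set h := l / 2 with hh
  obtain ⟨q, hq⟩ : ∃ q, l = h + q := ⟨l - h, by omega⟩
  have hh1 : (h : ℝ) ≤ l / 2 := by rw [hh]; exact Nat.cast_div_le
  have hq1 : (q : ℝ) ≤ (l + 1) / 2 := by
    have : 2 * q ≤ l + 1 := by omega
    have : (2 : ℝ) * q ≤ l + 1 := by exact_mod_cast this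
    linarith
  refine ⟨h, q, fun x v => ?_⟩
  set P := transferProd V E (x - h) h with hP
  set Q := transferProd V E x q with hQ
  have hQP : Q * P = transferProd V E (x - h) l := by
    rw [hq, transferProd_add, hP, hQ]; congr 2; ring
  have h1 := entryNorm_mul_planeNorm_le P Q v
  have hlowl := hlow (x - h)
  rw [← hQP] at hlowl
  have hP1 := one_le_entryNorm_transferProd V E (x - h) h
  have hQ1 := one_le_entryNorm_transferProd V E x q
  have hQP1 : 1 ≤ entryNorm (Q * P) := hQP ▸ one_le_entryNorm_transferProd V E (x - h) l
  set M := Real.exp ((Λ + ε) * ((l + 1) / 2) + K) with hM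
  have hPM : entryNorm P ≤ M := by
    rw [← Real.log_le_iff_le_exp (by linarith)]
    refine ((log_entryNorm_le_growth hV E _ _).trans (hK h)).trans ?_
    have : (h : ℝ) ≤ (l + 1) / 2 := by linarith
    have : (Λ + ε) * h ≤ (Λ + ε) * ((l + 1) / 2) := by gcongr
    linarith
  have hQM : entryNorm Q ≤ M := by
    rw [← Real.log_le_iff_le_exp (by linarith)]
    refine ((log_entryNorm_le_growth hV E _ _).trans (hK q)).trans ?_
    have : (Λ + ε) * q ≤ (Λ + ε) * ((l + 1) / 2) := by gcongr
    linarith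
  have hbig : 6 * M ≤ entryNorm (Q * P) := by
    have e6 : (6 : ℝ) ≤ Real.exp 3 := by
      have := Real.add_one_le_exp (1 : ℝ)
      have e : Real.exp 3 = Real.exp 1 * Real.exp 1 * Real.exp 1 := by
        rw [← Real.exp_add, ← Real.exp_add]; norm_num
      rw [e]; nlinarith
    have : Real.exp 3 * M ≤ entryNorm (Q * P) := by
      rw [hM, ← Real.exp_add, ← Real.le_log_iff_exp_le (by linarith)]
      refine le_trans ?_ hlowl
      have hεC : ε * (C + 1) = Λ / 4 := by rw [hε]; field_simp
      have : ε * C * l = Λ / 4 * l - ε * l := by rw [← hεC]; ring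
      nlinarith [mul_pos hε0 (show (0 : ℝ) < l by exact_mod_cast hl)]
    have hM0 : 0 < M := Real.exp_pos _
    nlinarith
  have hM0 : 0 < M := Real.exp_pos _
  have hv := planeNorm_nonneg v
  have hX := planeNorm_nonneg (Q.mulVec v)
  have hY := planeNorm_nonneg (P.adjugate.mulVec v)
  have h2 : 6 * M * planeNorm v ≤
      2 * (planeNorm (Q.mulVec v) * M + M * planeNorm (P.adjugate.mulVec v)) := by
    calc 6 * M * planeNorm v ≤ entryNorm (Q * P) * planeNorm v := by gcongr
      _ ≤ _ := h1
      _ ≤ _ := by gcongr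
  refine le_of_mul_le_mul_left (a := M) ?_ hM0
  linarith

section Hilbert
open scoped InnerProductSpace
variable {F : Type*} [NormedAddCommGroup F] [InnerProductSpace ℝ F]

lemma isUnit_of_symmetric_of_le [CompleteSpace F] (T : F →L[ℝ] F)
    (hT : ∀ u v, ⟪T u, v⟫_ℝ = ⟪u, T v⟫_ℝ)
    {c : ℝ} (hc : 0 < c) (h : ∀ u, c * ‖u‖ ≤ ‖T u‖) : IsUnit T := by
  have h2 : IsUnit (T * T) := by
    refine ContinuousLinearMap.isUnit_of_forall_le_norm_inner_map (T * T)
      (c := ⟨c ^ 2, by positivity⟩) (by exact_mod_cast (by positivity : 0 < c ^ 2)) fun x => ?_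
    have e : ⟪(T * T) x, x⟫_ℝ = ‖T x‖ ^ 2 := by
      rw [mul_apply_eq_comp, hT, real_inner_self_eq_norm_sq]
    rw [e]
    change ‖x‖ ^ 2 * c ^ 2 ≤ ‖‖T x‖ ^ 2‖
    rw [norm_pow, norm_norm]
    have := h x
    have h0 : 0 ≤ c * ‖x‖ := by positivity
    nlinarith
  exact ((Commute.refl T).isUnit_mul_iff.1 h2).1

lemma exists_le_of_isUnit (T : F →L[ℝ] F) (h : IsUnit T) : ∃ C > 0, ∀ u, ‖u‖ ≤ C * ‖T u‖ := by
  obtain ⟨W, rfl⟩ := h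
  refine ⟨‖(↑W⁻¹ : F →L[ℝ] F)‖ + 1, by positivity, fun u => ?_⟩
  have e : u = (↑W⁻¹ : F →L[ℝ] F) ((W : F →L[ℝ] F) u) := by
    rw [← mul_apply_eq_comp, Units.inv_mul]; rfl
  calc ‖u‖ = ‖(↑W⁻¹ : F →L[ℝ] F) ((W : F →L[ℝ] F) u)‖ := by rw [← e]
    _ ≤ ‖(↑W⁻¹ : F →L[ℝ] F)‖ * ‖(W : F →L[ℝ] F) u‖ := ContinuousLinearMap.le_opNorm _ _
    _ ≤ _ := by gcongr; linarith

/-- A positive symmetric operator satisfies `‖Q u‖² ≤ ‖Q‖ ⟪Q u, u⟫`. -/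
lemma norm_sq_le_of_nonneg (Q : F →L[ℝ] F) (hQ : ∀ u v, ⟪Q u, v⟫_ℝ = ⟪u, Q v⟫_ℝ)
    (hpos : ∀ u, 0 ≤ ⟪Q u, u⟫_ℝ) (u : F) : ‖Q u‖ ^ 2 ≤ ‖Q‖ * ⟪Q u, u⟫_ℝ := by
  set v := Q u with hv
  have h1 : ∀ t : ℝ, 0 ≤ ⟪Q v, v⟫_ℝ * (t * t) + 2 * ‖v‖ ^ 2 * t + ⟪Q u, u⟫_ℝ := by
    intro t
    have := hpos (u + t • v)
    have e : ⟪Q (u + t • v), u + t • v⟫_ℝ =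
        ⟪Q v, v⟫_ℝ * (t * t) + 2 * ‖v‖ ^ 2 * t + ⟪Q u, u⟫_ℝ := by
      simp only [map_add, map_smul, inner_add_left, inner_add_right, real_inner_smul_left,
        real_inner_smul_right]
      rw [hQ v u, ← hv, real_inner_self_eq_norm_sq]; ring
    rwa [e] at this
  have h2 := discrim_le_zero h1
  rw [discrim] at h2
  have h3 : ⟪Q v, v⟫_ℝ ≤ ‖Q‖ * ‖v‖ ^ 2 := by
    calc ⟪Q v, v⟫_ℝ ≤ ‖Q v‖ * ‖v‖ := real_inner_le_norm _ _
      _ ≤ ‖Q‖ * ‖v‖ * ‖v‖ := by gcongr; exact Q.le_opNorm v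
      _ = _ := by ring
  have h4 := hpos u
  rcases (sq_nonneg ‖v‖).eq_or_lt with h0 | h0
  · rw [← h0]; positivity
  · refine le_of_mul_le_mul_left (a := ‖v‖ ^ 2) ?_ h0
    have := mul_le_mul_of_nonneg_right h3 h4
    rw [← hv] at *
    nlinarith

/-- A symmetric operator without spectrum in `(-d, d)` is bounded below by `d`. -/
lemma le_norm_of_isUnit_sub (S : F →L[ℝ] F) (hS : ∀ u v, ⟪S u, v⟫_ℝ = ⟪u, S v⟫_ℝ)
    {d : ℝ} (hd : ∀ s : ℝ, |s| < d → IsUnit (S - algebraMap ℝ _ s)) (u : F) :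
    d * ‖u‖ ≤ ‖S u‖ := by
  by_contra hcon
  push Not at hcon
  have hu0 : 0 < ‖u‖ := by
    rw [norm_pos_iff]; rintro rfl; simp at hcon
  set A : Set ℝ := (fun v : F => ‖S v‖ / ‖v‖) '' {v | v ≠ 0} with hA
  have hAne : A.Nonempty := ⟨_, u, norm_pos_iff.1 hu0, rfl⟩
  have hAb : BddBelow A := ⟨0, by rintro _ ⟨v, -, rfl⟩; positivity⟩
  set m := sInf A with hm
  have hm0 : 0 ≤ m := le_csInf hAne (by rintro _ ⟨v, -, rfl⟩; positivity)
  have hmd : m < d := by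
    refine lt_of_le_of_lt (csInf_le hAb ⟨u, norm_pos_iff.1 hu0, rfl⟩) ?_
    simp only
    rwa [div_lt_iff₀ hu0]
  have hmle : ∀ v, m * ‖v‖ ≤ ‖S v‖ := by
    intro v
    by_cases hv : v = 0
    · simp [hv]
    · rw [← le_div_iff₀ (norm_pos_iff.2 hv)]
      exact csInf_le hAb ⟨v, hv, rfl⟩
  set Q := (S - algebraMap ℝ _ m) * (S - algebraMap ℝ _ (-m)) with hQ
  have hQu : ∀ v, Q v = S (S v) - (m ^ 2) • v := by
    intro v
    simp only [hQ, mul_apply_eq_comp, Algebra.algebraMap_eq_smul_one]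
    simp
    module
  have hQunit : IsUnit Q := (hd m (by rwa [abs_of_nonneg hm0])).mul
    (hd (-m) (by rwa [abs_neg, abs_of_nonneg hm0]))
  have hQsym : ∀ v w, ⟪Q v, w⟫_ℝ = ⟪v, Q w⟫_ℝ := by
    intro v w
    rw [hQu, hQu, inner_sub_left, inner_sub_right, hS, hS, real_inner_smul_left,
      real_inner_smul_right]
  have hQval : ∀ v, ⟪Q v, v⟫_ℝ = ‖S v‖ ^ 2 - m ^ 2 * ‖v‖ ^ 2 := by
    intro v
    rw [hQu, inner_sub_left, hS, real_inner_smul_left, real_inner_self_eq_norm_sq,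
      real_inner_self_eq_norm_sq]
  have hQpos : ∀ v, 0 ≤ ⟪Q v, v⟫_ℝ := by
    intro v
    rw [hQval]
    have := hmle v
    have : 0 ≤ m * ‖v‖ := by positivity
    nlinarith
  obtain ⟨C, hC, hCu⟩ := exists_le_of_isUnit Q hQunit
  set B := C ^ 2 * ‖Q‖ + 1 with hB
  have hB0 : 0 < B := by positivity
  have hbig : ∀ v, (m ^ 2 + 1 / B) * ‖v‖ ^ 2 ≤ ‖S v‖ ^ 2 := by
    intro v
    have h1 := norm_sq_le_of_nonneg Q hQsym hQpos v
    have h2 := hCu v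
    have h3 : ‖v‖ ^ 2 ≤ C ^ 2 * ‖Q v‖ ^ 2 := by
      rw [← mul_pow]; gcongr
    have h4 : ‖v‖ ^ 2 ≤ B * ⟪Q v, v⟫_ℝ := by
      have := hQpos v
      have h5 : C ^ 2 * ‖Q v‖ ^ 2 ≤ C ^ 2 * (‖Q‖ * ⟪Q v, v⟫_ℝ) := by gcongr
      rw [hB]; nlinarith
    have h6 : 1 / B * ‖v‖ ^ 2 ≤ ⟪Q v, v⟫_ℝ := by
      rw [div_mul_eq_mul_div, one_mul, div_le_iff₀ hB0]; linarith
    rw [hQval] at h6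
    linarith
  have hsq : Real.sqrt (m ^ 2 + 1 / B) ≤ m := by
    refine le_csInf hAne ?_
    rintro _ ⟨v, hv, rfl⟩
    simp only
    have hv' : 0 < ‖v‖ := norm_pos_iff.2 hv
    rw [le_div_iff₀ hv', ← abs_of_nonneg (norm_nonneg (S v)), ← Real.sqrt_sq_eq_abs]
    have := Real.sqrt_le_sqrt (hbig v)
    rwa [Real.sqrt_mul (by positivity), Real.sqrt_sq hv'.le] at this
  have h7 := (Real.sqrt_le_left hm0).1 hsq
  have : 0 < 1 / B := by positivity
  linarith

/-- If `0` is at most an isolated point of the spectrum of a symmetric operator, then the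
operator is bounded below on the orthogonal complement of its kernel. -/
lemma exists_ker_near [CompleteSpace F] (T : F →L[ℝ] F) (hT : ∀ u v, ⟪T u, v⟫_ℝ = ⟪u, T v⟫_ℝ)
    {d : ℝ} (hd0 : 0 < d)
    (hd : ∀ s : ℝ, s ≠ 0 → |s| < d → IsUnit (T - algebraMap ℝ _ s)) (u : F) :
    ∃ v, T v = 0 ∧ d * ‖u - v‖ ≤ ‖T u‖ := by
  have hTT : ∀ w, d * ‖T w‖ ≤ ‖T (T w)‖ := by
    intro w
    set σ := d ^ 2 / 2 with hσ
    have hσ0 : 0 < σ := by positivity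
    have hSu : ∀ v, (T * T - algebraMap ℝ _ σ) v = T (T v) - σ • v := by
      intro v
      simp [Algebra.algebraMap_eq_smul_one]
    have h1 := le_norm_of_isUnit_sub (T * T - algebraMap ℝ _ σ) (fun v w => by
      rw [hSu, hSu, inner_sub_left, inner_sub_right, hT, hT, real_inner_smul_left,
        real_inner_smul_right]) (d := σ) (fun s hs => by
        have hs' := abs_lt.1 hs
        set r := Real.sqrt (σ + s) with hr
        have hr2 : r * r = σ + s := Real.mul_self_sqrt (by linarith)
        have hr0 : 0 < r := Real.sqrt_pos.2 (by linarith)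
        have hrd : r < d := by nlinarith
        have e : T * T - algebraMap ℝ (F →L[ℝ] F) σ - algebraMap ℝ _ s =
            (T - algebraMap ℝ _ r) * (T - algebraMap ℝ _ (-r)) := by
          ext v
          have : s • v = (r * r) • v - σ • v := by rw [hr2]; module
          simp only [mul_apply_eq_comp, Algebra.algebraMap_eq_smul_one]
          simp
          rw [this]
          module
        rw [e]
        exact (hd r hr0.ne' (by rwa [abs_of_pos hr0])).mul
          (hd (-r) (by linarith) (by rwa [abs_neg, abs_of_pos hr0]))) w
    rw [hSu] at h1
    have h2 : ‖T (T w) - σ • w‖ ^ 2 = ‖T (T w)‖ ^ 2 - 2 * σ * ‖T w‖ ^ 2 + σ ^ 2 * ‖w‖ ^ 2 := by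
      rw [norm_sub_sq_real, real_inner_smul_right, hT, real_inner_self_eq_norm_sq, norm_smul,
        Real.norm_of_nonneg hσ0.le]; ring
    have h3 : (σ * ‖w‖) ^ 2 ≤ ‖T (T w) - σ • w‖ ^ 2 := by gcongr
    rw [h2] at h3
    have h4 : (d * ‖T w‖) ^ 2 ≤ ‖T (T w)‖ ^ 2 := by
      rw [mul_pow]; nlinarith
    exact le_of_sq_le_sq h4 (norm_nonneg _)
  set K : Submodule ℝ F := LinearMap.ker T.toLinearMap with hK
  have hKc : IsClosed (K : Set F) := T.isClosed_ker
  have : CompleteSpace K := hKc.completeSpace_coe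
  refine ⟨K.starProjection u, ?_, ?_⟩
  · have := K.starProjection_apply_mem u
    exact LinearMap.mem_ker.1 this
  set w := u - K.starProjection u with hw
  have hTw : T u = T w := by
    have : T (K.starProjection u) = 0 := LinearMap.mem_ker.1 (K.starProjection_apply_mem u)
    rw [hw, map_sub, this, sub_zero]
  rw [hTw]
  have hwK : w ∈ Kᗮ := K.sub_starProjection_mem_orthogonal u
  have hrange : (LinearMap.range T.toLinearMap)ᗮ ≤ K := by
    intro z hz
    rw [Submodule.mem_orthogonal] at hz
    rw [hK, LinearMap.mem_ker]
    have h1 := hz (T (T z)) ⟨T z, rfl⟩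
    rw [hT, real_inner_self_eq_norm_sq] at h1
    exact norm_eq_zero.1 (pow_eq_zero_iff two_ne_zero |>.1 h1)
  have hwc : w ∈ (LinearMap.range T.toLinearMap).topologicalClosure := by
    rw [← Submodule.orthogonal_orthogonal_eq_closure]
    exact Submodule.orthogonal_le hrange hwK
  have hclosed : IsClosed {z : F | d * ‖z‖ ≤ ‖T z‖} :=
    isClosed_le (by fun_prop) (by fun_prop)
  have hsub : closure (LinearMap.range T.toLinearMap : Set F) ⊆ {z : F | d * ‖z‖ ≤ ‖T z‖} := by
    refine closure_minimal ?_ hclosed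
    rintro _ ⟨z, rfl⟩
    exact hTT z
  exact hsub hwc

end Hilbert

section Operator
open scoped InnerProductSpace

lemma memlp_two_iff (f : ℤ → ℝ) : Memℓp f 2 ↔ Summable fun n => f n ^ 2 := by
  rw [memℓp_gen_iff (by norm_num)]
  simp

lemma summable_sq (u : lp (fun _ : ℤ => ℝ) 2) : Summable fun n => u n ^ 2 :=
  (memlp_two_iff _).1 (lp.memℓp u)

lemma norm_sq_eq_tsum (u : lp (fun _ : ℤ => ℝ) 2) : ‖u‖ ^ 2 = ∑' n, u n ^ 2 := by
  have := lp.norm_rpow_eq_tsum (p := 2) (by norm_num) u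
  simpa using this

lemma summable_shift {f : ℤ → ℝ} (h : Summable f) (t : ℤ) : Summable fun n => f (n + t) :=
  (Equiv.addRight t).summable_iff.2 h

lemma tsum_shift (f : ℤ → ℝ) (t : ℤ) : ∑' n, f (n + t) = ∑' n, f n :=
  (Equiv.addRight t).tsum_eq f

lemma summable_mul_of_sq {f g : ℤ → ℝ} (hf : Summable fun n => f n ^ 2)
    (hg : Summable fun n => g n ^ 2) : Summable fun n => f n * g n := by
  refine Summable.of_norm_bounded (hf.add hg) fun n => ?_
  rw [Real.norm_eq_abs, abs_mul]
  nlinarith [sq_abs (f n), sq_abs (g n), sq_nonneg (|f n| - |g n|), sq_nonneg (f n),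
    sq_nonneg (g n)]

lemma abs_apply_le_norm (u : lp (fun _ : ℤ => ℝ) 2) (n : ℤ) : |u n| ≤ ‖u‖ :=
  lp.norm_apply_le_norm (by norm_num) u n

variable {V : ℤ → ℝ} {H : lp (fun _ : ℤ => ℝ) 2 →L[ℝ] lp (fun _ : ℤ => ℝ) 2}

lemma schrodinger_inner_symm (hH : IsSchrodingerOp V H) (hV : ∀ n, |V n| ≤ 1)
    (u v : lp (fun _ : ℤ => ℝ) 2) : ⟪H u, v⟫_ℝ = ⟪u, H v⟫_ℝ := by
  have key : ∀ u v : lp (fun _ : ℤ => ℝ) 2, ⟪H u, v⟫_ℝ =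
      (∑' n, u (n + 1) * v n) + (∑' n, u n * v (n + 1)) + ∑' n, V n * u n * v n := by
    intro u v
    have s1 : Summable fun n => u (n + 1) * v n :=
      summable_mul_of_sq (summable_shift (summable_sq u) 1) (summable_sq v)
    have s2 : Summable fun n => u (n - 1) * v n :=
      summable_mul_of_sq (summable_shift (summable_sq u) (-1)) (summable_sq v)
    have s3 : Summable fun n => V n * u n * v n := by
      refine summable_mul_of_sq ?_ (summable_sq v)
      refine Summable.of_nonneg_of_le (fun n => sq_nonneg _) (fun n => ?_) (summable_sq u)
      rw [mul_pow]
      have : V n ^ 2 ≤ 1 := by rw [← sq_abs]; nlinarith [hV n, abs_nonneg (V n)]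
      nlinarith [sq_nonneg (u n)]
    have e2 : ∑' n, u n * v (n + 1) = ∑' n, u (n - 1) * v n := by
      rw [← tsum_shift (fun n => u (n - 1) * v n) 1]
      simp
    rw [e2, ← s1.tsum_add s2, ← (s1.add s2).tsum_add s3, lp.inner_eq_tsum]
    refine tsum_congr fun n => ?_
    rw [hH u n]
    simp
    ring
  rw [key, real_inner_comm, key]
  have e1 : ∀ n, v (n + 1) * u n = u n * v (n + 1) := fun n => mul_comm _ _
  have e2 : ∀ n, v n * u (n + 1) = u (n + 1) * v n := fun n => mul_comm _ _
  have e3 : ∀ n, V n * v n * u n = V n * u n * v n := fun n => by ring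
  simp only [e1, e2, e3]
  ring

lemma schrodinger_sub_apply (hH : IsSchrodingerOp V H) (E : ℝ)
    (u : lp (fun _ : ℤ => ℝ) 2) (n : ℤ) :
    ((H - algebraMap ℝ (lp (fun _ : ℤ => ℝ) 2 →L[ℝ] lp (fun _ : ℤ => ℝ) 2) E) u) n =
      u (n + 1) + u (n - 1) + (V n - E) * u n := by
  have := hH u n
  simp only [Algebra.algebraMap_eq_smul_one]
  change H u n - E * u n = _
  rw [this]; ring

lemma schrodinger_sub_symm (hH : IsSchrodingerOp V H) (hV : ∀ n, |V n| ≤ 1) (E : ℝ)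
    (u v : lp (fun _ : ℤ => ℝ) 2) :
    ⟪(H - algebraMap ℝ (lp (fun _ : ℤ => ℝ) 2 →L[ℝ] lp (fun _ : ℤ => ℝ) 2) E) u, v⟫_ℝ =
    ⟪u, (H - algebraMap ℝ (lp (fun _ : ℤ => ℝ) 2 →L[ℝ] lp (fun _ : ℤ => ℝ) 2) E) v⟫_ℝ := by
  simp only [Algebra.algebraMap_eq_smul_one, _root_.sub_apply,
    smul_apply, one_apply_eq_self, inner_sub_left, inner_sub_right,
    real_inner_smul_left, real_inner_smul_right, schrodinger_inner_symm hH hV]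

/-- Comparison of an approximate solution with the transfer matrices. -/
lemma planeNorm_sub_transferProd_le (hV : ∀ n, |V n| ≤ 1) (E : ℝ) {u f : ℤ → ℝ}
    (hf : ∀ n, f n = u (n + 1) + u (n - 1) + (V n - E) * u n) (a : ℤ) (n : ℕ) :
    planeNorm (![u (a + n), u (a + n - 1)] - (transferProd V E a n).mulVec ![u a, u (a - 1)]) ≤
      (|E| + 3) ^ n * ∑ i ∈ Finset.range n, |f (a + i)| := by
  induction n with
  | zero => simp [transferProd, planeNorm]
  | succ n ih =>
    set X := ![u (a + n), u (a + n - 1)] with hX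
    set Y := (transferProd V E a n).mulVec ![u a, u (a - 1)] with hY
    have e : ![u (a + (n + 1 : ℕ)), u (a + (n + 1 : ℕ) - 1)] -
        (transferProd V E a (n + 1)).mulVec ![u a, u (a - 1)] =
        (stepMat V E (a + n)).mulVec (X - Y) + ![f (a + n), 0] := by
      rw [transferProd, ← Matrix.mulVec_mulVec, ← hY, Matrix.mulVec_sub]
      have : ![u (a + (n + 1 : ℕ)), u (a + (n + 1 : ℕ) - 1)] =
          (stepMat V E (a + n)).mulVec X + ![f (a + n), 0] := by
        have e1 : a + ((n + 1 : ℕ) : ℤ) = a + n + 1 := by push_cast; ring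
        rw [e1]
        ext i
        fin_cases i
        · simp [stepMat, hX, hf]; ring
        · simp [stepMat, hX]
      rw [this]; abel
    rw [e, Finset.sum_range_succ]
    have hK : 1 ≤ (|E| + 3) := by linarith [abs_nonneg E]
    have hK0 : 0 ≤ (|E| + 3) := by linarith
    have h1 : planeNorm ![f (a + n), 0] = |f (a + n)| := by simp [planeNorm]
    calc _ ≤ planeNorm ((stepMat V E (a + n)).mulVec (X - Y)) + planeNorm ![f (a + n), 0] :=
          planeNorm_add_le _ _
      _ ≤ (|E| + 3) * ((|E| + 3) ^ n * ∑ i ∈ Finset.range n, |f (a + i)|) + |f (a + n)| := by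
          rw [h1]
          gcongr
          refine (planeNorm_mulVec_le _ _).trans ?_
          have := entryNorm_stepMat_le hV E (a + n)
          have h0 := planeNorm_nonneg (X - Y)
          gcongr
      _ ≤ _ := by
          rw [mul_add, ← mul_assoc, ← pow_succ']
          have : 1 ≤ (|E| + 3) ^ (n + 1) := one_le_pow₀ hK
          have := mul_le_mul_of_nonneg_right this (abs_nonneg (f (a + n)))
          linarith

lemma schrodinger_isUnit_of_growth (hH : IsSchrodingerOp V H) (hV : ∀ n, |V n| ≤ 1) {C : ℕ}
    (hR : RecurrentAtScales C V) (E : ℝ) (hΛ : 0 < (subadditive_growth hV E).lim) :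
    IsUnit (H - algebraMap ℝ (lp (fun _ : ℤ => ℝ) 2 →L[ℝ] lp (fun _ : ℤ => ℝ) 2) E) := by
  obtain ⟨p, q, hpq⟩ := exists_expansion hV hR E hΛ
  set T := H - algebraMap ℝ (lp (fun _ : ℤ => ℝ) 2 →L[ℝ] lp (fun _ : ℤ => ℝ) 2) E with hT
  set K := |E| + 3 with hK
  have hK1 : 1 ≤ K := by linarith [abs_nonneg E]
  set B := K ^ q + 2 * K ^ p * K ^ p with hB
  have hB0 : 0 < B := by positivity
  set l := p + q with hl
  suffices h : ∀ u, ‖u‖ ≤ (B * l + 1) * ‖T u‖ by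
    have hpos : 0 < B * l + 1 := by positivity
    refine isUnit_of_symmetric_of_le T (schrodinger_sub_symm hH hV E) (c := (B * l + 1)⁻¹)
      (by positivity)
      fun u => ?_
    rw [inv_mul_le_iff₀ hpos]
    exact h u
  intro u
  set f := T u with hf
  have hfn : ∀ n, f n = u (n + 1) + u (n - 1) + (V n - E) * u n := schrodinger_sub_apply hH E u
  set g : ℤ → ℝ := fun x => |u x| + |u (x - 1)| with hg
  have hgp : ∀ x, g x = planeNorm ![u x, u (x - 1)] := fun x => by simp [hg, planeNorm]
  set S : ℤ → ℝ := fun x => ∑ i ∈ Finset.range l, |f (x - p + i)| with hS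
  have main : ∀ x, 3 * g x ≤ g (x + q) + g (x - p) + B * S x := by
    intro x
    have h1 := hpq x ![u x, u (x - 1)]
    have h2 := planeNorm_sub_transferProd_le hV E hfn x q
    have h3 := planeNorm_sub_transferProd_le hV E hfn (x - p) p
    have e3 : x - p + (p : ℤ) = x := by ring
    rw [e3] at h3
    set P := transferProd V E (x - p) p with hP
    set Q := transferProd V E x q with hQ
    set U0 := ![u x, u (x - 1)] with hU0
    set U1 := ![u (x + q), u (x + q - 1)] with hU1
    set U2 := ![u (x - p), u (x - p - 1)] with hU2
    have a1 : planeNorm (Q.mulVec U0) ≤ g (x + q) + planeNorm (U1 - Q.mulVec U0) := by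
      rw [hgp, ← hU1]
      have e : Q.mulVec U0 = U1 + -(U1 - Q.mulVec U0) := by abel
      have hn : planeNorm (-(U1 - Q.mulVec U0)) = planeNorm (U1 - Q.mulVec U0) := by
        simp only [planeNorm, Pi.neg_apply, abs_neg]
      have := planeNorm_add_le U1 (-(U1 - Q.mulVec U0))
      rw [hn] at this
      rwa [← e] at this
    have a2 : planeNorm (P.adjugate.mulVec U0) ≤
        g (x - p) + 2 * K ^ p * planeNorm (U0 - P.mulVec U2) := by
      rw [hgp, ← hU2]
      have e : P.adjugate.mulVec U0 = U2 + P.adjugate.mulVec (U0 - P.mulVec U2) := by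
        rw [Matrix.mulVec_sub, Matrix.mulVec_mulVec, Matrix.adjugate_mul,
          det_transferProd, one_smul, Matrix.one_mulVec]; abel
      rw [e]
      refine (planeNorm_add_le _ _).trans ?_
      gcongr
      refine (planeNorm_mulVec_le _ _).trans ?_
      rw [entryNorm_adjugate]
      have := entryNorm_transferProd_le hV E (x - p) p
      have h0 := planeNorm_nonneg (U0 - P.mulVec U2)
      gcongr
    have eS : S x = ∑ i ∈ Finset.range p, |f (x - p + i)| + ∑ i ∈ Finset.range q, |f (x + i)| := by
      simp only [hS, hl, Finset.sum_range_add]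
      congr 1
      refine Finset.sum_congr rfl fun i _ => ?_
      rw [show x - p + ((p + i : ℕ) : ℤ) = x + i by push_cast; ring]
    have s1 : 0 ≤ ∑ i ∈ Finset.range p, |f (x - p + i)| := Finset.sum_nonneg fun _ _ => abs_nonneg _
    have s2 : 0 ≤ ∑ i ∈ Finset.range q, |f (x + i)| := Finset.sum_nonneg fun _ _ => abs_nonneg _
    set s := ∑ i ∈ Finset.range p, |f (x - p + i)| with hs
    set s' := ∑ i ∈ Finset.range q, |f (x + i)| with hs'
    have hh0 := hgp x
    rw [← hU0] at hh0
    rw [hh0, eS, hB]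
    have h4 : 2 * K ^ p * planeNorm (U0 - P.mulVec U2) ≤ 2 * K ^ p * (K ^ p * s) := by gcongr
    have : 0 ≤ K ^ q * s := by positivity
    have : 0 ≤ 2 * K ^ p * K ^ p * s' := by positivity
    linarith
  have hsq : ∀ x, 9 * g x ^ 2 ≤ 3 * (g (x + q) ^ 2 + g (x - p) ^ 2) +
      3 * B ^ 2 * l * ∑ i ∈ Finset.range l, f (x - p + i) ^ 2 := by
    intro x
    have h0 : 0 ≤ 3 * g x := by simp only [hg]; positivity
    have h1 := pow_le_pow_left₀ h0 (main x) 2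
    have h2 : S x ^ 2 ≤ l * ∑ i ∈ Finset.range l, f (x - p + i) ^ 2 := by
      have := sq_sum_le_card_mul_sum_sq (s := Finset.range l) (f := fun i : ℕ => |f (x - p + i)|)
      simpa [hS] using this
    have h3 : B ^ 2 * S x ^ 2 ≤ B ^ 2 * (l * ∑ i ∈ Finset.range l, f (x - p + i) ^ 2) := by
      gcongr
    nlinarith [sq_nonneg (g (x + q) - g (x - p)), sq_nonneg (g (x + q) - B * S x),
      sq_nonneg (g (x - p) - B * S x)]
  have sg : Summable fun x => g x ^ 2 := by
    refine Summable.of_nonneg_of_le (fun x => sq_nonneg _) (fun x => ?_)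
      (((summable_sq u).add (summable_shift (summable_sq u) (-1))).mul_left 2)
    simp only [hg]
    rw [← sub_eq_add_neg]
    nlinarith [sq_abs (u x), sq_abs (u (x - 1)), sq_nonneg (|u x| - |u (x - 1)|)]
  have sf : ∀ i : ℕ, Summable fun x => f (x - p + i) ^ 2 := by
    intro i
    have := summable_shift (summable_sq f) (-p + i)
    refine this.congr fun x => ?_
    rw [show x + (-(p : ℤ) + i) = x - p + i by ring]
  have tf : ∀ i : ℕ, ∑' x, f (x - p + i) ^ 2 = ‖f‖ ^ 2 := by
    intro i
    rw [norm_sq_eq_tsum, ← tsum_shift (fun n => f n ^ 2) (-p + i)]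
    refine tsum_congr fun x => ?_
    rw [show x + (-(p : ℤ) + i) = x - p + i by ring]
  have sfs : Summable fun x => ∑ i ∈ Finset.range l, f (x - p + i) ^ 2 :=
    summable_sum fun i _ => sf i
  have tfs : ∑' x, ∑ i ∈ Finset.range l, f (x - p + i) ^ 2 = l * ‖f‖ ^ 2 := by
    rw [Summable.tsum_finsetSum fun i _ => sf i]
    simp [tf]
  have sq1 : Summable fun x => g (x + q) ^ 2 := summable_shift sg q
  have sq2 : Summable fun x => g (x - p) ^ 2 := summable_shift sg (-p)
  have tq1 : ∑' x, g (x + q) ^ 2 = ∑' x, g x ^ 2 := tsum_shift (fun x => g x ^ 2) q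
  have tq2 : ∑' x, g (x - p) ^ 2 = ∑' x, g x ^ 2 := tsum_shift (fun x => g x ^ 2) (-p)
  have hts := Summable.tsum_le_tsum hsq (sg.mul_left 9)
    (((sq1.add sq2).mul_left 3).add (sfs.mul_left _))
  rw [tsum_mul_left, Summable.tsum_add ((sq1.add sq2).mul_left 3) (sfs.mul_left _),
    tsum_mul_left, tsum_mul_left, sq1.tsum_add sq2, tq1, tq2, tfs] at hts
  have hug : ‖u‖ ^ 2 ≤ ∑' x, g x ^ 2 := by
    rw [norm_sq_eq_tsum]
    refine Summable.tsum_le_tsum (fun x => ?_) (summable_sq u) sg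
    simp only [hg]
    nlinarith [sq_abs (u x), abs_nonneg (u x), abs_nonneg (u (x - 1)),
      mul_nonneg (abs_nonneg (u x)) (abs_nonneg (u (x - 1)))]
  have hfin : ‖u‖ ^ 2 ≤ (B * l * ‖f‖) ^ 2 := by nlinarith
  have h0 : 0 ≤ B * l * ‖f‖ := by positivity
  have := le_of_sq_le_sq hfin h0
  linarith [norm_nonneg f]

/-- On the spectrum the transfer matrices grow subexponentially, uniformly in the base point. -/
lemma schrodinger_growth_le (hH : IsSchrodingerOp V H) (hV : ∀ n, |V n| ≤ 1) {C : ℕ}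
    (hR : RecurrentAtScales C V) {E : ℝ} (hE : E ∈ spectrum ℝ H) {ε : ℝ} (hε : 0 < ε) :
    ∀ᶠ n : ℕ in atTop, Real.log (entryNorm (transferProd V E 0 n)) ≤ ε * n := by
  have hΛ : (subadditive_growth hV E).lim ≤ 0 := by
    by_contra hcon
    push Not at hcon
    have h1 := schrodinger_isUnit_of_growth hH hV hR E hcon
    rw [spectrum.mem_iff] at hE
    exact hE (by rw [← neg_sub]; exact h1.neg)
  have ht := (subadditive_growth hV E).tendsto_lim (bddBelow_growth hV E)
  filter_upwards [ht.eventually (gt_mem_nhds (lt_of_le_of_lt hΛ hε)), eventually_gt_atTop 0]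
    with n hn hn0
  rw [div_lt_iff₀ (by exact_mod_cast hn0)] at hn
  exact (log_entryNorm_le_growth hV E 0 n).trans hn.le

/-- Translation of a sequence in `ℓ²(ℤ)`. -/
noncomputable def translate (t : ℤ) (u : lp (fun _ : ℤ => ℝ) 2) : lp (fun _ : ℤ => ℝ) 2 :=
  ⟨fun n => u (n + t), (memlp_two_iff _).2 (summable_shift (summable_sq u) t)⟩

lemma translate_apply (t : ℤ) (u : lp (fun _ : ℤ => ℝ) 2) (n : ℤ) :
    translate t u n = u (n + t) := rfl

lemma norm_translate (t : ℤ) (u : lp (fun _ : ℤ => ℝ) 2) : ‖translate t u‖ = ‖u‖ := by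
  have : ‖translate t u‖ ^ 2 = ‖u‖ ^ 2 := by
    rw [norm_sq_eq_tsum, norm_sq_eq_tsum]
    exact tsum_shift (fun n => u n ^ 2) t
  exact (pow_left_inj₀ (norm_nonneg _) (norm_nonneg _) two_ne_zero).1 this

lemma exists_tail_lt (u : lp (fun _ : ℤ => ℝ) 2) {ε : ℝ} (hε : 0 < ε) :
    ∃ L : ℕ, ∀ g : ℤ → ℝ, (∀ n, |g n| ≤ |u n|) → (∀ n : ℤ, |n| ≤ L → g n = 0) →
      ∑' n, g n ^ 2 < ε := by
  have h1 : Summable fun n => u n ^ 2 := summable_sq u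
  have h2 := (tendsto_order.1 (tendsto_tsum_compl_atTop_zero fun n => u n ^ 2)).2 ε hε
  obtain ⟨s, hs⟩ := h2.exists
  refine ⟨∑ n ∈ s, n.natAbs, fun g hg hgL => lt_of_le_of_lt ?_ hs⟩
  have e : (∑' a : {x // x ∉ s}, u a ^ 2) = ∑' n, ({n | n ∉ s} : Set ℤ).indicator
      (fun n => u n ^ 2) n := tsum_subtype ({n | n ∉ s} : Set ℤ) (fun n => u n ^ 2)
  rw [e]
  have hpt : ∀ n, g n ^ 2 ≤ ({n | n ∉ s} : Set ℤ).indicator (fun n => u n ^ 2) n := by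
    intro n
    by_cases hn : n ∈ s
    · rw [hgL n]
      · simp [hn]
      · rw [Int.abs_eq_natAbs]
        exact_mod_cast Finset.single_le_sum (f := fun n : ℤ => n.natAbs)
          (fun _ _ => Nat.zero_le _) hn
    · rw [indicator_of_mem (by exact hn)]
      exact sq_le_sq.2 (hg n)
  have hs2 := h1.indicator ({n | n ∉ s} : Set ℤ)
  exact Summable.tsum_le_tsum hpt (Summable.of_nonneg_of_le (fun n => sq_nonneg _) hpt hs2) hs2

lemma exists_large_recurrence {C : ℕ} (hR : RecurrentAtScales C V) (L : ℕ) :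
    ∃ t : ℤ, 2 * (L : ℤ) + 2 ≤ t ∧ ∀ n : ℤ, |n| ≤ L → V (n + t) = V n := by
  obtain ⟨l, hl, -, h⟩ := hR (2 * L + 1)
  obtain ⟨m, hm, -, h⟩ := h (-L) (L + 2)
  refine ⟨m + L, by omega, fun n hn => ?_⟩
  have hn' := abs_le.1 hn
  have := h (n + L).toNat (by omega)
  have e : (((n + L).toNat : ℕ) : ℤ) = n + L := Int.toNat_of_nonneg (by omega)
  rw [e] at this
  rw [show n + (m + L) = m + (n + L) by ring, this]
  congr 1; ring

lemma schrodinger_ker_bound (hH : IsSchrodingerOp V H) (E : ℝ) :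
    ∃ C > 0, ∀ v, (H - algebraMap ℝ (lp (fun _ : ℤ => ℝ) 2 →L[ℝ] lp (fun _ : ℤ => ℝ) 2) E) v = 0 →
      ‖v‖ ≤ C * max |v 0| |v 1| := by
  set T := H - algebraMap ℝ (lp (fun _ : ℤ => ℝ) 2 →L[ℝ] lp (fun _ : ℤ => ℝ) 2) E with hT
  set K := LinearMap.ker T.toLinearMap with hK
  let Φ : K →ₗ[ℝ] ℝ × ℝ :=
    { toFun := fun v => ((v : lp (fun _ : ℤ => ℝ) 2) 0, (v : lp (fun _ : ℤ => ℝ) 2) 1)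
      map_add' := fun v w => rfl
      map_smul' := fun c v => rfl }
  have hinj : Function.Injective Φ := by
    rw [← LinearMap.ker_eq_bot, LinearMap.ker_eq_bot']
    rintro ⟨v, hv⟩ hΦ
    have hv0 : T v = 0 := LinearMap.mem_ker.1 hv
    have h0 : v 0 = 0 := congrArg Prod.fst hΦ
    have h1 : v 1 = 0 := congrArg Prod.snd hΦ
    have hrec : ∀ n, v (n + 1) + v (n - 1) + (V n - E) * v n = 0 := by
      intro n
      rw [← schrodinger_sub_apply hH E v n, ← hT, hv0]; rfl
    have hup : ∀ n : ℕ, v n = 0 ∧ v (n + 1) = 0 := by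
      intro n
      induction n with
      | zero => exact ⟨h0, by simpa using h1⟩
      | succ n ih =>
        have := hrec (n + 1)
        rw [add_sub_cancel_right, ih.1, ih.2] at this
        push_cast
        exact ⟨ih.2, by linarith⟩
    have hdown : ∀ n : ℕ, v (-n) = 0 ∧ v (-n + 1) = 0 := by
      intro n
      induction n with
      | zero => exact ⟨by simpa using h0, by simpa using h1⟩
      | succ n ih =>
        have := hrec (-n)
        rw [ih.1, ih.2] at this
        push_cast
        rw [show -((n : ℤ) + 1) = -n - 1 by ring, show -(n : ℤ) - 1 + 1 = -n by ring]
        exact ⟨by linarith, ih.1⟩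
    have hall : ∀ n : ℤ, v n = 0 := by
      intro n
      obtain ⟨k, rfl | rfl⟩ := n.eq_nat_or_neg
      · exact (hup k).1
      · exact (hdown k).1
    apply Subtype.ext
    apply lp.ext
    funext n
    exact hall n
  have : FiniteDimensional ℝ K := Module.Finite.of_injective Φ hinj
  obtain ⟨C, hC0, hC⟩ := Φ.exists_antilipschitzWith (LinearMap.ker_eq_bot.2 hinj)
  refine ⟨C, by exact_mod_cast hC0, fun v hv => ?_⟩
  have h1 := hC.le_mul_dist (⟨v, LinearMap.mem_ker.2 hv⟩ : K) 0
  rw [map_zero, dist_zero_right, dist_zero_right] at h1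
  exact h1

/-- The spectrum of a recurrent Schrödinger operator has no isolated points. -/
lemma schrodinger_accPt (hH : IsSchrodingerOp V H) (hV : ∀ n, V n ∈ Set.Icc (0 : ℝ) 1) {C : ℕ}
    (hR : RecurrentAtScales C V) {E : ℝ} (hE : E ∈ spectrum ℝ H) :
    AccPt E (𝓟 (spectrum ℝ H)) := by
  have hV1 : ∀ n, |V n| ≤ 1 := fun n => by rw [abs_of_nonneg (hV n).1]; exact (hV n).2
  by_contra hacc
  rw [accPt_iff_nhds] at hacc
  push Not at hacc
  obtain ⟨U, hU, hiso⟩ := hacc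
  obtain ⟨d, hd0, hdU⟩ := Metric.mem_nhds_iff.1 hU
  set T := H - algebraMap ℝ (lp (fun _ : ℤ => ℝ) 2 →L[ℝ] lp (fun _ : ℤ => ℝ) 2) E with hT
  have hTs := schrodinger_sub_symm hH hV1 E
  rw [← hT] at hTs
  have hunit : ∀ s : ℝ, s ≠ 0 → |s| < d → IsUnit (T - algebraMap ℝ _ s) := by
    intro s hs hsd
    by_contra hns
    refine hs ?_
    have hmem : E + s ∈ spectrum ℝ H := by
      rw [spectrum.mem_iff]
      intro hu
      refine hns ?_
      rw [hT, sub_sub, ← map_add, ← neg_sub]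
      exact hu.neg
    have := hiso (E + s) ⟨hdU (by simpa [Real.dist_eq] using hsd), hmem⟩
    linarith
  have hnear := exists_ker_near T hTs hd0 hunit
  obtain ⟨u0, hu0, hu0T⟩ : ∃ u0, u0 ≠ 0 ∧ T u0 = 0 := by
    by_contra hno
    push Not at hno
    have hu : IsUnit T := isUnit_of_symmetric_of_le T hTs hd0 fun u => by
      obtain ⟨v, hv, hvu⟩ := hnear u
      have hv0 : v = 0 := by
        by_contra h0; exact hno v h0 hv
      rwa [hv0, sub_zero] at hvu
    rw [spectrum.mem_iff] at hE
    exact hE (by rw [← neg_sub]; exact hu.neg)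
  obtain ⟨K, hK0, hK⟩ := schrodinger_ker_bound hH E
  have hu0' : 0 < ‖u0‖ := norm_pos_iff.2 hu0
  obtain ⟨ε, hε0, hε⟩ : ∃ ε > 0, K * (ε + ε / d) + ε / d < ‖u0‖ := by
    refine ⟨‖u0‖ / (2 * (K * (1 + 1 / d) + 1 / d)), by positivity, ?_⟩
    have : K * (‖u0‖ / (2 * (K * (1 + 1 / d) + 1 / d)) +
        ‖u0‖ / (2 * (K * (1 + 1 / d) + 1 / d)) / d) +
        ‖u0‖ / (2 * (K * (1 + 1 / d) + 1 / d)) / d = ‖u0‖ / 2 := by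
      field_simp
    rw [this]; linarith
  obtain ⟨L, hL⟩ := exists_tail_lt u0 (show 0 < ε ^ 2 by positivity)
  obtain ⟨t, htL, ht⟩ := exists_large_recurrence hR L
  set w := translate (-t) u0 with hw
  have hTu0 : ∀ n, u0 (n + 1) + u0 (n - 1) + (V n - E) * u0 n = 0 := by
    intro n
    rw [← schrodinger_sub_apply hH E u0 n, ← hT, hu0T]; rfl
  have hTw : ∀ n, (T w) n = (V n - V (n - t)) * u0 (n - t) := by
    intro n
    rw [hT, schrodinger_sub_apply hH]
    simp only [hw, translate_apply]
    have := hTu0 (n - t)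
    rw [show n + 1 + -t = n - t + 1 by ring, show n - 1 + -t = n - t - 1 by ring,
      show n + -t = n - t by ring]
    linear_combination this
  have hTwn : ‖T w‖ ≤ ε := by
    refine le_of_sq_le_sq ?_ hε0.le
    rw [norm_sq_eq_tsum, ← tsum_shift _ t]
    refine (hL (fun n => (T w) (n + t)) (fun n => ?_) (fun n hn => ?_)).le
    · rw [hTw, abs_mul, add_sub_cancel_right]
      have h1 : |V (n + t) - V n| ≤ 1 := by
        rw [abs_le]
        constructor <;> linarith [(hV n).1, (hV n).2, (hV (n + t)).1, (hV (n + t)).2]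
      exact mul_le_of_le_one_left (abs_nonneg _) h1
    · rw [hTw, add_sub_cancel_right, ht n hn, sub_self, zero_mul]
  have hsmall : ∀ n : ℤ, |n| ≤ 1 → |w n| ≤ ε := by
    intro n hn
    have hn' := abs_le.1 hn
    refine abs_le_of_sq_le_sq ?_ hε0.le
    have h1 := hL (fun m => if m = n - t then u0 m else 0) (fun m => by
      by_cases h : m = n - t <;> simp [h]) (fun m hm => by
      rw [if_neg]; rintro rfl; have := abs_le.1 hm; omega)
    rw [tsum_eq_single (n - t) (fun m hm => by simp [hm])] at h1
    simp only [if_true] at h1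
    rw [hw, translate_apply, ← sub_eq_add_neg]
    exact h1.le
  obtain ⟨v, hv, hvw⟩ := hnear w
  have hdist : ‖w - v‖ ≤ ε / d := by
    rw [le_div_iff₀ hd0]; linarith
  have hvn : ∀ n : ℤ, |n| ≤ 1 → |v n| ≤ ε + ε / d := by
    intro n hn
    have h1 := abs_apply_le_norm (w - v) n
    have h2 : (w - v) n = w n - v n := rfl
    rw [h2, abs_sub_comm] at h1
    have h3 := hsmall n hn
    have h4 := abs_sub_abs_le_abs_sub (v n) (w n)
    linarith
  have h1 := hK v hv
  have h2 : max |v 0| |v 1| ≤ ε + ε / d := max_le (hvn 0 (by simp)) (hvn 1 (by simp))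
  have h3 : K * max |v 0| |v 1| ≤ K * (ε + ε / d) := by gcongr
  have h4 : ‖w‖ = ‖u0‖ := norm_translate _ _
  have h5 : ‖w‖ ≤ ‖w - v‖ + ‖v‖ := by simpa using norm_add_le (w - v) v
  linarith

end Operator

/-- The continued fraction tails `d 0 = 0`, `d (n+1) = -1 / (z - v n + d n)`. -/
noncomputable def cfTail (v : ℕ → ℝ) (z : ℂ) : ℕ → ℂ
  | 0 => 0
  | n + 1 => -(z - v n + cfTail v z n)⁻¹

/-- The half-line Weyl quotients `z - v n + d n`. -/
noncomputable def weyl (v : ℕ → ℝ) (z : ℂ) (n : ℕ) : ℂ := z - v n + cfTail v z n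

/-- Holomorphic self-maps of the upper half-plane with decay `1 / Im z`. -/
structure IsHerglotz (f : ℂ → ℂ) : Prop where
  diff : DifferentiableOn ℂ f {z | 0 < z.im}
  im_nonneg : ∀ z : ℂ, 0 < z.im → 0 ≤ (f z).im
  norm_le : ∀ z : ℂ, 0 < z.im → ‖f z‖ ≤ 1 / z.im

lemma im_neg_inv (w : ℂ) : (-w⁻¹).im = w.im / Complex.normSq w := by
  simp [Complex.inv_im, neg_div]

lemma ne_zero_of_im_pos {w : ℂ} (h : 0 < w.im) : w ≠ 0 := by
  rintro rfl; simp at h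

lemma le_im_add (z : ℂ) (r : ℝ) {f : ℂ} (hf : 0 ≤ f.im) : z.im ≤ (z - r + f).im := by
  simp; linarith

lemma isHerglotz_zero : IsHerglotz fun _ => 0 :=
  ⟨differentiableOn_const 0, fun _ _ => by simp, fun z hz => by simp; exact hz.le⟩

lemma isHerglotz_neg_inv (r : ℝ) {f : ℂ → ℂ} (hf : DifferentiableOn ℂ f {z | 0 < z.im})
    (hf0 : ∀ z : ℂ, 0 < z.im → 0 ≤ (f z).im) : IsHerglotz fun z => -(z - r + f z)⁻¹ := by
  have hpos : ∀ z : ℂ, 0 < z.im → z.im ≤ (z - r + f z).im := fun z hz =>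
    le_im_add z r (hf0 z hz)
  refine ⟨?_, fun z hz => ?_, fun z hz => ?_⟩
  · refine DifferentiableOn.neg (DifferentiableOn.inv ?_ ?_)
    · exact ((differentiableOn_id).sub (differentiableOn_const _)).add hf
    · intro z hz
      exact ne_zero_of_im_pos (lt_of_lt_of_le hz (hpos z hz))
  · rw [im_neg_inv]
    exact div_nonneg (hz.le.trans (hpos z hz)) (Complex.normSq_nonneg _)
  · rw [norm_neg, norm_inv, ← one_div]
    exact one_div_le_one_div_of_le hz
      ((hpos z hz).trans ((le_abs_self _).trans (Complex.abs_im_le_norm _)))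

lemma isHerglotz_cfTail (v : ℕ → ℝ) (n : ℕ) : IsHerglotz fun z => cfTail v z n := by
  induction n with
  | zero => exact isHerglotz_zero
  | succ n ih => exact isHerglotz_neg_inv (v n) ih.diff ih.im_nonneg

lemma im_le_weyl_im (v : ℕ → ℝ) {z : ℂ} (hz : 0 < z.im) (n : ℕ) : z.im ≤ (weyl v z n).im :=
  le_im_add z (v n) ((isHerglotz_cfTail v n).im_nonneg z hz)

lemma weyl_ne_zero (v : ℕ → ℝ) {z : ℂ} (hz : 0 < z.im) (n : ℕ) : weyl v z n ≠ 0 :=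
  ne_zero_of_im_pos (hz.trans_le (im_le_weyl_im v hz n))

lemma cfTail_succ (v : ℕ → ℝ) (z : ℂ) (n : ℕ) : cfTail v z (n + 1) = -(weyl v z n)⁻¹ := rfl

lemma weyl_succ (v : ℕ → ℝ) (z : ℂ) (n : ℕ) :
    weyl v z (n + 1) = z - v (n + 1) - (weyl v z n)⁻¹ := by
  rw [weyl, cfTail_succ]; ring

/-- The potential read backwards from the end of the box `{0, …, N - 1}`. -/
def revSeq (v : ℕ → ℝ) (N : ℕ) : ℕ → ℝ := fun j => v (N - 1 - j)

/-- The right tail at site `n` of the box `{0, …, N - 1}`. -/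
noncomputable def rightTail (v : ℕ → ℝ) (N : ℕ) (z : ℂ) (n : ℕ) : ℂ :=
  cfTail (revSeq v N) z (N - 1 - n)

lemma rightTail_last (v : ℕ → ℝ) (N : ℕ) (z : ℂ) : rightTail v (N + 1) z N = 0 := by
  simp [rightTail, cfTail]

lemma weyl_revSeq (v : ℕ → ℝ) {N n : ℕ} (z : ℂ) (hn : n < N) :
    weyl (revSeq v N) z (N - 1 - n) = z - v n + rightTail v N z n := by
  rw [weyl, rightTail, revSeq, show N - 1 - (N - 1 - n) = n by omega]

lemma rightTail_eq (v : ℕ → ℝ) {N n : ℕ} (z : ℂ) (hn : n + 1 < N) :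
    rightTail v N z n = -(z - v (n + 1) + rightTail v N z (n + 1))⁻¹ := by
  rw [← weyl_revSeq v z hn, ← cfTail_succ, rightTail]
  congr 1; omega

lemma isHerglotz_rightTail (v : ℕ → ℝ) (N n : ℕ) : IsHerglotz fun z => rightTail v N z n :=
  isHerglotz_cfTail _ _

/-! ### The logarithmic sums -/

lemma div_le_log_sub_log {X h : ℝ} (hh : 0 < h) (hX : h / 2 < X) :
    h / X ≤ Real.log (X + h / 2) - Real.log (X - h / 2) := by
  have hXp : 0 < X := by linarith
  have hx : |h / 2 / X| < 1 := by
    rw [abs_of_pos (by positivity), div_lt_one hXp]; exact hX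
  have := Real.hasSum_log_sub_log_of_abs_lt_one hx
  have h0 := this.summable.sum_le_tsum (Finset.range 1) (fun i _ => by positivity)
  rw [this.tsum_eq] at h0
  have e1 : Real.log (1 + h / 2 / X) = Real.log (X + h / 2) - Real.log X := by
    rw [← Real.log_div (by positivity) hXp.ne']; congr 1; field_simp
  have e2 : Real.log (1 - h / 2 / X) = Real.log (X - h / 2) - Real.log X := by
    rw [← Real.log_div (by linarith) hXp.ne']; congr 1; field_simp
  rw [e1, e2] at h0
  simp at h0
  calc h / X = 2 * (h / 2 / X) := by ring
    _ ≤ _ := by linarith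

lemma kotani_sum_aux (v : ℕ → ℝ) {z : ℂ} (hz : 0 < z.im) (n : ℕ) :
    ∑ k ∈ Finset.range (n + 1), z.im / ((weyl v z k).im - z.im / 2) ≤
      2 + Real.log (weyl v z n).im - Real.log z.im +
        2 * ∑ k ∈ Finset.range n, Real.log ‖weyl v z k‖ := by
  induction n with
  | zero =>
    have : (weyl v z 0).im = z.im := by simp [weyl, cfTail]
    simp only [Finset.sum_range_one, this, Finset.range_zero, Finset.sum_empty, zero_add]
    rw [show z.im - z.im / 2 = z.im / 2 by ring, div_div_eq_mul_div, mul_comm,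
      mul_div_assoc, div_self hz.ne']
    linarith
  | succ n ih =>
    rw [Finset.sum_range_succ, Finset.sum_range_succ (fun k => Real.log _) n]
    have hpos := hz.trans_le (im_le_weyl_im v hz n)
    have hnn := norm_pos_iff.2 (weyl_ne_zero v hz n)
    have him : (weyl v z (n + 1)).im = z.im + (weyl v z n).im / ‖weyl v z n‖ ^ 2 := by
      rw [weyl, cfTail_succ, Complex.add_im, im_neg_inv, Complex.normSq_eq_norm_sq]; simp
    have hq : 0 < (weyl v z n).im / ‖weyl v z n‖ ^ 2 := by positivity
    have h1 := div_le_log_sub_log (X := (weyl v z (n + 1)).im - z.im / 2) hz (by rw [him]; linarith)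
    rw [sub_add_cancel, show (weyl v z (n + 1)).im - z.im / 2 - z.im / 2
      = (weyl v z n).im / ‖weyl v z n‖ ^ 2 by rw [him]; ring,
      Real.log_div hpos.ne' (by positivity), Real.log_pow] at h1
    push_cast at h1
    linarith

lemma kotani_sum (v : ℕ → ℝ) {z : ℂ} (hz : 0 < z.im) (N : ℕ) :
    ∑ k ∈ Finset.range (N + 1), z.im / ((weyl v z k).im - z.im / 2) ≤
      2 * ∑ k ∈ Finset.range (N + 1), Real.log ‖weyl v z k‖ + 2 - 2 * Real.log z.im := by
  refine (kotani_sum_aux v hz N).trans ?_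
  rw [Finset.sum_range_succ]
  have h0 := im_le_weyl_im v hz N
  have h1 := Real.log_le_log hz h0
  have h2 := Real.log_le_log (hz.trans_le h0) ((le_abs_self _).trans (Complex.abs_im_le_norm _))
  linarith

/-- `log |D_N|`, the logarithm of the modulus of the characteristic polynomial of the box. -/
noncomputable def logDet (v : ℕ → ℝ) (N : ℕ) (z : ℂ) : ℝ :=
  ∑ k ∈ Finset.range N, Real.log ‖weyl v z k‖

lemma le_logDet (v : ℕ → ℝ) {z : ℂ} (hz : 0 < z.im) (N : ℕ) :
    Real.log z.im - 1 ≤ logDet v (N + 1) z := by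
  have h := kotani_sum v hz N
  have : 0 ≤ ∑ k ∈ Finset.range (N + 1), z.im / ((weyl v z k).im - z.im / 2) :=
    Finset.sum_nonneg fun k _ => div_nonneg hz.le (by linarith [im_le_weyl_im v hz k])
  rw [logDet]; linarith

/-- The denominators `h n = a n + c n` of the diagonal Green's function of the box. -/
noncomputable def greenDen (v : ℕ → ℝ) (N : ℕ) (z : ℂ) (n : ℕ) : ℂ :=
  weyl v z n + rightTail v N z n

lemma im_le_greenDen_im (v : ℕ → ℝ) {z : ℂ} (hz : 0 < z.im) (N n : ℕ) :
    z.im ≤ (greenDen v N z n).im := by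
  have := im_le_weyl_im v hz n
  have h2 := (isHerglotz_rightTail v N n).im_nonneg z hz
  simp [greenDen]; linarith

lemma greenDen_ne_zero (v : ℕ → ℝ) {z : ℂ} (hz : 0 < z.im) (N n : ℕ) : greenDen v N z n ≠ 0 :=
  ne_zero_of_im_pos (hz.trans_le (im_le_greenDen_im v hz N n))

lemma greenDen_mul (v : ℕ → ℝ) {z : ℂ} (hz : 0 < z.im) {N n : ℕ} (hn : n + 1 < N) :
    greenDen v N z n * (z - v (n + 1) + rightTail v N z (n + 1)) =
      weyl v z n * greenDen v N z (n + 1) := by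
  have h1 := weyl_ne_zero v hz n
  have h2 : z - v (n + 1) + rightTail v N z (n + 1) ≠ 0 := by
    rw [← weyl_revSeq v z hn]; exact weyl_ne_zero _ hz _
  rw [greenDen, greenDen, rightTail_eq v z hn, weyl_succ]
  field_simp
  ring

lemma logDet_revSeq_aux (v : ℕ → ℝ) {z : ℂ} (hz : 0 < z.im) {N : ℕ} (n : ℕ) (hn : n < N) :
    ∑ k ∈ Finset.range (n + 1), Real.log ‖z - v k + rightTail v N z k‖ =
      ∑ k ∈ Finset.range n, Real.log ‖weyl v z k‖ + Real.log ‖greenDen v N z n‖ := by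
  induction n with
  | zero => simp [greenDen, weyl, cfTail]
  | succ n ih =>
    rw [Finset.sum_range_succ, ih (by omega), Finset.sum_range_succ _ n]
    have h2 : z - v (n + 1) + rightTail v N z (n + 1) ≠ 0 := by
      rw [← weyl_revSeq v z hn]; exact weyl_ne_zero _ hz _
    have := congrArg (fun w => Real.log ‖w‖) (greenDen_mul v hz hn)
    simp only [norm_mul] at this
    rw [Real.log_mul (norm_ne_zero_iff.2 (greenDen_ne_zero v hz N n)) (norm_ne_zero_iff.2 h2),
      Real.log_mul (norm_ne_zero_iff.2 (weyl_ne_zero v hz n))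
        (norm_ne_zero_iff.2 (greenDen_ne_zero v hz N _))] at this
    linarith

lemma logDet_revSeq (v : ℕ → ℝ) {z : ℂ} (hz : 0 < z.im) (N : ℕ) :
    logDet (revSeq v (N + 1)) (N + 1) z = logDet v (N + 1) z := by
  rw [logDet, ← Finset.sum_range_reflect, logDet,
    Finset.sum_range_succ (fun k => Real.log ‖weyl v z k‖) N]
  have := logDet_revSeq_aux v hz (N := N + 1) N (by omega)
  rw [greenDen, rightTail_last, add_zero] at this
  rw [← this]
  refine Finset.sum_congr rfl fun k hk => ?_
  rw [weyl_revSeq v z (Finset.mem_range.1 hk)]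

lemma kotani_sum_right (v : ℕ → ℝ) {z : ℂ} (hz : 0 < z.im) (N : ℕ) :
    ∑ k ∈ Finset.range (N + 1), z.im / ((rightTail v (N + 1) z k).im + z.im / 2) ≤
      2 * logDet v (N + 1) z + 2 - 2 * Real.log z.im := by
  rw [← logDet_revSeq v hz]
  refine le_trans (le_of_eq ?_) (kotani_sum (revSeq v (N + 1)) hz N)
  rw [← Finset.sum_range_reflect (fun k => z.im / ((weyl (revSeq v (N + 1)) z k).im - z.im / 2))]
  refine Finset.sum_congr rfl fun k hk => ?_
  rw [weyl_revSeq v z (Finset.mem_range.1 hk)]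
  congr 1
  simp; ring

/-! ### The derivative of the logarithmic determinant -/

/-- The derivative of `weyl` in the spectral parameter. -/
noncomputable def weylDeriv (v : ℕ → ℝ) (z : ℂ) : ℕ → ℂ
  | 0 => 1
  | n + 1 => 1 + weylDeriv v z n / weyl v z n ^ 2

lemma hasDerivAt_weyl (v : ℕ → ℝ) {z : ℂ} (hz : 0 < z.im) (n : ℕ) :
    HasDerivAt (fun z => weyl v z n) (weylDeriv v z n) z := by
  induction n with
  | zero =>
    simpa [weyl, cfTail, weylDeriv] using (hasDerivAt_id z).sub_const (v 0 : ℂ)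
  | succ n ih =>
    simp only [weyl_succ, weylDeriv]
    refine (((hasDerivAt_id z).sub_const (v (n + 1) : ℂ)).sub
      (ih.inv (weyl_ne_zero v hz n))).congr_deriv ?_
    ring

lemma sum_weylDeriv_aux (v : ℕ → ℝ) {z : ℂ} (hz : 0 < z.im) {N : ℕ} (n : ℕ) (hn : n < N) :
    ∑ k ∈ Finset.range n, weylDeriv v z k / weyl v z k + weylDeriv v z n / greenDen v N z n =
      ∑ k ∈ Finset.range (n + 1), (greenDen v N z k)⁻¹ := by
  induction n with
  | zero => simp [weylDeriv]
  | succ n ih =>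
    rw [Finset.sum_range_succ _ (n + 1), ← ih (by omega), Finset.sum_range_succ _ n]
    have h1 := weyl_ne_zero v hz n
    have h3 := greenDen_ne_zero v hz N n
    have h4 := greenDen_ne_zero v hz N (n + 1)
    have h2 : z - v (n + 1) + rightTail v N z (n + 1) ≠ 0 := by
      rw [← weyl_revSeq v z hn]; exact weyl_ne_zero _ hz _
    have e1 : greenDen v N z (n + 1) =
        z - v (n + 1) + rightTail v N z (n + 1) - (weyl v z n)⁻¹ := by
      rw [greenDen, weyl_succ]; ring
    have e2 : greenDen v N z n =
        weyl v z n - (z - v (n + 1) + rightTail v N z (n + 1))⁻¹ := by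
      rw [greenDen, rightTail_eq v z hn]; ring
    rw [weylDeriv]
    set a := weyl v z n
    set b := z - v (n + 1) + rightTail v N z (n + 1)
    have h5 : a * b - 1 ≠ 0 := by
      intro h; apply h3
      rw [e2, sub_eq_zero, eq_comm, inv_eq_one_div, div_eq_iff h2]
      exact (sub_eq_zero.1 h).symm
    rw [e1, e2]
    have e3 : b - a⁻¹ = (a * b - 1) / a := by field_simp
    have e4 : a - b⁻¹ = (a * b - 1) / b := by field_simp
    rw [e3, e4]
    field_simp
    ring

lemma sum_weylDeriv (v : ℕ → ℝ) {z : ℂ} (hz : 0 < z.im) (N : ℕ) :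
    ∑ k ∈ Finset.range (N + 1), weylDeriv v z k / weyl v z k =
      ∑ k ∈ Finset.range (N + 1), (greenDen v (N + 1) z k)⁻¹ := by
  rw [← sum_weylDeriv_aux v hz N (by omega), Finset.sum_range_succ]
  simp [greenDen, rightTail_last]

lemma isHerglotz_green (v : ℕ → ℝ) (N n : ℕ) : IsHerglotz fun z => -(greenDen v N z n)⁻¹ := by
  have h1 := isHerglotz_cfTail v n
  have h2 := isHerglotz_rightTail v N n
  have h := isHerglotz_neg_inv (v n) (h1.diff.add h2.diff) fun z hz => by
    simpa using add_nonneg (h1.im_nonneg z hz) (h2.im_nonneg z hz)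
  refine (funext fun z => ?_ : (fun z => -(greenDen v N z n)⁻¹) = _) ▸ h
  rw [greenDen, weyl]
  simp only [Pi.add_apply]
  ring_nf

/-- The imaginary part of the diagonal Green's function. -/
noncomputable def greenIm (v : ℕ → ℝ) (N : ℕ) (z : ℂ) (n : ℕ) : ℝ :=
  (-(greenDen v N z n)⁻¹).im

lemma hasDerivAt_log_norm {f : ℝ → ℂ} {f' : ℂ} {x : ℝ} (hf : HasDerivAt f f' x) (h0 : f x ≠ 0) :
    HasDerivAt (fun t => Real.log ‖f t‖) (f' / f x).re x := by
  have h1 : HasDerivAt (fun t => Complex.normSq (f t))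
      (2 * ((f x).re * f'.re + (f x).im * f'.im)) x := by
    have hr : HasDerivAt (fun t => (f t).re) f'.re x :=
      (Complex.reCLM.hasFDerivAt.comp_hasDerivAt x hf)
    have hi : HasDerivAt (fun t => (f t).im) f'.im x :=
      (Complex.imCLM.hasFDerivAt.comp_hasDerivAt x hf)
    simp only [Complex.normSq_apply]
    refine ((hr.mul hr).add (hi.mul hi)).congr_deriv ?_
    ring
  have h2 := (h1.log (by simpa using h0)).div_const 2
  have e : (fun t => Real.log ‖f t‖) = fun t => Real.log (Complex.normSq (f t)) / 2 := by
    funext t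
    rw [Complex.normSq_eq_norm_sq, Real.log_pow]; push_cast; ring
  rw [e]
  refine h2.congr_deriv ?_
  have : Complex.normSq (f x) ≠ 0 := by simpa using h0
  rw [Complex.div_re]
  field_simp

lemma hasDerivAt_logDet (v : ℕ → ℝ) (E : ℝ) {η : ℝ} (hη : 0 < η) (N : ℕ) :
    HasDerivAt (fun s : ℝ => logDet v (N + 1) (E + s * Complex.I))
      (∑ k ∈ Finset.range (N + 1), greenIm v (N + 1) (E + η * Complex.I) k) η := by
  set z : ℂ := E + η * Complex.I
  have hz : 0 < z.im := by simpa [z] using hη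
  have hline : HasDerivAt (fun s : ℝ => (E + s * Complex.I : ℂ)) Complex.I η := by
    simpa using ((Complex.ofRealCLM.hasDerivAt (x := η)).mul_const Complex.I).const_add (E : ℂ)
  have hk : ∀ k, HasDerivAt (fun s : ℝ => Real.log ‖weyl v (E + s * Complex.I) k‖)
      (weylDeriv v z k * Complex.I / weyl v z k).re η := fun k =>
    hasDerivAt_log_norm (HasDerivAt.comp (h₂ := fun z => weyl v z k) η
      (hasDerivAt_weyl v hz k) hline) (weyl_ne_zero v hz k)
  have h := HasDerivAt.fun_sum (u := Finset.range (N + 1)) fun k _ => hk k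
  refine h.congr_deriv ?_
  have e : ∀ k, (weylDeriv v z k * Complex.I / weyl v z k).re =
      -(weylDeriv v z k / weyl v z k).im := by
    intro k
    rw [mul_div_right_comm]; simp
  rw [Finset.sum_congr rfl (fun k _ => e k)]
  have := congrArg (fun w => -Complex.im w) (sum_weylDeriv v hz N)
  simp only [Complex.im_sum] at this
  rw [Finset.sum_neg_distrib, this]
  simp [greenIm]

/-! ### Determinants of the box -/

/-- The characteristic polynomial of the restriction of the operator to `{0, …, n - 1}`. -/
noncomputable def boxDet (v : ℕ → ℝ) (z : ℂ) : ℕ → ℂ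
  | 0 => 1
  | 1 => z - v 0
  | n + 2 => (z - v (n + 1)) * boxDet v z (n + 1) - boxDet v z n

lemma boxDet_succ (v : ℕ → ℝ) {z : ℂ} (hz : 0 < z.im) (n : ℕ) :
    boxDet v z (n + 1) = weyl v z n * boxDet v z n := by
  induction n with
  | zero => simp [boxDet, weyl, cfTail]
  | succ n ih =>
    have h1 := weyl_ne_zero v hz n
    rw [boxDet, weyl_succ, ih]
    field_simp

lemma boxDet_ne_zero (v : ℕ → ℝ) {z : ℂ} (hz : 0 < z.im) (n : ℕ) : boxDet v z n ≠ 0 := by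
  induction n with
  | zero => simp [boxDet]
  | succ n ih => rw [boxDet_succ v hz]; exact mul_ne_zero (weyl_ne_zero v hz n) ih

lemma logDet_eq (v : ℕ → ℝ) {z : ℂ} (hz : 0 < z.im) (N : ℕ) :
    logDet v N z = Real.log ‖boxDet v z N‖ := by
  induction N with
  | zero => simp [logDet, boxDet]
  | succ n ih =>
    rw [logDet, Finset.sum_range_succ, boxDet_succ v hz, norm_mul,
      Real.log_mul (norm_ne_zero_iff.2 (weyl_ne_zero v hz n))
        (norm_ne_zero_iff.2 (boxDet_ne_zero v hz n)), ← ih, logDet, add_comm]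

lemma continuous_boxDet (v : ℕ → ℝ) (n : ℕ) : Continuous fun z => boxDet v z n := by
  have : Continuous (fun z => boxDet v z n) ∧ Continuous (fun z => boxDet v z (n + 1)) := by
    induction n with
    | zero => exact ⟨continuous_const, continuous_id.sub continuous_const⟩
    | succ n ih =>
      exact ⟨ih.2, ((continuous_id.sub continuous_const).mul ih.2).sub ih.1⟩
  exact this.1

lemma transferProd_eq_boxDet (V : ℤ → ℝ) (E : ℝ) (n : ℕ) :
    ((transferProd V E 0 n 0 0 : ℝ) : ℂ) = boxDet (fun k => V k) E n := by
  have h10 : ∀ m, transferProd V E 0 (m + 1) 1 0 = transferProd V E 0 m 0 0 := fun m => by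
    rw [transferProd]; simp [stepMat, Matrix.mul_apply, Fin.sum_univ_two]
  have h00 : ∀ m : ℕ, transferProd V E 0 (m + 1) 0 0 =
      (E - V m) * transferProd V E 0 m 0 0 - transferProd V E 0 m 1 0 := fun m => by
    rw [transferProd]; simp [stepMat, Matrix.mul_apply, Fin.sum_univ_two]; ring
  have : ((transferProd V E 0 n 0 0 : ℝ) : ℂ) = boxDet (fun k => V k) E n ∧
      ((transferProd V E 0 (n + 1) 0 0 : ℝ) : ℂ) = boxDet (fun k => V k) E (n + 1) := by
    induction n with
    | zero =>
      refine ⟨by simp [transferProd, boxDet], ?_⟩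
      rw [h00]; simp [transferProd, boxDet]
    | succ n ih =>
      refine ⟨ih.2, ?_⟩
      rw [h00, h10, boxDet, ← ih.1, ← ih.2]
      push_cast; rfl
  exact this.1

lemma norm_boxDet_le (V : ℤ → ℝ) (E : ℝ) (n : ℕ) :
    ‖boxDet (fun k => V k) E n‖ ≤ entryNorm (transferProd V E 0 n) := by
  rw [← transferProd_eq_boxDet V E n, Complex.norm_real, Real.norm_eq_abs, entryNorm]
  linarith [abs_nonneg (transferProd V E 0 n 0 1), abs_nonneg (transferProd V E 0 n 1 0),
    abs_nonneg (transferProd V E 0 n 1 1)]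

/-! ### The Kotani sums -/

/-- The nonnegative defect in Kotani's argument. -/
noncomputable def kotaniDefect (η : ℝ) (a c : ℂ) : ℝ :=
  1 / (a.im - η / 2) + 1 / (c.im + η / 2) - 4 * (-(a + c)⁻¹).im

/-- A bounded chart of the upper half-plane. -/
noncomputable def chart (w : ℂ) : ℂ := (w + Complex.I)⁻¹

lemma im_add_one_le_norm (w : ℂ) (h : 0 ≤ w.im) : w.im + 1 ≤ ‖w + Complex.I‖ := by
  have := Complex.abs_im_le_norm (w + Complex.I)
  rw [Complex.add_im, Complex.I_im, abs_of_nonneg (by linarith)] at this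
  exact this

lemma norm_chart_le {w : ℂ} (h : 0 ≤ w.im) : ‖chart w‖ ≤ 1 := by
  rw [chart, norm_inv]
  exact inv_le_one_of_one_le₀ (by linarith [im_add_one_le_norm w h])

lemma kotaniDefect_nonneg_and_bound {η : ℝ} (hη : 0 < η) {a c : ℂ} (ha : η ≤ a.im) (hc : 0 ≤ c.im) :
    0 ≤ kotaniDefect η a c ∧ (a.re + c.re) ^ 2 + (a.im - c.im - η) ^ 2 ≤
      ‖a + c‖ ^ 2 * ((a.im + c.im) * kotaniDefect η a c) / 4 := by
  set A := a.im - η / 2 with hA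
  set B := c.im + η / 2 with hB
  have hAp : 0 < A := by rw [hA]; linarith
  have hBp : 0 < B := by rw [hB]; linarith
  have hn : ‖a + c‖ ^ 2 = (a.re + c.re) ^ 2 + (A + B) ^ 2 := by
    rw [← Complex.normSq_eq_norm_sq, Complex.normSq_apply, hA, hB]; simp; ring
  have hnp : 0 < ‖a + c‖ ^ 2 := by rw [hn]; positivity
  have hQ : kotaniDefect η a c =
      (A + B) * ((a.re + c.re) ^ 2 + (A - B) ^ 2) / (A * B * ‖a + c‖ ^ 2) := by
    rw [kotaniDefect, im_neg_inv, Complex.normSq_eq_norm_sq, Complex.add_im,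
      show a.im + c.im = A + B by rw [hA, hB]; ring, ← hA, ← hB]
    have h2 : (a.re + c.re) ^ 2 = ‖a + c‖ ^ 2 - (A + B) ^ 2 := by rw [hn]; ring
    rw [h2]
    set H := ‖a + c‖ ^ 2
    field_simp
    ring
  refine ⟨by rw [hQ]; positivity, ?_⟩
  rw [hQ, show a.im + c.im = A + B by rw [hA, hB]; ring,
    show a.im - c.im - η = A - B by rw [hA, hB]; ring]
  set S := (a.re + c.re) ^ 2 + (A - B) ^ 2
  have hS : 0 ≤ S := by positivity
  have e : ‖a + c‖ ^ 2 * ((A + B) * ((A + B) * S / (A * B * ‖a + c‖ ^ 2))) / 4 =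
    S * ((A + B) ^ 2 / (4 * (A * B))) := by
    set H := ‖a + c‖ ^ 2
    field_simp
  rw [e]
  refine le_mul_of_one_le_right hS ?_
  rw [one_le_div (by positivity)]
  nlinarith [sq_nonneg (A - B)]

lemma chart_add_conj {a c : ℂ} (ha : 0 ≤ a.im) (hc : 0 ≤ c.im) :
    ‖chart a + (starRingEnd ℂ) (chart c)‖ =
      ‖a + (starRingEnd ℂ) c‖ / (‖a + Complex.I‖ * ‖c + Complex.I‖) := by
  have h1 : a + Complex.I ≠ 0 := norm_pos_iff.1 (by linarith [im_add_one_le_norm a ha])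
  have h2 : c + Complex.I ≠ 0 := norm_pos_iff.1 (by linarith [im_add_one_le_norm c hc])
  have h3 : (starRingEnd ℂ) (c + Complex.I) ≠ 0 := (map_ne_zero _).2 h2
  have e : chart a + (starRingEnd ℂ) (chart c) =
      (a + (starRingEnd ℂ) c) / ((a + Complex.I) * (starRingEnd ℂ) (c + Complex.I)) := by
    rw [chart, chart, map_inv₀]
    field_simp
    simp; ring
  rw [e, norm_div, norm_mul, Complex.norm_conj]

lemma chart_add_conj_le {η τ : ℝ} (hη : 0 < η) (hτ : 0 < τ) {a c : ℂ} (ha : η ≤ a.im)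
    (hc : 0 ≤ c.im) : ‖chart a + (starRingEnd ℂ) (chart c)‖ ≤
      τ * (a.im + c.im) + kotaniDefect η a c / τ + η := by
  obtain ⟨hQ, hb⟩ := kotaniDefect_nonneg_and_bound hη ha hc
  rw [chart_add_conj (hη.le.trans ha) hc]
  set Q := kotaniDefect η a c
  set p := ‖a + Complex.I‖
  set q := ‖c + Complex.I‖
  have hp : 1 ≤ p := by linarith [im_add_one_le_norm a (hη.le.trans ha)]
  have hq : 1 ≤ q := by linarith [im_add_one_le_norm c hc]
  have hh : ‖a + c‖ ≤ 4 * (p * q) := by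
    have e : a + c = (a + Complex.I) + (c + Complex.I) - 2 * Complex.I := by ring
    have h1 : ‖a + c‖ ≤ p + q + 2 := by
      rw [e]
      refine (norm_sub_le _ _).trans (add_le_add (norm_add_le _ _) ?_)
      simp
    nlinarith
  have h2 : ‖a + (starRingEnd ℂ) c - η * Complex.I‖ ^ 2 ≤
      (‖a + c‖ / 2 * (τ * (a.im + c.im) + Q / τ) / 2) ^ 2 := by
    rw [← Complex.normSq_eq_norm_sq, Complex.normSq_apply]
    have e : (a + (starRingEnd ℂ) c - η * Complex.I).re *
          (a + (starRingEnd ℂ) c - η * Complex.I).re +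
      (a + (starRingEnd ℂ) c - η * Complex.I).im * (a + (starRingEnd ℂ) c - η * Complex.I).im =
      (a.re + c.re) ^ 2 + (a.im - c.im - η) ^ 2 := by simp; ring
    rw [e]
    refine hb.trans ?_
    have h3 : (a.im + c.im) * Q ≤ ((τ * (a.im + c.im) + Q / τ) / 2) ^ 2 := by
      have : (a.im + c.im) * Q = (τ * (a.im + c.im)) * (Q / τ) := by field_simp
      rw [this]; nlinarith [sq_nonneg (τ * (a.im + c.im) - Q / τ)]
    have h4 := mul_le_mul_of_nonneg_left h3 (sq_nonneg (‖a + c‖))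
    linarith
  have h5 := abs_le_of_sq_le_sq' h2 (by have := hη.trans_le ha; positivity)
  have h6 : ‖a + (starRingEnd ℂ) c‖ ≤ ‖a + c‖ / 2 * (τ * (a.im + c.im) + Q / τ) / 2 + η := by
    have e : a + (starRingEnd ℂ) c = (a + (starRingEnd ℂ) c - η * Complex.I) + η * Complex.I := by
      ring
    rw [e]
    refine (norm_add_le _ _).trans (add_le_add h5.2 ?_)
    simp [abs_of_pos hη]
  rw [div_le_iff₀ (by positivity)]
  refine h6.trans ?_
  have hK : 0 ≤ τ * (a.im + c.im) + Q / τ := by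
    have := hη.trans_le ha
    positivity
  have hpq : 1 ≤ p * q := by nlinarith
  nlinarith [mul_le_mul_of_nonneg_right hh hK]

/-! ### Contraction -/

lemma weyl_contraction (v : ℕ → ℝ) {z : ℂ} (hz : 0 < z.im) (m m' k : ℕ)
    (h : ∀ j ≤ k, v (m + j) = v (m' + j)) :
    ‖weyl v z (m + k) - weyl v z (m' + k)‖ ^ 2 ≤
      4 / z.im ^ 4 * ((1 + z.im ^ 2) ^ k)⁻¹ ^ 2 *
        ((weyl v z (m + k)).im * (weyl v z (m' + k)).im) := by
  induction k with
  | zero =>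
    have h0 := h 0 le_rfl
    have e : weyl v z (m + 0) - weyl v z (m' + 0) = cfTail v z m - cfTail v z m' := by
      rw [weyl, weyl, h0]; simp
    rw [e]
    have h1 : ‖cfTail v z m - cfTail v z m'‖ ≤ 2 / z.im := by
      refine (norm_sub_le _ _).trans ?_
      have := (isHerglotz_cfTail v m).norm_le z hz
      have := (isHerglotz_cfTail v m').norm_le z hz
      calc _ ≤ 1 / z.im + 1 / z.im := by linarith
        _ = _ := by ring
    calc _ ≤ (2 / z.im) ^ 2 := pow_le_pow_left₀ (norm_nonneg _) h1 2
      _ = 4 / z.im ^ 4 * ((1 + z.im ^ 2) ^ 0)⁻¹ ^ 2 * (z.im * z.im) := by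
          field_simp; norm_num
      _ ≤ _ := by
          refine mul_le_mul_of_nonneg_left ?_ (by positivity)
          exact mul_le_mul (im_le_weyl_im v hz m) (im_le_weyl_im v hz m') hz.le
            (hz.le.trans (im_le_weyl_im v hz m))
  | succ k ih =>
    have ih := ih fun j hj => h j (by omega)
    have hstep := h (k + 1) le_rfl
    set x := weyl v z (m + k) with hx
    set x' := weyl v z (m' + k) with hx'
    have h1 : x ≠ 0 := weyl_ne_zero v hz _
    have h2 : x' ≠ 0 := weyl_ne_zero v hz _
    have hi : z.im ≤ x.im := im_le_weyl_im v hz _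
    have hi' : z.im ≤ x'.im := im_le_weyl_im v hz _
    have e1 : weyl v z (m + (k + 1)) = z - v (m + (k + 1)) - x⁻¹ := weyl_succ v z (m + k)
    have e2 : weyl v z (m' + (k + 1)) = z - v (m + (k + 1)) - x'⁻¹ := by
      rw [hstep]; exact weyl_succ v z (m' + k)
    have im1 : ∀ {w : ℂ}, w ≠ 0 → z.im ≤ w.im → ∀ r : ℝ,
        w.im / ‖w‖ ^ 2 * (1 + z.im ^ 2) ≤ (z - r - w⁻¹).im := by
      intro w hw hwi r
      have e : (z - r - w⁻¹).im = z.im + w.im / ‖w‖ ^ 2 := by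
        rw [← Complex.normSq_eq_norm_sq, ← im_neg_inv]; simp; ring
      rw [e]
      have hwp : 0 < ‖w‖ := norm_pos_iff.2 hw
      have hle : w.im ≤ ‖w‖ := (le_abs_self _).trans (Complex.abs_im_le_norm w)
      have : w.im / ‖w‖ ^ 2 * z.im ^ 2 ≤ z.im := by
        rw [div_mul_eq_mul_div, div_le_iff₀ (by positivity)]
        have h1 : w.im * z.im ≤ ‖w‖ ^ 2 := by
          rw [sq]; exact mul_le_mul hle (hwi.trans hle) hz.le hwp.le
        nlinarith [mul_le_mul_of_nonneg_left h1 hz.le]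
      linarith
    rw [e1, e2]
    have e3 : (z - v (m + (k + 1)) - x⁻¹) - (z - v (m + (k + 1)) - x'⁻¹) = (x - x') / (x * x') := by
      field_simp; ring
    rw [e3, norm_div, norm_mul]
    have hp := mul_le_mul (im1 h1 hi (v (m + (k + 1)))) (im1 h2 hi' (v (m + (k + 1))))
      (by have := hz.trans_le hi'; positivity) (by
        have := im1 h1 hi (v (m + (k + 1)))
        have h3 := hz.trans_le hi
        exact le_trans (by positivity) this)
    have hpx := norm_pos_iff.2 h1
    have hpx' := norm_pos_iff.2 h2
    calc (‖x - x'‖ / (‖x‖ * ‖x'‖)) ^ 2 = ‖x - x'‖ ^ 2 / (‖x‖ ^ 2 * ‖x'‖ ^ 2) := by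
          rw [div_pow, mul_pow]
      _ ≤ (4 / z.im ^ 4 * ((1 + z.im ^ 2) ^ k)⁻¹ ^ 2 * (x.im * x'.im)) / (‖x‖ ^ 2 * ‖x'‖ ^ 2) := by
          gcongr
      _ = 4 / z.im ^ 4 * ((1 + z.im ^ 2) ^ (k + 1))⁻¹ ^ 2 *
          (x.im / ‖x‖ ^ 2 * (1 + z.im ^ 2) * (x'.im / ‖x'‖ ^ 2 * (1 + z.im ^ 2))) := by
          field_simp
          ring
      _ ≤ _ := mul_le_mul_of_nonneg_left hp (by positivity)

lemma chart_weyl_sub_le (v : ℕ → ℝ) {y : ℝ} (hy : 0 < y) {z : ℂ} (hz : y ≤ z.im) (m m' k : ℕ)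
    (h : ∀ j ≤ k, v (m + j) = v (m' + j)) :
    ‖chart (weyl v z (m + k)) - chart (weyl v z (m' + k))‖ ≤ 2 / y ^ 2 * ((1 + y ^ 2) ^ k)⁻¹ := by
  have hz0 := hy.trans_le hz
  have hc := weyl_contraction v hz0 m m' k h
  set x := weyl v z (m + k)
  set x' := weyl v z (m' + k)
  have hi : 0 < x.im := hz0.trans_le (im_le_weyl_im v hz0 _)
  have hi' : 0 < x'.im := hz0.trans_le (im_le_weyl_im v hz0 _)
  have h1 := im_add_one_le_norm x hi.le
  have h2 := im_add_one_le_norm x' hi'.le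
  have n1 : x + Complex.I ≠ 0 := norm_pos_iff.1 (by linarith)
  have n2 : x' + Complex.I ≠ 0 := norm_pos_iff.1 (by linarith)
  have e : chart x - chart x' = (x' - x) / ((x + Complex.I) * (x' + Complex.I)) := by
    rw [chart, chart]; field_simp; ring
  have hle : 2 / z.im ^ 2 * ((1 + z.im ^ 2) ^ k)⁻¹ ≤ 2 / y ^ 2 * ((1 + y ^ 2) ^ k)⁻¹ := by
    gcongr
  refine le_trans ?_ hle
  refine abs_le_of_sq_le_sq' ?_ (by positivity) |>.2
  rw [e, norm_div, norm_mul, norm_sub_rev, div_pow, mul_pow, div_le_iff₀ (by positivity)]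
  refine hc.trans ?_
  have h3 : x.im * x'.im ≤ ‖x + Complex.I‖ ^ 2 * ‖x' + Complex.I‖ ^ 2 :=
    mul_le_mul (by nlinarith) (by nlinarith) hi'.le (by positivity)
  calc _ ≤ 4 / z.im ^ 4 * ((1 + z.im ^ 2) ^ k)⁻¹ ^ 2 *
        (‖x + Complex.I‖ ^ 2 * ‖x' + Complex.I‖ ^ 2) :=
        mul_le_mul_of_nonneg_left h3 (by positivity)
    _ = _ := by ring

/-! ### Separation of the right tails -/

lemma norm_chart_rightTail_sub_ge (v : ℕ → ℝ) (hv : ∀ n, v n = 0 ∨ v n = 1) {N n n' : ℕ}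
    (hn : n + 1 < N) (hn' : n' + 1 < N) (hne : v (n + 1) ≠ v (n' + 1)) {s : ℝ} (h3 : 3 ≤ s)
    (h5 : s ≤ 5) :
    1 / 300 ≤ ‖chart (rightTail v N (s * Complex.I) n) -
      chart (rightTail v N (s * Complex.I) n')‖ := by
  set z : ℂ := s * Complex.I with hzdef
  have hzi : z.im = s := by simp [hzdef]
  have hz : 0 < z.im := by linarith
  have hT : ∀ j, ‖rightTail v N z j‖ ≤ 1 / 3 := fun j =>
    ((isHerglotz_rightTail v N j).norm_le z hz).trans (by
      rw [hzi]; exact one_div_le_one_div_of_le (by norm_num) h3)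
  have hTi : ∀ j, 0 ≤ (rightTail v N z j).im := fun j => (isHerglotz_rightTail v N j).im_nonneg z hz
  have hb0 : ∀ {j : ℕ}, j + 1 < N → z - v (j + 1) + rightTail v N z (j + 1) ≠ 0 := fun hj => by
    rw [← weyl_revSeq v z hj]; exact weyl_ne_zero _ hz _
  have hbn : ∀ j : ℕ, ‖z - v (j + 1) + rightTail v N z (j + 1)‖ ≤ 7 := fun j => by
    refine (norm_add_le _ _).trans ?_
    have h1 : ‖z - v (j + 1)‖ ≤ 5 + 1 := by
      refine (norm_sub_le _ _).trans (add_le_add ?_ ?_)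
      · simp [hzdef, abs_of_pos (show 0 < s by linarith)]; exact h5
      · rcases hv (j + 1) with h | h <;> simp [h]
    linarith [hT (j + 1)]
  set b := z - v (n + 1) + rightTail v N z (n + 1) with hb
  set b' := z - v (n' + 1) + rightTail v N z (n' + 1) with hb'
  set c := rightTail v N z n with hc
  set c' := rightTail v N z n' with hc'
  have ec : c = -b⁻¹ := rightTail_eq v z hn
  have ec' : c' = -b'⁻¹ := rightTail_eq v z hn'
  have h1 : (1 : ℝ) / 3 ≤ ‖b - b'‖ := by
    have e : ((v (n' + 1) - v (n + 1) : ℝ) : ℂ) =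
        (b - b') + (rightTail v N z (n' + 1) - rightTail v N z (n + 1)) := by
      rw [hb, hb']; push_cast; ring
    have h2 := norm_add_le (b - b') (rightTail v N z (n' + 1) - rightTail v N z (n + 1))
    rw [← e] at h2
    have h3 := norm_sub_le (rightTail v N z (n' + 1)) (rightTail v N z (n + 1))
    have h4 : ‖((v (n' + 1) - v (n + 1) : ℝ) : ℂ)‖ = 1 := by
      rw [Complex.norm_real]
      rcases hv (n + 1) with h | h <;> rcases hv (n' + 1) with h' | h'
      · exact absurd (h.trans h'.symm) hne
      · simp [h, h']
      · simp [h, h']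
      · exact absurd (h.trans h'.symm) hne
    rw [h4] at h2
    linarith [hT (n + 1), hT (n' + 1)]
  have hbne := hb0 hn
  have hbne' := hb0 hn'
  have hci : ∀ j, ‖rightTail v N z j + Complex.I‖ ≤ 4 / 3 := fun j => by
    refine (norm_add_le _ _).trans ?_
    rw [Complex.norm_I]; linarith [hT j]
  have n1 : c + Complex.I ≠ 0 := norm_pos_iff.1 (by linarith [im_add_one_le_norm c (hTi n), hTi n])
  have n2 : c' + Complex.I ≠ 0 :=
    norm_pos_iff.1 (by linarith [im_add_one_le_norm c' (hTi n'), hTi n'])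
  have e : chart c - chart c' = (c' - c) / ((c + Complex.I) * (c' + Complex.I)) := by
    rw [chart, chart]; field_simp; ring
  have e2 : c' - c = (b' - b) / (b * b') := by 
    rw [ec, ec']
    have hb0 : b ≠ 0 := hbne
    have hb0' : b' ≠ 0 := hbne'
    field_simp
    ring
  rw [e, e2, norm_div, norm_div, norm_mul, norm_mul, norm_sub_rev b' b]
  have p1 := norm_pos_iff.2 hbne
  have p2 := norm_pos_iff.2 hbne'
  have p3 := norm_pos_iff.2 n1
  have p4 := norm_pos_iff.2 n2
  rw [div_div, div_le_div_iff₀ (by norm_num) (by positivity)]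
  have q1 : ‖b‖ * ‖b'‖ ≤ 7 * 7 := mul_le_mul (hbn n) (hbn n') p2.le (by norm_num)
  have q2 : ‖c + Complex.I‖ * ‖c' + Complex.I‖ ≤ 4 / 3 * (4 / 3) :=
    mul_le_mul (hci n) (hci n') p4.le (by norm_num)
  have q3 := mul_le_mul q1 q2 (by positivity) (by norm_num)
  linarith

/-- The Poisson kernel of the upper half-plane. -/
noncomputable def poisson (y t : ℝ) : ℝ := Real.pi⁻¹ * (y / (t ^ 2 + y ^ 2))

lemma poisson_nonneg {y : ℝ} (hy : 0 < y) (t : ℝ) : 0 ≤ poisson y t := by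
  have := Real.pi_pos
  unfold poisson; positivity

lemma poisson_le {y : ℝ} (hy : 0 < y) (t : ℝ) : poisson y t ≤ 1 / (Real.pi * y) := by
  have := Real.pi_pos
  unfold poisson
  rw [← div_eq_inv_mul, div_div, div_le_div_iff₀ (by positivity) (by positivity)]
  nlinarith [mul_nonneg this.le (sq_nonneg t)]

/-- The conformal map from the disc onto `{Im z > s}` sending `0` to `x + i (y + s)`. -/
noncomputable def discMap (x y s : ℝ) (w : ℂ) : ℂ :=
  x + s * Complex.I + y * Complex.I * ((1 + w) / (1 - w))

lemma discMap_im (x y s : ℝ) (w : ℂ) :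
    (discMap x y s w).im = s + y * ((1 - ‖w‖ ^ 2) / ‖1 - w‖ ^ 2) := by
  have : ((1 + w) / (1 - w)).re = (1 - ‖w‖ ^ 2) / ‖1 - w‖ ^ 2 := by
    rw [Complex.div_re, ← Complex.normSq_eq_norm_sq, ← Complex.normSq_eq_norm_sq, ← add_div]
    congr 1
    simp [Complex.normSq_apply]; ring
  rw [← this, discMap]
  simp

lemma le_discMap_im (x s : ℝ) {y : ℝ} (hy : 0 < y) {w : ℂ} (hw : ‖w‖ ≤ 1) :
    s ≤ (discMap x y s w).im := by
  rw [discMap_im]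
  have : 0 ≤ (1 - ‖w‖ ^ 2) / ‖1 - w‖ ^ 2 :=
    div_nonneg (by nlinarith [norm_nonneg w]) (by positivity)
  nlinarith [mul_nonneg hy.le this]

lemma differentiableAt_discMap (x y s : ℝ) {w : ℂ} (hw : w ≠ 1) :
    DifferentiableAt ℂ (discMap x y s) w := by
  have h : (1 : ℂ) - w ≠ 0 := sub_ne_zero.2 hw.symm
  unfold discMap
  fun_prop (disch := assumption)

lemma circleMap_arctan (τ : ℝ) :
    circleMap 0 1 (Real.pi + 2 * Real.arctan τ) = -((1 + τ * Complex.I) / (1 - τ * Complex.I)) := by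
  have h0 : (1 - τ * Complex.I : ℂ) ≠ 0 := fun h => by
    have := congrArg Complex.re h; simp at this
  have hpos : 0 < 1 + τ ^ 2 := by positivity
  have e1 : Complex.exp (Real.arctan τ * Complex.I) =
      (1 + τ * Complex.I) / (Real.sqrt (1 + τ ^ 2) : ℝ) := by
    rw [Complex.exp_mul_I, ← Complex.ofReal_cos, ← Complex.ofReal_sin, Real.cos_arctan,
      Real.sin_arctan]
    push_cast; ring
  have h2 : ((Real.sqrt (1 + τ ^ 2) : ℝ) : ℂ) ^ 2 = 1 + τ ^ 2 := by
    rw [← Complex.ofReal_pow, Real.sq_sqrt hpos.le]; push_cast; ring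
  have e2 : (1 + τ ^ 2 : ℂ) = (1 + τ * Complex.I) * (1 - τ * Complex.I) := by
    ring_nf; rw [Complex.I_sq]; ring
  have h3 : (1 + τ * Complex.I : ℂ) ≠ 0 := fun h => by
    have := congrArg Complex.re h; simp at this
  rw [circleMap]
  simp only [Complex.ofReal_add, Complex.ofReal_mul, Complex.ofReal_ofNat, Complex.ofReal_one]
  rw [add_mul, Complex.exp_add, Complex.exp_pi_mul_I,
    show (2 * (Real.arctan τ : ℂ) * Complex.I) = (2 : ℕ) * (Real.arctan τ * Complex.I) by
      rw [Nat.cast_ofNat]; ring, Complex.exp_nat_mul, e1, div_pow, h2, e2]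
  field_simp
  ring

lemma discMap_arctan (x y s t : ℝ) (hy : y ≠ 0) :
    discMap x y s (circleMap 0 1 (Real.pi + 2 * Real.arctan ((t - x) / y))) =
      t + s * Complex.I := by
  set τ := (t - x) / y with hτ
  have h0 : (1 - τ * Complex.I : ℂ) ≠ 0 := fun h => by
    have := congrArg Complex.re h; simp at this
  have e : (1 + -((1 + τ * Complex.I) / (1 - τ * Complex.I))) /
      (1 - -((1 + τ * Complex.I) / (1 - τ * Complex.I))) = -(τ * Complex.I) := by
    have h1 : (1 - -((1 + τ * Complex.I) / (1 - τ * Complex.I)) : ℂ) =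
        2 / (1 - τ * Complex.I) := by field_simp; ring
    rw [h1]
    field_simp
    ring
  rw [circleMap_arctan, discMap, e]
  have : (y : ℂ) * τ = t - x := by
    rw [hτ]; push_cast
    have : (y : ℂ) ≠ 0 := by exact_mod_cast hy
    field_simp
  linear_combination this - (y * τ : ℂ) * (Complex.I_sq)

lemma arctan_image (x : ℝ) {y : ℝ} (hy : 0 < y) :
    (fun t : ℝ => Real.pi + 2 * Real.arctan ((t - x) / y)) '' univ = Ioo 0 (2 * Real.pi) := by
  ext θ
  simp only [image_univ, mem_range, mem_Ioo]
  constructor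
  · rintro ⟨t, rfl⟩
    have h1 := Real.neg_pi_div_two_lt_arctan ((t - x) / y)
    have h2 := Real.arctan_lt_pi_div_two ((t - x) / y)
    constructor <;> linarith
  · rintro ⟨h1, h2⟩
    refine ⟨x + y * Real.tan ((θ - Real.pi) / 2), ?_⟩
    rw [add_sub_cancel_left, mul_div_cancel_left₀ _ hy.ne',
      Real.arctan_tan (by linarith) (by linarith)]
    ring

lemma integral_circle_eq_poisson (x : ℝ) {y : ℝ} (hy : 0 < y) (g : ℝ → ℂ) :
    ∫ θ in Ioo 0 (2 * Real.pi), g θ =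
      ∫ t, (2 * Real.pi * poisson y (x - t)) • g (Real.pi + 2 * Real.arctan ((t - x) / y)) := by
  have hd : ∀ t ∈ (univ : Set ℝ), HasDerivWithinAt
      (fun t : ℝ => Real.pi + 2 * Real.arctan ((t - x) / y)) (2 * Real.pi * poisson y (x - t))
      univ t := by
    intro t _
    refine HasDerivAt.hasDerivWithinAt ?_
    have h := (((((hasDerivAt_id t).sub_const x).div_const y).arctan).const_mul 2).const_add Real.pi
    refine h.congr_deriv ?_
    unfold poisson
    have := Real.pi_pos
    have h1 : (x - t) ^ 2 + y ^ 2 ≠ 0 := by positivity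
    have h2 : 1 + ((t - x) / y) ^ 2 ≠ 0 := by positivity
    simp only [id]
    have h3 : 1 + ((t - x) / y) ^ 2 = ((x - t) ^ 2 + y ^ 2) / y ^ 2 := by field_simp; ring
    rw [h3]
    field_simp
  have hinj : InjOn (fun t : ℝ => Real.pi + 2 * Real.arctan ((t - x) / y)) univ := by
    intro t _ t' _ h
    have h1 : Real.arctan ((t - x) / y) = Real.arctan ((t' - x) / y) := by
      simp only at h; linarith
    have h2 := Real.arctan_injective h1
    rw [div_left_inj' hy.ne'] at h2
    linarith
  rw [← arctan_image x hy, integral_image_eq_integral_abs_deriv_smul MeasurableSet.univ hd hinj,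
    setIntegral_univ]
  refine integral_congr_ae (Eventually.of_forall fun t => ?_)
  simp only
  rw [abs_of_nonneg]
  have := poisson_nonneg hy (x - t)
  have := Real.pi_pos
  positivity

lemma circleMap_ne_one {θ : ℝ} (h0 : 0 < θ) (h1 : θ < 2 * Real.pi) : circleMap 0 1 θ ≠ 1 := by
  intro h
  rw [circleMap, Complex.ofReal_one, one_mul, zero_add, Complex.exp_eq_one_iff] at h
  obtain ⟨n, hn⟩ := h
  have hn' : θ = n * (2 * Real.pi) := by
    have := congrArg Complex.im hn
    simpa using this
  have hp := Real.two_pi_pos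
  rw [hn'] at h0 h1
  have a1 : (0 : ℝ) < n := by by_contra hh; push Not at hh; nlinarith
  have a2 : (n : ℝ) < 1 := by by_contra hh; push Not at hh; nlinarith
  have b1 : 0 < n := by exact_mod_cast a1
  have b2 : n < 1 := by exact_mod_cast a2
  omega

/-- The Poisson representation of bounded holomorphic functions in a half-plane. -/
theorem integral_poisson_mul {f : ℂ → ℂ} (hf : DifferentiableOn ℂ f {z | 0 < z.im}) {s : ℝ}
    (hs : 0 < s) {B : ℝ} (hB : ∀ z : ℂ, s ≤ z.im → ‖f z‖ ≤ B) (x : ℝ) {y : ℝ} (hy : 0 < y) :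
    ∫ t : ℝ, poisson y (x - t) • f (t + s * Complex.I) = f (x + (y + s : ℝ) * Complex.I) := by
  have hopen : IsOpen {z : ℂ | 0 < z.im} := isOpen_lt continuous_const Complex.continuous_im
  have hdiff : ∀ w : ℂ, ‖w‖ ≤ 1 → w ≠ 1 → DifferentiableAt ℂ (fun w => f (discMap x y s w)) w := by
    intro w hw hw1
    have h1 : DifferentiableAt ℂ f (discMap x y s w) :=
      hf.differentiableAt (hopen.mem_nhds (hs.trans_le (le_discMap_im x s hy hw)))
    exact h1.comp w (differentiableAt_discMap x y s hw1)
  have hval : ∀ r : ℝ, 0 < r → r < 1 →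
      Real.circleAverage (fun w => f (discMap x y s w)) 0 r = f (x + (y + s : ℝ) * Complex.I) := by
    intro r hr0 hr1
    have h : DiffContOnCl ℂ (fun w => f (discMap x y s w)) (Metric.ball 0 |r|) := by
      refine DifferentiableOn.diffContOnCl fun w hw => ?_
      have hw' : ‖w‖ ≤ r := by
        have := Metric.closure_ball_subset_closedBall hw
        rwa [mem_closedBall_zero_iff, abs_of_pos hr0] at this
      refine (hdiff w (by linarith) ?_).differentiableWithinAt
      rintro rfl
      rw [norm_one] at hw'; linarith
    rw [h.circleAverage]
    congr 1
    simp [discMap]; ring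
  have hlim : Tendsto (fun n : ℕ => ∫ θ in (0 : ℝ)..2 * Real.pi,
      f (discMap x y s (circleMap 0 (1 - 1 / ((n : ℝ) + 2)) θ))) atTop
      (nhds (∫ θ in (0 : ℝ)..2 * Real.pi, f (discMap x y s (circleMap 0 1 θ)))) := by
    have hr : ∀ n : ℕ, 0 < 1 - 1 / ((n : ℝ) + 2) ∧ 1 - 1 / ((n : ℝ) + 2) < 1 := fun n => by
      have : 1 / ((n : ℝ) + 2) < 1 := by
        rw [div_lt_one (by positivity)]; linarith [(Nat.cast_nonneg n : (0 : ℝ) ≤ n)]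
      constructor
      · linarith
      · have : 0 < 1 / ((n : ℝ) + 2) := by positivity
        linarith
    have hnorm : ∀ (n : ℕ) (θ : ℝ), ‖circleMap 0 (1 - 1 / ((n : ℝ) + 2)) θ‖ < 1 := fun n θ => by
      rw [norm_circleMap_zero, abs_of_pos (hr n).1]; exact (hr n).2
    refine intervalIntegral.tendsto_integral_filter_of_dominated_convergence (fun _ => B) ?_ ?_
      intervalIntegrable_const ?_
    · refine Eventually.of_forall fun n => (Continuous.aestronglyMeasurable ?_)
      rw [continuous_iff_continuousAt]
      intro θ
      have h1 := (hdiff _ (hnorm n θ).le (fun h => by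
        have := hnorm n θ; rw [h, norm_one] at this; exact lt_irrefl _ this)).continuousAt
      exact ContinuousAt.comp (f := circleMap 0 (1 - 1 / ((n : ℝ) + 2))) h1
        (continuous_circleMap 0 _).continuousAt
    · refine Eventually.of_forall fun n => Eventually.of_forall fun θ _ => ?_
      exact hB _ (le_discMap_im x s hy (hnorm n θ).le)
    · have hne : ∀ᵐ θ : ℝ, θ ≠ 2 * Real.pi := by
        simp [ae_iff, measure_singleton]
      filter_upwards [hne] with θ hθ hmem
      rw [uIoc_of_le Real.two_pi_pos.le] at hmem
      have h1 := (hdiff _ (by simp) (circleMap_ne_one hmem.1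
        (lt_of_le_of_ne hmem.2 hθ))).continuousAt
      have h2 : Tendsto (fun n : ℕ => circleMap 0 (1 - 1 / ((n : ℝ) + 2)) θ) atTop
          (nhds (circleMap 0 1 θ)) := by
        have h3 : Tendsto (fun n : ℕ => 1 - 1 / ((n : ℝ) + 2)) atTop (nhds (1 - 0)) := by
          refine tendsto_const_nhds.sub ?_
          simpa using (tendsto_const_nhds (x := (1 : ℝ))).div_atTop
            (tendsto_atTop_add_const_right atTop (2 : ℝ) tendsto_natCast_atTop_atTop)
        rw [sub_zero] at h3
        have h4 : Continuous fun r : ℝ => circleMap 0 r θ := by unfold circleMap; fun_prop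
        exact (h4.tendsto 1).comp h3
      exact h1.tendsto.comp h2
  have hconst : ∀ n : ℕ, (∫ θ in (0 : ℝ)..2 * Real.pi,
      f (discMap x y s (circleMap 0 (1 - 1 / ((n : ℝ) + 2)) θ))) =
      (2 * Real.pi : ℝ) • f (x + (y + s : ℝ) * Complex.I) := by
    intro n
    have : 1 / ((n : ℝ) + 2) < 1 := by
      rw [div_lt_one (by positivity)]; linarith [(Nat.cast_nonneg n : (0 : ℝ) ≤ n)]
    have h0 : 0 < 1 / ((n : ℝ) + 2) := by positivity
    rw [← hval (1 - 1 / ((n : ℝ) + 2)) (by linarith) (by linarith), Real.circleAverage, smul_smul,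
      mul_inv_cancel₀ Real.two_pi_pos.ne', one_smul]
  simp only [hconst] at hlim
  have heq := tendsto_nhds_unique tendsto_const_nhds hlim
  rw [intervalIntegral.integral_of_le Real.two_pi_pos.le, integral_Ioc_eq_integral_Ioo,
    integral_circle_eq_poisson x hy] at heq
  simp only [discMap_arctan x y s _ hy.ne', mul_smul] at heq
  rw [integral_smul, integral_smul, ← mul_smul, ← mul_smul] at heq
  exact (smul_right_injective _ Real.two_pi_pos.ne' heq).symm

lemma continuous_horizontal {f : ℂ → ℂ} (hf : DifferentiableOn ℂ f {z | 0 < z.im}) {s : ℝ}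
    (hs : 0 < s) : Continuous fun t : ℝ => f (t + s * Complex.I) := by
  refine hf.continuousOn.comp_continuous (by fun_prop) fun t => ?_
  simpa using hs

lemma integral_poisson (x : ℝ) {y : ℝ} (hy : 0 < y) : ∫ t, poisson y (x - t) = 1 := by
  have h := integral_poisson_mul (f := fun _ => 1) (differentiableOn_const _) one_pos (B := 1)
    (fun _ _ => by simp) x hy
  simp only [Complex.real_smul, mul_one] at h
  have h2 : ∫ t, ((poisson y (x - t) : ℝ) : ℂ) = ((∫ t, poisson y (x - t) : ℝ) : ℂ) :=
    integral_ofReal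
  rw [h2] at h
  exact_mod_cast h

lemma integrable_poisson (x : ℝ) {y : ℝ} (hy : 0 < y) : Integrable fun t => poisson y (x - t) := by
  by_contra h
  have := integral_poisson x hy
  rw [integral_undef h] at this
  exact zero_ne_one this

lemma integrable_poisson_smul {E : Type*} [NormedAddCommGroup E] [NormedSpace ℝ E]
    {g : ℝ → E} (hg : AEStronglyMeasurable g)
    {B : ℝ} (hB : ∀ t, ‖g t‖ ≤ B) (x : ℝ) {y : ℝ} (hy : 0 < y) :
    Integrable fun t => poisson y (x - t) • g t :=
  (integrable_poisson x hy).smul_bdd B hg (Eventually.of_forall hB)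

/-- The harmonic measure of `S` in the upper half-plane, at the point `x + i y`. -/
noncomputable def harm (S : Set ℝ) (y x : ℝ) : ℝ := ∫ t in S, poisson y (x - t)

lemma harm_nonneg (S : Set ℝ) {y : ℝ} (hy : 0 < y) (x : ℝ) : 0 ≤ harm S y x :=
  integral_nonneg fun t => poisson_nonneg hy (x - t)

lemma harm_add_compl {S : Set ℝ} (hS : MeasurableSet S) {y : ℝ} (hy : 0 < y) (x : ℝ) :
    harm S y x + ∫ t in Sᶜ, poisson y (x - t) = 1 := by
  rw [harm, integral_add_compl hS (integrable_poisson x hy), integral_poisson x hy]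

lemma harm_le_one {S : Set ℝ} (hS : MeasurableSet S) {y : ℝ} (hy : 0 < y) (x : ℝ) :
    harm S y x ≤ 1 := by
  have h := harm_add_compl hS hy x
  have : 0 ≤ ∫ t in Sᶜ, poisson y (x - t) := integral_nonneg fun t => poisson_nonneg hy (x - t)
  linarith

lemma isHerglotz_norm_le {f : ℂ → ℂ} (hf : IsHerglotz f) {s : ℝ} (hs : 0 < s) {z : ℂ}
    (hz : s ≤ z.im) : ‖f z‖ ≤ 1 / s :=
  (hf.norm_le z (hs.trans_le hz)).trans (one_div_le_one_div_of_le hs hz)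

lemma integral_poisson_mul_im {f : ℂ → ℂ} (hf : IsHerglotz f) {s : ℝ} (hs : 0 < s) (x : ℝ) {y : ℝ}
    (hy : 0 < y) : Integrable (fun t : ℝ => poisson y (x - t) * (f (t + s * Complex.I)).im) ∧
      ∫ t : ℝ, poisson y (x - t) * (f (t + s * Complex.I)).im =
      (f (x + (y + s : ℝ) * Complex.I)).im := by
  have hc := continuous_horizontal hf.diff hs
  have hb : ∀ t : ℝ, ‖f (t + s * Complex.I)‖ ≤ 1 / s := fun t =>
    isHerglotz_norm_le hf hs (by simp)
  have h := integral_poisson_mul hf.diff hs (fun z hz => isHerglotz_norm_le hf hs hz) x hy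
  have hi := integrable_poisson_smul hc.aestronglyMeasurable hb x hy
  constructor
  · simpa using hi.im
  · rw [← h, ← RCLike.im_eq_complex_im, ← integral_im hi]
    simp

lemma integral_green_le {f : ℂ → ℂ} (hf : IsHerglotz f) {S : Set ℝ} (hS : MeasurableSet S) {R : ℝ}
    (hR : 0 < R) (hSR : S ⊆ Icc (-R) R) {s : ℝ} (hs : 0 < s) :
    ∫ t in S, (f (t + s * Complex.I)).im ≤ 2 * Real.pi := by
  obtain ⟨hi, he⟩ := integral_poisson_mul_im hf hs 0 hR
  have hnn : ∀ t : ℝ, 0 ≤ (f (t + s * Complex.I)).im := fun t => hf.im_nonneg _ (by simpa using hs)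
  have hp := Real.pi_pos
  have h1 : ∫ t in S, (f (t + s * Complex.I)).im ≤
      ∫ t in S, 2 * Real.pi * R * (poisson R (0 - t) * (f (t + s * Complex.I)).im) := by
    refine integral_mono_of_nonneg (Eventually.of_forall hnn) (hi.integrableOn.const_mul _) ?_
    filter_upwards [ae_restrict_mem hS] with t ht
    rw [← mul_assoc]
    refine le_mul_of_one_le_left (hnn t) ?_
    have ht2 : t ^ 2 ≤ R ^ 2 := by
      have := hSR ht
      exact sq_le_sq' this.1 this.2
    rw [poisson, show 2 * Real.pi * R * (Real.pi⁻¹ * (R / ((0 - t) ^ 2 + R ^ 2))) =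
      2 * R ^ 2 / (t ^ 2 + R ^ 2) by field_simp; ring_nf]
    rw [one_le_div (by positivity)]
    linarith
  refine h1.trans ?_
  rw [integral_const_mul]
  have h2 : ∫ t in S, poisson R (0 - t) * (f (t + s * Complex.I)).im ≤ 1 / R := by
    refine (setIntegral_le_integral hi (Eventually.of_forall fun t =>
      mul_nonneg (poisson_nonneg hR _) (hnn t))).trans ?_
    rw [he]
    refine (le_abs_self _).trans ((Complex.abs_im_le_norm _).trans (isHerglotz_norm_le hf hR ?_))
    simp; exact hs.le
  calc _ ≤ 2 * Real.pi * R * (1 / R) := mul_le_mul_of_nonneg_left h2 (by positivity)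
    _ = _ := by field_simp

lemma continuous_kotaniDefect {d c : ℂ → ℂ} (hd : IsHerglotz d) (hc : IsHerglotz c) (r : ℝ) {s : ℝ}
    (hs : 0 < s) : Continuous fun t : ℝ => kotaniDefect s
      (t + s * Complex.I - r + d (t + s * Complex.I)) (c (t + s * Complex.I)) := by
  have h1 := continuous_horizontal hd.diff hs
  have h2 := continuous_horizontal hc.diff hs
  have p1 : ∀ t : ℝ, 0 ≤ (d (t + s * Complex.I)).im := fun t => hd.im_nonneg _ (by simpa using hs)
  have p2 : ∀ t : ℝ, 0 ≤ (c (t + s * Complex.I)).im := fun t => hc.im_nonneg _ (by simpa using hs)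
  have h3 : Continuous fun t : ℝ => (t + s * Complex.I - r + d (t + s * Complex.I) : ℂ) :=
    (show Continuous fun t : ℝ => (t + s * Complex.I - r : ℂ) by fun_prop).add h1
  have p3 : ∀ t : ℝ, s ≤ (t + s * Complex.I - r + d (t + s * Complex.I) : ℂ).im := fun t => by
    simpa using p1 t
  unfold kotaniDefect
  refine ((continuous_const.div ((Complex.continuous_im.comp h3).sub continuous_const) ?_).add
    (continuous_const.div ((Complex.continuous_im.comp h2).add continuous_const) ?_)).sub
    (continuous_const.mul (Complex.continuous_im.comp ((h3.add h2).inv₀ ?_).neg))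
  · intro t
    change (t + s * Complex.I - r + d (t + s * Complex.I) : ℂ).im - s / 2 ≠ 0
    exact (by linarith [p3 t] :
      0 < (t + s * Complex.I - r + d (t + s * Complex.I) : ℂ).im - s / 2).ne'
  · intro t
    change (c (t + s * Complex.I) : ℂ).im + s / 2 ≠ 0
    exact (by linarith [p2 t] : 0 < (c (t + s * Complex.I) : ℂ).im + s / 2).ne'
  · intro t
    refine ne_zero_of_im_pos ?_
    change 0 < (t + s * Complex.I - r + d (t + s * Complex.I) + c (t + s * Complex.I) : ℂ).im
    rw [Complex.add_im]
    linarith [p3 t, p2 t]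

lemma differentiableOn_chart {f : ℂ → ℂ} (hf : DifferentiableOn ℂ f {z | 0 < z.im})
    (h0 : ∀ z : ℂ, 0 < z.im → 0 ≤ (f z).im) :
    DifferentiableOn ℂ (fun z => chart (f z)) {z | 0 < z.im} := by
  unfold chart
  refine DifferentiableOn.inv (hf.add (differentiableOn_const _)) fun z hz => ?_
  refine ne_zero_of_im_pos ?_
  have := h0 z hz
  simp; linarith

/-- Approximate reflection symmetry of the Weyl functions. -/
lemma norm_chart_add_conj_le {d c : ℂ → ℂ} (hd : IsHerglotz d) (hc : IsHerglotz c) (r : ℝ)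
    {S : Set ℝ} (hS : IsCompact S) {η τ y q : ℝ} (hη : 0 < η) (hτ : 0 < τ) (hy : 0 < y)
    (hq : ∫ t in S, kotaniDefect η (t + η * Complex.I - r + d (t + η * Complex.I))
      (c (t + η * Complex.I)) ≤ q) (x : ℝ) {z : ℂ} (hz : z = x + (y + η : ℝ) * Complex.I) :
    ‖chart (z - r + d z) + (starRingEnd ℂ) (chart (c z))‖ ≤
      2 * (1 - harm S y x) + τ * (η + 2 / y) + q / (Real.pi * y * τ) + η := by
  have hSm := hS.measurableSet
  set a : ℂ → ℂ := fun z => z - r + d z with ha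
  have had : DifferentiableOn ℂ a {z | 0 < z.im} :=
    (differentiableOn_id.sub (differentiableOn_const _)).add hd.diff
  have hai : ∀ z : ℂ, 0 < z.im → z.im ≤ (a z).im := fun z hz => le_im_add z r (hd.im_nonneg z hz)
  have hca := differentiableOn_chart had fun z hz => hz.le.trans (hai z hz)
  have hcc := differentiableOn_chart hc.diff hc.im_nonneg
  have hba : ∀ z : ℂ, η ≤ z.im → ‖chart (a z)‖ ≤ 1 := fun z hz =>
    norm_chart_le ((hη.trans_le hz).le.trans (hai z (hη.trans_le hz)))
  have hbc : ∀ z : ℂ, η ≤ z.im → ‖chart (c z)‖ ≤ 1 := fun z hz =>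
    norm_chart_le (hc.im_nonneg z (hη.trans_le hz))
  have hpa := integral_poisson_mul hca hη hba x hy
  have hpc := integral_poisson_mul hcc hη hbc x hy
  have him : ∀ t : ℝ, (t + η * Complex.I : ℂ).im = η := fun t => by simp
  have hca' := continuous_horizontal hca hη
  have hcc' := continuous_horizontal hcc hη
  set g : ℝ → ℂ := fun t => chart (a (t + η * Complex.I)) +
    (starRingEnd ℂ) (chart (c (t + η * Complex.I))) with hg
  have hgc : Continuous g := hca'.add (Complex.continuous_conj.comp hcc')
  have hg2 : ∀ t, ‖g t‖ ≤ 2 := fun t => by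
    refine (norm_add_le _ _).trans ?_
    rw [Complex.norm_conj]
    linarith [hba (t + η * Complex.I) (him t).ge, hbc (t + η * Complex.I) (him t).ge]
  have hrep : chart (a z) + (starRingEnd ℂ) (chart (c z)) = ∫ t, poisson y (x - t) • g t := by
    have h1 := integrable_poisson_smul hca'.aestronglyMeasurable
      (fun t => hba (t + η * Complex.I) (him t).ge) x hy
    have h2 := integrable_poisson_smul
      (Complex.continuous_conj.comp hcc').aestronglyMeasurable (B := 1)
      (fun t => by
        rw [Function.comp_apply, Complex.norm_conj]; exact hbc (t + η * Complex.I) (him t).ge) x hy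
    rw [hz, ← hpa, ← hpc, ← integral_conj, ← integral_add h1]
    · refine integral_congr_ae (Eventually.of_forall fun t => ?_)
      simp [hg]
    · simpa using h2
  have hQc := continuous_kotaniDefect hd hc r hη
  set Q : ℝ → ℝ := fun t => kotaniDefect η (t + η * Complex.I - r + d (t + η * Complex.I))
    (c (t + η * Complex.I)) with hQ
  set w : ℝ → ℝ := fun t => η + (d (t + η * Complex.I)).im + (c (t + η * Complex.I)).im with hw
  obtain ⟨id1, id2⟩ := integral_poisson_mul_im hd hη x hy
  obtain ⟨ic1, ic2⟩ := integral_poisson_mul_im hc hη x hy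
  have hP := integrable_poisson x hy
  have hwi : Integrable fun t => poisson y (x - t) * w t := by
    refine (((hP.mul_const η).add id1).add ic1).congr (Eventually.of_forall fun t => ?_)
    simp [hw]; ring
  have hd0 : ∀ t : ℝ, 0 ≤ (d (t + η * Complex.I)).im := fun t =>
    hd.im_nonneg _ (by rw [him]; exact hη)
  have hc0 : ∀ t : ℝ, 0 ≤ (c (t + η * Complex.I)).im := fun t =>
    hc.im_nonneg _ (by rw [him]; exact hη)
  have hwint : ∫ t, poisson y (x - t) * w t ≤ η + 2 / y := by
    have e : ∫ t, poisson y (x - t) * w t = η + (d z).im + (c z).im := by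
      rw [hz, ← id2, ← ic2]
      have e1 : ∫ t, poisson y (x - t) * η = η := by
        rw [integral_mul_const, integral_poisson x hy, one_mul]
      have e2 := integral_add (hP.mul_const η) id1
      have e3 := integral_add ((hP.mul_const η).add id1) ic1
      simp only [Pi.add_apply] at e3
      rw [e2, e1] at e3
      rw [← e3]
      refine integral_congr_ae (Eventually.of_forall fun t => ?_)
      simp only [hw]
      ring
    rw [e]
    have hzy : y ≤ z.im := by rw [hz]; simp; exact hη.le
    have b1 := (le_abs_self _).trans
      ((Complex.abs_im_le_norm _).trans (isHerglotz_norm_le hd hy hzy))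
    have b2 := (le_abs_self _).trans
      ((Complex.abs_im_le_norm _).trans (isHerglotz_norm_le hc hy hzy))
    calc _ ≤ η + 1 / y + 1 / y := by linarith
      _ = _ := by ring
  have hpt : ∀ t, ‖g t‖ ≤ τ * w t + Q t / τ + η := fun t => by
    have h := chart_add_conj_le hη hτ (a := a (t + η * Complex.I)) (c := c (t + η * Complex.I))
      (by have := hai (t + η * Complex.I) (by rw [him]; exact hη); rwa [him] at this) (hc0 t)
    refine h.trans (le_of_eq ?_)
    simp [ha, hw, hQ]
  have hQ0 : ∀ t, 0 ≤ Q t := fun t => (kotaniDefect_nonneg_and_bound hη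
      (by have := hai (t + η * Complex.I) (by rw [him]; exact hη); rwa [him] at this) (hc0 t)).1
  change ‖chart (a z) + (starRingEnd ℂ) (chart (c z))‖ ≤ _
  have hPg : Integrable fun t => poisson y (x - t) * ‖g t‖ := by
    have := (integrable_poisson_smul hgc.aestronglyMeasurable hg2 x hy).norm
    refine this.congr (Eventually.of_forall fun t => ?_)
    simp only [norm_smul, Real.norm_eq_abs, abs_of_nonneg (poisson_nonneg hy _)]
  have norm_sum_le : ‖chart (a z) + (starRingEnd ℂ) (chart (c z))‖ ≤
      ∫ t, poisson y (x - t) * ‖g t‖ := by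
    rw [hrep]
    refine (norm_integral_le_integral_norm _).trans (le_of_eq ?_)
    refine integral_congr_ae (Eventually.of_forall fun t => ?_)
    simp only [norm_smul, Real.norm_eq_abs, abs_of_nonneg (poisson_nonneg hy _)]
  refine norm_sum_le.trans ?_
  rw [← integral_add_compl hSm hPg]
  have hcompl : ∫ t in Sᶜ, poisson y (x - t) * ‖g t‖ ≤ 2 * (1 - harm S y x) := by
    have e : 1 - harm S y x = ∫ t in Sᶜ, poisson y (x - t) := by
      linarith [harm_add_compl hSm hy x]
    rw [e, ← integral_const_mul]
    refine integral_mono hPg.integrableOn (hP.integrableOn.const_mul 2) fun t => ?_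
    simp only
    rw [mul_comm 2]
    exact mul_le_mul_of_nonneg_left (hg2 t) (poisson_nonneg hy _)
  have hQi : IntegrableOn Q S := hQc.continuousOn.integrableOn_compact hS
  have hSle : ∫ t in S, poisson y (x - t) * ‖g t‖ ≤
      τ * (η + 2 / y) + q / (Real.pi * y * τ) + η := by
    have h1 : ∫ t in S, poisson y (x - t) * ‖g t‖ ≤ ∫ t in S, (τ * (poisson y (x - t) * w t) +
        1 / (Real.pi * y * τ) * Q t + η * poisson y (x - t)) := by
      refine integral_mono hPg.integrableOn
        (((hwi.integrableOn.const_mul τ).add (hQi.const_mul _)).add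
          (hP.integrableOn.const_mul η)) fun t => ?_
      have hp0 := poisson_nonneg hy (x - t)
      have h2 := mul_le_mul_of_nonneg_left (hpt t) hp0
      have h3 : poisson y (x - t) * (Q t / τ) ≤ 1 / (Real.pi * y * τ) * Q t := by
        calc _ ≤ 1 / (Real.pi * y) * (Q t / τ) :=
              mul_le_mul_of_nonneg_right (poisson_le hy _) (div_nonneg (hQ0 t) hτ.le)
          _ = _ := by field_simp
      simp only
      calc _ ≤ _ := h2
        _ = τ * (poisson y (x - t) * w t) + poisson y (x - t) * (Q t / τ) +
            η * poisson y (x - t) := by ring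
        _ ≤ _ := by linarith
    refine h1.trans ?_
    have e1 := integral_add ((hwi.integrableOn (s := S)).const_mul τ)
      (hQi.const_mul (1 / (Real.pi * y * τ)))
    have e2 := integral_add (((hwi.integrableOn (s := S)).const_mul τ).add
      (hQi.const_mul (1 / (Real.pi * y * τ)))) ((hP.integrableOn (s := S)).const_mul η)
    simp only [Pi.add_apply] at e2
    rw [e2, e1, integral_const_mul, integral_const_mul, integral_const_mul]
    have b1 : ∫ t in S, poisson y (x - t) * w t ≤ η + 2 / y :=
      (setIntegral_le_integral hwi (Eventually.of_forall fun t =>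
        mul_nonneg (poisson_nonneg hy _) (by simp only [hw]; linarith [hd0 t, hc0 t]))).trans hwint
    have b2 : ∫ t in S, poisson y (x - t) ≤ 1 := harm_le_one hSm hy x
    have b3 : 1 / (Real.pi * y * τ) * ∫ t in S, Q t ≤ q / (Real.pi * y * τ) := by
      rw [div_eq_mul_one_div q, mul_comm]
      have := Real.pi_pos
      exact mul_le_mul_of_nonneg_right hq (by positivity)
    have b4 := mul_le_mul_of_nonneg_left b1 hτ.le
    have b5 := mul_le_mul_of_nonneg_left b2 hη.le
    linarith
  linarith

/-- The Cauchy transform of the indicator of `S`, normalised so that its real part is the harmonic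
measure of `S`. -/
noncomputable def cauchyTransform (S : Set ℝ) (z : ℂ) : ℂ :=
  (Real.pi * Complex.I)⁻¹ * ∫ t in S, ((t : ℂ) - z)⁻¹

lemma im_le_norm_ofReal_sub (t : ℝ) (z : ℂ) : z.im ≤ ‖(t : ℂ) - z‖ := by
  have := (neg_le_abs _).trans (Complex.abs_im_le_norm ((t : ℂ) - z))
  simpa using this

lemma norm_inv_ofReal_sub_le {y : ℝ} (hy : 0 < y) {z : ℂ} (hz : y ≤ z.im) (t : ℝ) :
    ‖((t : ℂ) - z)⁻¹‖ ≤ y⁻¹ := by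
  rw [norm_inv]
  exact inv_anti₀ hy (hz.trans (im_le_norm_ofReal_sub t z))

lemma ofReal_sub_ne_zero {z : ℂ} (hz : 0 < z.im) (t : ℝ) : (t : ℂ) - z ≠ 0 := by
  rw [← norm_pos_iff]
  exact hz.trans_le (im_le_norm_ofReal_sub t z)

lemma continuous_inv_ofReal_sub {z : ℂ} (hz : 0 < z.im) :
    Continuous fun t : ℝ => ((t : ℂ) - z)⁻¹ :=
  (Complex.continuous_ofReal.sub continuous_const).inv₀ fun t => ofReal_sub_ne_zero hz t

lemma differentiableOn_cauchyTransform {S : Set ℝ} (hS : IsCompact S) :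
    DifferentiableOn ℂ (cauchyTransform S) {z | 0 < z.im} := by
  intro z hz
  have hz : 0 < z.im := hz
  have hfin : IsFiniteMeasure (volume.restrict S) := ⟨by simpa using hS.measure_lt_top⟩
  have him : ∀ w ∈ Metric.ball z (z.im / 2), z.im / 2 ≤ w.im := fun w hw => by
    have h1 := (neg_le_abs _).trans (Complex.abs_im_le_norm (w - z))
    rw [Metric.mem_ball, dist_eq_norm] at hw
    simp only [Complex.sub_im] at h1
    linarith
  have h := hasDerivAt_integral_of_dominated_loc_of_deriv_le (μ := volume.restrict S) (𝕜 := ℂ)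
    (F := fun w t => ((t : ℂ) - w)⁻¹) (F' := fun w t => (((t : ℂ) - w)⁻¹) ^ 2) (x₀ := z)
    (s := Metric.ball z (z.im / 2)) (bound := fun _ => ((z.im / 2)⁻¹) ^ 2)
    (Metric.ball_mem_nhds z (half_pos hz)) ?_ ?_ ?_ ?_ ?_ ?_
  · exact (h.2.differentiableAt.const_mul _).differentiableWithinAt
  · filter_upwards [Metric.ball_mem_nhds z (half_pos hz)] with w hw
    exact (continuous_inv_ofReal_sub ((half_pos hz).trans_le (him w hw))).aestronglyMeasurable
  · exact (continuous_inv_ofReal_sub hz).continuousOn.integrableOn_compact hS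
  · exact ((continuous_inv_ofReal_sub hz).pow 2).aestronglyMeasurable
  · refine Eventually.of_forall fun t w hw => ?_
    rw [norm_pow]
    exact pow_le_pow_left₀ (norm_nonneg _) (norm_inv_ofReal_sub_le (half_pos hz) (him w hw) t) 2
  · exact integrable_const _
  · refine Eventually.of_forall fun t w hw => ?_
    have hne := ofReal_sub_ne_zero ((half_pos hz).trans_le (him w hw)) t
    refine (((hasDerivAt_id w).const_sub (t : ℂ)).inv hne).congr_deriv ?_
    simp

lemma cauchyTransform_re {S : Set ℝ} (hS : IsCompact S) {y : ℝ} (hy : 0 < y) (x : ℝ) :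
    (cauchyTransform S (x + y * Complex.I)).re = harm S y x := by
  have hz : 0 < (x + y * Complex.I : ℂ).im := by simpa using hy
  have hi : IntegrableOn (fun t : ℝ => ((t : ℂ) - (x + y * Complex.I))⁻¹) S :=
    (continuous_inv_ofReal_sub hz).continuousOn.integrableOn_compact hS
  have h1 : (∫ t in S, ((t : ℂ) - (x + y * Complex.I))⁻¹).im =
      ∫ t in S, (((t : ℂ) - (x + y * Complex.I))⁻¹).im := by
    rw [← RCLike.im_eq_complex_im, ← integral_im hi]
  have h2 : (Real.pi * Complex.I : ℂ)⁻¹ = -((Real.pi⁻¹ : ℝ) * Complex.I) := by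
    rw [mul_inv, Complex.inv_I, Complex.ofReal_inv]; ring
  rw [cauchyTransform, h2, harm]
  have h3 : ∀ w : ℂ, (-((Real.pi⁻¹ : ℝ) * Complex.I) * w).re = Real.pi⁻¹ * w.im := fun w => by
    simp
  rw [h3, h1, ← integral_const_mul]
  refine integral_congr_ae (Eventually.of_forall fun t => ?_)
  simp only [poisson]
  rw [Complex.inv_im]
  have h4 : Complex.normSq ((t : ℂ) - (x + y * Complex.I)) = (x - t) ^ 2 + y ^ 2 := by
    simp [Complex.normSq_apply]; ring
  rw [h4]
  simp

lemma norm_cauchyTransform_le {S : Set ℝ} (hS : IsCompact S) {y : ℝ} (hy : 0 < y) {z : ℂ}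
    (hz : y ≤ z.im) : ‖cauchyTransform S z‖ ≤ Real.pi⁻¹ * (y⁻¹ * volume.real S) := by
  rw [cauchyTransform, norm_mul]
  have h1 : ‖(Real.pi * Complex.I : ℂ)⁻¹‖ = Real.pi⁻¹ := by
    simp [abs_of_pos Real.pi_pos]
  rw [h1]
  refine mul_le_mul_of_nonneg_left ?_ (inv_nonneg.2 Real.pi_pos.le)
  exact norm_setIntegral_le_of_norm_le_const hS.measure_lt_top
    fun t _ => norm_inv_ofReal_sub_le hy hz t

lemma continuous_harm {S : Set ℝ} (hS : IsCompact S) {y : ℝ} (hy : 0 < y) :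
    Continuous (harm S y) := by
  have h := Complex.continuous_re.comp
    (continuous_horizontal (differentiableOn_cauchyTransform hS) hy)
  refine h.congr fun t => ?_
  exact cauchyTransform_re hS hy t

/-- The semigroup property of the Poisson kernel, for harmonic measure. -/
lemma integral_poisson_mul_harm {S : Set ℝ} (hS : IsCompact S) {s y : ℝ} (hs : 0 < s) (hy : 0 < y)
    (x : ℝ) : ∫ t, poisson y (x - t) * harm S s t = harm S (y + s) x := by
  have hc := continuous_horizontal (differentiableOn_cauchyTransform hS) hs
  have hb : ∀ t : ℝ, ‖cauchyTransform S (t + s * Complex.I)‖ ≤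
      Real.pi⁻¹ * (s⁻¹ * volume.real S) := fun t =>
    norm_cauchyTransform_le hS hs (by simp)
  have h := integral_poisson_mul (differentiableOn_cauchyTransform hS) hs
    (fun z hz => norm_cauchyTransform_le hS hs hz) x hy
  have hi := integrable_poisson_smul hc.aestronglyMeasurable hb x hy
  rw [← cauchyTransform_re hS (by positivity) x, ← h, ← RCLike.re_eq_complex_re, ← integral_re hi]
  refine integral_congr_ae (Eventually.of_forall fun t => ?_)
  simp [cauchyTransform_re hS hs]

lemma tendsto_harm_of_notMem {S : Set ℝ} (hS : IsCompact S) {x : ℝ} (hx : x ∉ S) :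
    Tendsto (fun y => harm S y x) (nhdsWithin 0 (Ioi 0)) (nhds 0) := by
  obtain ⟨δ, hδ, hδS⟩ := Metric.isOpen_iff.1 hS.isClosed.isOpen_compl x hx
  have hlim : Tendsto (fun y : ℝ => Real.pi⁻¹ * (y / δ ^ 2) * volume.real S)
      (nhdsWithin 0 (Ioi 0)) (nhds 0) := by
    have : Continuous fun y : ℝ => Real.pi⁻¹ * (y / δ ^ 2) * volume.real S := by fun_prop
    have h0 := (this.tendsto 0).mono_left (nhdsWithin_le_nhds (s := Ioi 0))
    simpa using h0
  refine tendsto_of_tendsto_of_tendsto_of_le_of_le' tendsto_const_nhds hlim ?_ ?_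
  · filter_upwards [self_mem_nhdsWithin] with y hy
    exact harm_nonneg S hy x
  · filter_upwards [self_mem_nhdsWithin] with y hy
    have hy : 0 < y := hy
    refine (le_abs_self _).trans ?_
    rw [← Real.norm_eq_abs]
    refine norm_setIntegral_le_of_norm_le_const hS.measure_lt_top fun t ht => ?_
    have hxt : δ ≤ |x - t| := by
      by_contra hlt
      push Not at hlt
      refine hδS (?_ : t ∈ _) ht
      rw [Metric.mem_ball, Real.dist_eq, abs_sub_comm]
      exact hlt
    have h2 : δ ^ 2 ≤ (x - t) ^ 2 := by
      rw [← sq_abs (x - t)]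
      exact pow_le_pow_left₀ hδ.le hxt 2
    rw [Real.norm_eq_abs, abs_of_nonneg (poisson_nonneg hy _), poisson]
    refine mul_le_mul_of_nonneg_left ?_ (inv_nonneg.2 Real.pi_pos.le)
    exact div_le_div_of_nonneg_left hy.le (by positivity) (by nlinarith [sq_nonneg y])

/-- Near the real axis, harmonic measure is close to `0` or `1` in the mean. -/
lemma tendsto_integral_harm_mul_one_sub {S : Set ℝ} (hS : IsCompact S) {h : ℝ} (hh : 0 < h) :
    Tendsto (fun y => ∫ t, poisson h (0 - t) * (harm S y t * (1 - harm S y t)))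
      (nhdsWithin 0 (Ioi 0)) (nhds 0) := by
  have hSm := hS.measurableSet
  have hP := integrable_poisson 0 hh
  have hlim1 : Tendsto (fun y => harm S (h + y) 0) (nhdsWithin 0 (Ioi 0)) (nhds (harm S h 0)) := by
    have hd : ContinuousAt (cauchyTransform S) ((0 : ℝ) + h * Complex.I) :=
      ((differentiableOn_cauchyTransform hS).differentiableAt
        ((isOpen_lt continuous_const Complex.continuous_im).mem_nhds
          (by simpa using hh))).continuousAt
    have hc : Tendsto (fun y : ℝ => ((0 : ℝ) + (h + y : ℝ) * Complex.I : ℂ)) (nhdsWithin 0 (Ioi 0))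
        (nhds ((0 : ℝ) + h * Complex.I)) := by
      have : Continuous fun y : ℝ => ((0 : ℝ) + (h + y : ℝ) * Complex.I : ℂ) := by fun_prop
      have h0 := (this.tendsto 0).mono_left (nhdsWithin_le_nhds (s := Ioi 0))
      simpa using h0
    have h1 := (Complex.continuous_re.tendsto _).comp (hd.tendsto.comp hc)
    rw [cauchyTransform_re hS hh 0] at h1
    refine h1.congr' ?_
    filter_upwards [self_mem_nhdsWithin] with y hy
    exact cauchyTransform_re hS (add_pos hh hy) 0
  have hlim2 : Tendsto (fun y => ∫ t in Sᶜ, poisson h (0 - t) * harm S y t)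
      (nhdsWithin 0 (Ioi 0)) (nhds 0) := by
    have h := tendsto_integral_filter_of_dominated_convergence (μ := volume.restrict Sᶜ)
      (l := nhdsWithin (0 : ℝ) (Ioi 0)) (F := fun y t => poisson h (0 - t) * harm S y t)
      (f := fun _ => (0 : ℝ)) (fun t => poisson h (0 - t)) ?_ ?_ hP.integrableOn ?_
    · simpa using h
    · filter_upwards [self_mem_nhdsWithin] with y hy
      exact (hP.aestronglyMeasurable.mul (continuous_harm hS hy).aestronglyMeasurable).restrict
    · filter_upwards [self_mem_nhdsWithin] with y hy
      refine Eventually.of_forall fun t => ?_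
      rw [Real.norm_eq_abs, abs_of_nonneg (mul_nonneg (poisson_nonneg hh _) (harm_nonneg S hy t))]
      exact mul_le_of_le_one_right (poisson_nonneg hh _) (harm_le_one hSm hy t)
    · filter_upwards [ae_restrict_mem hSm.compl] with t ht
      simpa using (tendsto_harm_of_notMem hS ht).const_mul (poisson h (0 - t))
  have hlim : Tendsto (fun y => harm S h 0 - harm S (h + y) 0 +
      2 * ∫ t in Sᶜ, poisson h (0 - t) * harm S y t) (nhdsWithin 0 (Ioi 0)) (nhds 0) := by
    simpa using (hlim1.const_sub (harm S h 0)).add (hlim2.const_mul 2)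
  refine tendsto_of_tendsto_of_tendsto_of_le_of_le' tendsto_const_nhds hlim ?_ ?_
  · filter_upwards [self_mem_nhdsWithin] with y hy
    exact integral_nonneg fun t => mul_nonneg (poisson_nonneg hh _)
      (mul_nonneg (harm_nonneg S hy t) (by linarith [harm_le_one hSm hy t]))
  · filter_upwards [self_mem_nhdsWithin] with y hy
    have hc := continuous_harm hS hy
    have hu0 := harm_nonneg S hy
    have hu1 := harm_le_one hSm hy
    have i1 : Integrable fun t => poisson h (0 - t) * harm S y t :=
      integrable_poisson_smul hc.aestronglyMeasurable (B := 1)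
        (fun t => by rw [Real.norm_eq_abs, abs_of_nonneg (hu0 t)]; exact hu1 t) 0 hh
    have i2 : Integrable fun t => poisson h (0 - t) * (harm S y t * (1 - harm S y t)) :=
      integrable_poisson_smul (hc.mul (continuous_const.sub hc)).aestronglyMeasurable (B := 1)
        (fun t => by
          change |harm S y t * (1 - harm S y t)| ≤ 1
          rw [abs_of_nonneg (mul_nonneg (hu0 t) (by linarith [hu1 t]))]
          nlinarith [hu0 t, hu1 t]) 0 hh
    have e := integral_poisson_mul_harm hS hy hh 0
    rw [← integral_add_compl hSm i1] at e
    rw [← integral_add_compl hSm i2]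
    have b1 : ∫ t in S, poisson h (0 - t) * (harm S y t * (1 - harm S y t)) ≤
        ∫ t in S, (poisson h (0 - t) - poisson h (0 - t) * harm S y t) := by
      refine integral_mono i2.integrableOn (hP.integrableOn.sub i1.integrableOn) fun t => ?_
      have : 0 ≤ poisson h (0 - t) * ((1 - harm S y t) * (1 - harm S y t)) :=
        mul_nonneg (poisson_nonneg hh _) (mul_self_nonneg _)
      simp only
      nlinarith
    have b2 : ∫ t in Sᶜ, poisson h (0 - t) * (harm S y t * (1 - harm S y t)) ≤
        ∫ t in Sᶜ, poisson h (0 - t) * harm S y t := by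
      refine integral_mono i2.integrableOn i1.integrableOn fun t => ?_
      refine mul_le_mul_of_nonneg_left ?_ (poisson_nonneg hh _)
      nlinarith [hu0 t, hu1 t]
    rw [integral_sub hP.integrableOn i1.integrableOn] at b1
    change _ ≤ harm S h 0 - _ at b1
    linarith

lemma exp_mul_le (M : ℝ) {u : ℝ} (hu0 : 0 ≤ u) (hu1 : u ≤ 1) :
    Real.exp (M * u) ≤ 1 + u * Real.exp M := by
  have h := convexOn_exp.2 (mem_univ (0 : ℝ)) (mem_univ M) (sub_nonneg.2 hu1) hu0 (by ring)
  simp only [smul_eq_mul, mul_zero, zero_add, Real.exp_zero, mul_one] at h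
  rw [mul_comm M u]
  linarith

/-- A bounded analytic function which is nearly controlled by `1 - harm S` close to the real axis
is small at the interior points, when `S` has positive measure. -/
lemma exists_height_norm_lt {S : Set ℝ} (hS : IsCompact S) (hpos : 0 < volume.real S) {r : ℝ}
    (hr : 0 < r) : ∃ y e : ℝ, 0 < y ∧ y ≤ 1 ∧ 0 < e ∧ ∀ (d : ℂ → ℂ) (η : ℝ), 0 < η →
      DifferentiableOn ℂ d {z | 0 < z.im} → (∀ z : ℂ, 0 < z.im → ‖d z‖ ≤ 2) →
      (∀ x : ℝ, ‖d (x + (y + η : ℝ) * Complex.I)‖ ≤ 4 * (1 - harm S y x) + e) →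
      ‖d ((3 + y + η : ℝ) * Complex.I)‖ < r := by
  have hSm := hS.measurableSet
  have hpi := Real.pi_pos
  obtain ⟨R, hR⟩ := hS.isBounded.exists_norm_le
  set U : ℝ := Real.pi⁻¹ * (3 / (R ^ 2 + 16)) * volume.real S with hU
  have hU0 : 0 < U := by positivity
  have hlow : ∀ y : ℝ, 0 < y → y ≤ 1 → U ≤ harm S (3 + y) 0 := fun y hy hy1 => by
    have hfin : volume S ≠ ⊤ := hS.measure_lt_top.ne
    have h1 : U = ∫ _ in S, Real.pi⁻¹ * (3 / (R ^ 2 + 16)) := by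
      rw [setIntegral_const, smul_eq_mul, mul_comm, hU]
    rw [h1]
    refine setIntegral_mono_on (integrableOn_const hfin)
      (integrable_poisson 0 (by positivity : 0 < 3 + y)).integrableOn hSm fun t ht => ?_
    rw [poisson]
    refine mul_le_mul_of_nonneg_left ?_ (inv_nonneg.2 hpi.le)
    have ht := hR t ht
    rw [Real.norm_eq_abs] at ht
    have ht2 : t ^ 2 ≤ R ^ 2 := by
      rw [← sq_abs t]
      exact pow_le_pow_left₀ (abs_nonneg t) ht 2
    exact div_le_div₀ (by positivity) (by linarith) (by positivity) (by nlinarith)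
  obtain ⟨M, hM0, hM⟩ : ∃ M : ℝ, 0 ≤ M ∧ 6 / r ≤ Real.exp (M * U) := by
    refine ⟨6 / r / U, by positivity, ?_⟩
    rw [div_mul_cancel₀ _ hU0.ne']
    linarith [Real.add_one_le_exp (6 / r)]
  have hE : 0 < Real.exp M := Real.exp_pos M
  have hev := (tendsto_integral_harm_mul_one_sub hS (h := 3) (by norm_num)).eventually
    (gt_mem_nhds (show (0 : ℝ) < 1 / (8 * Real.exp M) by positivity))
  have hev2 : ∀ᶠ y : ℝ in nhdsWithin 0 (Ioi 0), y < 1 :=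
    (gt_mem_nhds (show (0 : ℝ) < 1 by norm_num)).filter_mono nhdsWithin_le_nhds
  obtain ⟨y, hyT, hy1, hy⟩ := (hev.and (hev2.and self_mem_nhdsWithin)).exists
  have hy : 0 < y := hy
  refine ⟨y, 1 / Real.exp M, hy, hy1.le, by positivity, fun d η hη hd hd2 hdx => ?_⟩
  have hu0 := harm_nonneg S hy
  have hu1 := harm_le_one hSm hy
  have hc := continuous_harm hS hy
  set G : ℂ → ℂ := fun z => d (z + η * Complex.I) * Complex.exp (M * cauchyTransform S z) with hG
  have hshift : ∀ z : ℂ, (z + η * Complex.I).im = z.im + η := fun z => by simp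
  have hGd : DifferentiableOn ℂ G {z | 0 < z.im} := by
    refine DifferentiableOn.mul (hd.comp (by fun_prop) fun z hz => ?_)
      (((differentiableOn_cauchyTransform hS).const_mul (M : ℂ)).cexp)
    have hz : 0 < z.im := hz
    change 0 < (z + η * Complex.I).im
    rw [hshift]
    linarith
  have hGn : ∀ z : ℂ, ‖G z‖ =
      ‖d (z + η * Complex.I)‖ * Real.exp (M * (cauchyTransform S z).re) := fun z => by
    simp [hG, Complex.norm_exp]
  have hGb : ∀ z : ℂ, y ≤ z.im →
      ‖G z‖ ≤ 2 * Real.exp (M * (Real.pi⁻¹ * (y⁻¹ * volume.real S))) := fun z hz => by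
    rw [hGn]
    refine mul_le_mul (hd2 _ (by rw [hshift]; linarith)) ?_ (Real.exp_pos _).le zero_le_two
    refine Real.exp_le_exp.2 (mul_le_mul_of_nonneg_left ?_ hM0)
    exact (Complex.re_le_norm _).trans (norm_cauchyTransform_le hS hy hz)
  have hrep := integral_poisson_mul hGd hy hGb 0 (show (0 : ℝ) < 3 by norm_num)
  have hGc := continuous_horizontal hGd hy
  have h3 : (0 : ℝ) < 3 := by norm_num
  have hP := integrable_poisson 0 h3
  have hGi := integrable_poisson_smul hGc.aestronglyMeasurable
    (fun t => hGb (t + y * Complex.I) (by simp)) 0 h3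
  have i2 : Integrable fun t => poisson 3 (0 - t) * (harm S y t * (1 - harm S y t)) :=
    integrable_poisson_smul (hc.mul (continuous_const.sub hc)).aestronglyMeasurable (B := 1)
      (fun t => by
        change |harm S y t * (1 - harm S y t)| ≤ 1
        rw [abs_of_nonneg (mul_nonneg (hu0 t) (by linarith [hu1 t]))]
        nlinarith [hu0 t, hu1 t]) 0 h3
  have hpt : ∀ t : ℝ, ‖G (t + y * Complex.I)‖ ≤
      5 + 4 * Real.exp M * (harm S y t * (1 - harm S y t)) := fun t => by
    rw [hGn, cauchyTransform_re hS hy t]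
    have e1 : (t + y * Complex.I + η * Complex.I : ℂ) = t + (y + η : ℝ) * Complex.I := by
      push_cast; ring
    rw [e1]
    have b1 := exp_mul_le M (hu0 t) (hu1 t)
    have b2 : Real.exp (M * harm S y t) ≤ Real.exp M := by
      refine Real.exp_le_exp.2 ?_
      nlinarith [hu1 t]
    have hp := Real.exp_pos (M * harm S y t)
    have hu := hu0 t
    have hu' : 0 ≤ 1 - harm S y t := by linarith [hu1 t]
    calc _ ≤ (4 * (1 - harm S y t) + 1 / Real.exp M) * Real.exp (M * harm S y t) :=
          mul_le_mul_of_nonneg_right (hdx t) hp.le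
      _ = 4 * (1 - harm S y t) * Real.exp (M * harm S y t) +
          1 / Real.exp M * Real.exp (M * harm S y t) := by ring
      _ ≤ 4 * (1 - harm S y t) * (1 + harm S y t * Real.exp M) +
          1 / Real.exp M * Real.exp M :=
          add_le_add (mul_le_mul_of_nonneg_left b1 (by positivity))
            (mul_le_mul_of_nonneg_left b2 (by positivity))
      _ = 4 * (1 - harm S y t) + 1 + 4 * Real.exp M * (harm S y t * (1 - harm S y t)) := by
          field_simp
          ring
      _ ≤ _ := by linarith
  have hle : ‖G ((0 : ℝ) + (3 + y : ℝ) * Complex.I)‖ ≤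
      5 + 4 * Real.exp M * ∫ t, poisson 3 (0 - t) * (harm S y t * (1 - harm S y t)) := by
    rw [← hrep]
    refine (norm_integral_le_integral_norm _).trans ?_
    have hm : ∫ t : ℝ, ‖poisson 3 (0 - t) • G (t + y * Complex.I)‖ ≤
        ∫ t, (5 * poisson 3 (0 - t) +
          4 * Real.exp M * (poisson 3 (0 - t) * (harm S y t * (1 - harm S y t)))) := by
      refine integral_mono hGi.norm ((hP.const_mul 5).add (i2.const_mul _)) fun t => ?_
      have hp0 := poisson_nonneg h3 (0 - t)
      simp only [norm_smul, Real.norm_eq_abs, abs_of_nonneg hp0]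
      refine (mul_le_mul_of_nonneg_left (hpt t) hp0).trans (le_of_eq ?_)
      ring
    refine hm.trans (le_of_eq ?_)
    have e := integral_add (hP.const_mul 5) (i2.const_mul (4 * Real.exp M))
    rw [e, integral_const_mul, integral_const_mul, integral_poisson 0 h3]
    ring
  have hT : 4 * Real.exp M * ∫ t, poisson 3 (0 - t) * (harm S y t * (1 - harm S y t)) <
      1 := by
    have := mul_lt_mul_of_pos_left hyT (show 0 < 4 * Real.exp M by positivity)
    refine this.trans ?_
    field_simp
    norm_num
  rw [hGn, cauchyTransform_re hS (by positivity) 0] at hle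
  have e1 : ((0 : ℝ) + (3 + y : ℝ) * Complex.I + η * Complex.I : ℂ) =
      (3 + y + η : ℝ) * Complex.I := by
    push_cast; ring
  rw [e1] at hle
  have hexp : 6 / r ≤ Real.exp (M * harm S (3 + y) 0) :=
    hM.trans (Real.exp_le_exp.2 (mul_le_mul_of_nonneg_left (hlow y hy hy1.le) hM0))
  by_contra hcon
  push Not at hcon
  have := mul_le_mul hcon hexp (by positivity) (norm_nonneg _)
  rw [mul_div_cancel₀ _ hr.ne'] at this
  linarith

/-- The integral over `S` of `logDet` at height `s`. -/
noncomputable def intLogDet (S : Set ℝ) (v : ℕ → ℝ) (N : ℕ) (s : ℝ) : ℝ :=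
  ∫ E in S, logDet v N (E + s * Complex.I)

/-- The integral over `S` of the trace of the imaginary part of the Green function. -/
noncomputable def intGreen (S : Set ℝ) (v : ℕ → ℝ) (N : ℕ) (s : ℝ) : ℝ :=
  ∫ E in S, ∑ k ∈ Finset.range N, greenIm v N (E + s * Complex.I) k

lemma continuous_logDet (v : ℕ → ℝ) (N : ℕ) {s : ℝ} (hs : 0 < s) :
    Continuous fun E : ℝ => logDet v N (E + s * Complex.I) := by
  have him : ∀ E : ℝ, 0 < (E + s * Complex.I : ℂ).im := fun E => by simpa using hs
  have h : Continuous fun E : ℝ => boxDet v (E + s * Complex.I) N :=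
    (continuous_boxDet v N).comp (by fun_prop)
  refine (h.norm.log fun E => norm_ne_zero_iff.2 (boxDet_ne_zero v (him E) N)).congr fun E => ?_
  exact (logDet_eq v (him E) N).symm

lemma continuous_greenIm (v : ℕ → ℝ) (N k : ℕ) {s : ℝ} (hs : 0 < s) :
    Continuous fun E : ℝ => greenIm v N (E + s * Complex.I) k :=
  Complex.continuous_im.comp (continuous_horizontal (isHerglotz_green v N k).diff hs)

lemma abs_greenIm_le (v : ℕ → ℝ) (N k : ℕ) {s : ℝ} {z : ℂ} (hs : 0 < s) (hz : s ≤ z.im) :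
    |greenIm v N z k| ≤ 1 / s :=
  (Complex.abs_im_le_norm _).trans (isHerglotz_norm_le (isHerglotz_green v N k) hs hz)

lemma integrableOn_of_continuous {S : Set ℝ} (hS : IsCompact S) {f : ℝ → ℝ} (hf : Continuous f) :
    IntegrableOn f S := hf.continuousOn.integrableOn_compact hS

lemma hasDerivAt_intLogDet {S : Set ℝ} (hS : IsCompact S) (v : ℕ → ℝ) (N : ℕ) {η : ℝ}
    (hη : 0 < η) : HasDerivAt (intLogDet S v (N + 1)) (intGreen S v (N + 1) η) η := by
  have hfin : IsFiniteMeasure (volume.restrict S) := ⟨by simpa using hS.measure_lt_top⟩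
  have hball : ∀ s ∈ Metric.ball η (η / 2), η / 2 < s := fun s hs => by
    rw [Metric.mem_ball, Real.dist_eq, abs_lt] at hs
    linarith
  refine (hasDerivAt_integral_of_dominated_loc_of_deriv_le (μ := volume.restrict S) (𝕜 := ℝ)
    (F := fun s E => logDet v (N + 1) ((E : ℝ) + s * Complex.I))
    (F' := fun s E => ∑ k ∈ Finset.range (N + 1), greenIm v (N + 1) ((E : ℝ) + s * Complex.I) k)
    (x₀ := η) (s := Metric.ball η (η / 2)) (bound := fun _ => (N + 1 : ℕ) * (1 / (η / 2)))
    (Metric.ball_mem_nhds η (half_pos hη)) ?_ ?_ ?_ ?_ ?_ ?_).2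
  · filter_upwards [Metric.ball_mem_nhds η (half_pos hη)] with s hs
    exact (continuous_logDet v _ ((half_pos hη).trans (hball s hs))).aestronglyMeasurable
  · exact integrableOn_of_continuous hS (continuous_logDet v _ hη)
  · exact (continuous_finsetSum _ fun k _ => continuous_greenIm v _ k hη).aestronglyMeasurable
  · refine Eventually.of_forall fun E s hs => ?_
    refine (norm_sum_le _ _).trans ?_
    refine (Finset.sum_le_card_nsmul _ _ (1 / (η / 2)) fun k _ => ?_).trans (le_of_eq (by simp))
    exact abs_greenIm_le v _ k (half_pos hη) (by simpa using (hball s hs).le)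
  · exact integrable_const _
  · refine Eventually.of_forall fun E s hs => ?_
    exact hasDerivAt_logDet v E ((half_pos hη).trans (hball s hs)) N

lemma intGreen_le {S : Set ℝ} (hS : IsCompact S) (v : ℕ → ℝ) (N : ℕ) {η : ℝ} (hη : 0 < η) :
    intGreen S v N η ≤ 2 * Real.pi * N := by
  obtain ⟨R, hR⟩ := hS.isBounded.exists_norm_le
  rw [intGreen, integral_finsetSum _ fun k _ =>
    integrableOn_of_continuous hS (continuous_greenIm v N k hη)]
  refine (Finset.sum_le_card_nsmul _ _ (2 * Real.pi) fun k _ => ?_).trans (le_of_eq ?_)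
  · refine integral_green_le (isHerglotz_green v N k) hS.measurableSet
      (show 0 < max R 1 by positivity) (fun t ht => ?_) hη
    rw [mem_Icc, ← abs_le]
    exact (hR t ht).trans (le_max_left _ _)
  · simp; ring

lemma le_intLogDet {S : Set ℝ} (hS : IsCompact S) (v : ℕ → ℝ) (N : ℕ) {η : ℝ} (hη : 0 < η) :
    volume.real S * (Real.log η - 1) ≤ intLogDet S v (N + 1) η := by
  rw [← smul_eq_mul, ← setIntegral_const]
  refine integral_mono (integrableOn_const hS.measure_lt_top.ne)
    (integrableOn_of_continuous hS (continuous_logDet v _ hη)) fun E => ?_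
  have := le_logDet v (z := E + η * Complex.I) (by simpa using hη) N
  simpa using this

lemma continuous_log_max {X : Type*} [TopologicalSpace X] {f : X → ℂ} (hf : Continuous f) :
    Continuous fun x => Real.log (max 1 ‖f x‖) :=
  (continuous_const.max hf.norm).log fun _ => (zero_lt_one.trans_le (le_max_left _ _)).ne'

lemma intLogDet_le {S : Set ℝ} (hS : IsCompact S) (v : ℕ → ℝ) (N : ℕ) {η : ℝ} (hη : 0 < η) :
    intLogDet S v (N + 1) η ≤ 2 * Real.pi * (N + 1 : ℕ) * η +
      ∫ E : ℝ in S, Real.log (max 1 ‖boxDet v E (N + 1)‖) := by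
  have hcont : Continuous fun s : ℝ => ∫ E : ℝ in S,
      Real.log (max 1 ‖boxDet v (E + s * Complex.I) (N + 1)‖) := by
    refine continuous_parametric_integral_of_continuous ?_ hS
    exact continuous_log_max ((continuous_boxDet v (N + 1)).comp (by fun_prop))
  have hlim : Tendsto (fun s : ℝ => 2 * Real.pi * (N + 1 : ℕ) * (η - s) + ∫ E : ℝ in S,
      Real.log (max 1 ‖boxDet v (E + s * Complex.I) (N + 1)‖)) (nhdsWithin 0 (Ioi 0))
      (nhds (2 * Real.pi * (N + 1 : ℕ) * η +
        ∫ E : ℝ in S, Real.log (max 1 ‖boxDet v E (N + 1)‖))) := by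
    have h2 : Continuous fun s : ℝ => 2 * Real.pi * (N + 1 : ℕ) * (η - s) := by fun_prop
    have := ((h2.tendsto 0).add (hcont.tendsto 0)).mono_left (nhdsWithin_le_nhds (s := Ioi 0))
    simp only [Complex.ofReal_zero, zero_mul, add_zero, sub_zero] at this
    exact this
  refine ge_of_tendsto hlim ?_
  have hev : ∀ᶠ s : ℝ in nhdsWithin 0 (Ioi 0), s < η :=
    (gt_mem_nhds hη).filter_mono nhdsWithin_le_nhds
  filter_upwards [self_mem_nhdsWithin, hev] with s hs hsη
  have hs : 0 < s := hs
  have hder := fun t (ht : 0 < t) => hasDerivAt_intLogDet hS v N ht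
  have h1 := (convex_Ioi (0 : ℝ)).image_sub_le_mul_sub_of_deriv_le
    (f := intLogDet S v (N + 1))
    (fun t ht => (hder t ht).continuousAt.continuousWithinAt)
    (fun t ht => (hder t (interior_subset ht)).differentiableAt.differentiableWithinAt)
    (C := 2 * Real.pi * (N + 1 : ℕ))
    (fun t ht => by
      rw [(hder t (interior_subset ht)).deriv]
      exact intGreen_le hS v _ (interior_subset ht)) s hs η hη hsη.le
  have h2 : intLogDet S v (N + 1) s ≤ ∫ E : ℝ in S,
      Real.log (max 1 ‖boxDet v (E + s * Complex.I) (N + 1)‖) := by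
    refine integral_mono (integrableOn_of_continuous hS (continuous_logDet v _ hs))
      (integrableOn_of_continuous hS (continuous_log_max
        ((continuous_boxDet v (N + 1)).comp (by fun_prop)))) fun E => ?_
    have him : 0 < (E + s * Complex.I : ℂ).im := by simpa using hs
    simp only
    rw [logDet_eq v him]
    exact Real.log_le_log (norm_pos_iff.2 (boxDet_ne_zero v him _)) (le_max_right _ _)
  linarith

lemma eventually_integral_log_le {S : Set ℝ} (hS : IsCompact S) {V : ℤ → ℝ} (hV : ∀ n, |V n| ≤ 1)
    (hgr : ∀ E ∈ S, ∀ ε > 0, ∀ᶠ n : ℕ in atTop,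
      Real.log (entryNorm (transferProd V E 0 n)) ≤ ε * n) {ε : ℝ} (hε : 0 < ε) :
    ∀ᶠ n : ℕ in atTop,
      ∫ E : ℝ in S, Real.log (max 1 ‖boxDet (fun k => V k) E n‖) ≤ ε * n := by
  have hfin : IsFiniteMeasure (volume.restrict S) := ⟨by simpa using hS.measure_lt_top⟩
  obtain ⟨R, hR⟩ := hS.isBounded.exists_norm_le
  have hle : ∀ (E : ℝ) (n : ℕ), Real.log (max 1 ‖boxDet (fun k => V k) E n‖) ≤
      Real.log (entryNorm (transferProd V E 0 n)) := fun E n =>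
    Real.log_le_log (zero_lt_one.trans_le (le_max_left _ _))
      (max_le (one_le_entryNorm_transferProd V E 0 n) (norm_boxDet_le V E n))
  have h0 : ∀ (E : ℝ) (n : ℕ), 0 ≤ Real.log (max 1 ‖boxDet (fun k => V k) E n‖) := fun E n =>
    Real.log_nonneg (le_max_left _ _)
  have hlim := tendsto_integral_of_dominated_convergence (μ := volume.restrict S)
    (F := fun (n : ℕ) (E : ℝ) => Real.log (max 1 ‖boxDet (fun k => V k) E n‖) / n)
    (f := fun _ => (0 : ℝ)) (fun _ => Real.log 2 + Real.log (|R| + 3)) ?_ ?_ ?_ ?_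
  · simp only [integral_zero] at hlim
    filter_upwards [hlim.eventually (gt_mem_nhds hε), eventually_gt_atTop 0] with n hn hn0
    have hn0 : (0 : ℝ) < n := by exact_mod_cast hn0
    rw [integral_div, div_lt_iff₀ hn0] at hn
    exact hn.le
  · intro n
    exact ((continuous_log_max ((continuous_boxDet (fun k => V k) n).comp
      Complex.continuous_ofReal)).div_const _).aestronglyMeasurable
  · exact integrable_const _
  · intro n
    filter_upwards [ae_restrict_mem hS.measurableSet] with E hE
    rw [Real.norm_eq_abs, abs_of_nonneg (div_nonneg (h0 E n) n.cast_nonneg)]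
    have hl2 : 0 ≤ Real.log 2 := Real.log_nonneg (by norm_num)
    have hl3 : 0 ≤ Real.log (|R| + 3) := Real.log_nonneg (by linarith [abs_nonneg R])
    rcases Nat.eq_zero_or_pos n with rfl | hn
    · simp only [CharP.cast_eq_zero, div_zero]; linarith
    have hn1 : (1 : ℝ) ≤ n := by exact_mod_cast hn
    rw [div_le_iff₀ (by linarith)]
    refine (hle E n).trans ?_
    have hpos : 0 < |E| + 3 := by linarith [abs_nonneg E]
    refine (Real.log_le_log (zero_lt_one.trans_le (one_le_entryNorm_transferProd V E 0 n))
      (entryNorm_transferProd_le hV E 0 n)).trans ?_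
    rw [Real.log_mul two_ne_zero (pow_pos hpos n).ne', Real.log_pow]
    have h1 : Real.log (|E| + 3) ≤ Real.log (|R| + 3) :=
      Real.log_le_log hpos (by linarith [hR E hE, Real.norm_eq_abs E, le_abs_self R])
    nlinarith
  · filter_upwards [ae_restrict_mem hS.measurableSet] with E hE
    rw [Metric.tendsto_atTop]
    intro δ hδ
    obtain ⟨n0, hn0⟩ := eventually_atTop.1 (hgr E hE (δ / 2) (half_pos hδ))
    refine ⟨max n0 1, fun n hn => ?_⟩
    have hn1 : (1 : ℝ) ≤ n := by exact_mod_cast (le_max_right _ _).trans hn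
    rw [Real.dist_eq, sub_zero, abs_of_nonneg (div_nonneg (h0 E n) n.cast_nonneg)]
    rw [div_lt_iff₀ (by linarith)]
    have := (hle E n).trans (hn0 n ((le_max_left _ _).trans hn))
    nlinarith

lemma continuous_kotaniDefect_weyl (v : ℕ → ℝ) (N k : ℕ) {η : ℝ} (hη : 0 < η) :
    Continuous fun E : ℝ => kotaniDefect η (weyl v (E + η * Complex.I) k)
      (rightTail v N (E + η * Complex.I) k) :=
  continuous_kotaniDefect (isHerglotz_cfTail v k) (isHerglotz_rightTail v N k) (v k) hη

lemma sum_integral_kotaniDefect_le {S : Set ℝ} (hS : IsCompact S) (v : ℕ → ℝ) (N : ℕ) {η : ℝ}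
    (hη : 0 < η) :
    ∑ k ∈ Finset.range (N + 1), ∫ E in S, kotaniDefect η (weyl v (E + η * Complex.I) k)
      (rightTail v (N + 1) (E + η * Complex.I) k) ≤
    4 * (intLogDet S v (N + 1) η / η - intGreen S v (N + 1) η) +
      4 * volume.real S * (1 - Real.log η) / η := by
  rw [← integral_finsetSum _ fun k _ =>
    integrableOn_of_continuous hS (continuous_kotaniDefect_weyl v (N + 1) k hη)]
  have hi1 : IntegrableOn (fun E : ℝ => 4 / η * logDet v (N + 1) (E + η * Complex.I)) S :=
    integrableOn_of_continuous hS (continuous_const.mul (continuous_logDet v _ hη))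
  have hi2 : IntegrableOn (fun E : ℝ => 4 * ∑ k ∈ Finset.range (N + 1),
      greenIm v (N + 1) (E + η * Complex.I) k) S :=
    integrableOn_of_continuous hS (continuous_const.mul
      (continuous_finsetSum _ fun k _ => continuous_greenIm v _ k hη))
  have hi3 : IntegrableOn (fun _ : ℝ => 4 * (1 - Real.log η) / η) S :=
    integrableOn_const hS.measure_lt_top.ne
  have hle : ∀ E : ℝ, ∑ k ∈ Finset.range (N + 1), kotaniDefect η (weyl v (E + η * Complex.I) k)
      (rightTail v (N + 1) (E + η * Complex.I) k) ≤
      4 / η * logDet v (N + 1) (E + η * Complex.I) - 4 * ∑ k ∈ Finset.range (N + 1),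
        greenIm v (N + 1) (E + η * Complex.I) k + 4 * (1 - Real.log η) / η := fun E => by
    have him : (E + η * Complex.I : ℂ).im = η := by simp
    have hz : 0 < (E + η * Complex.I : ℂ).im := by rw [him]; exact hη
    have k1 := kotani_sum v hz N
    have k2 := kotani_sum_right v hz N
    rw [him] at k1 k2
    change _ ≤ 2 * logDet v (N + 1) (E + η * Complex.I) + 2 - 2 * Real.log η at k1
    have e1 : ∀ f : ℕ → ℝ, ∑ k ∈ Finset.range (N + 1), 1 / f k =
        (∑ k ∈ Finset.range (N + 1), η / f k) / η := fun f => by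
      rw [Finset.sum_div]
      refine Finset.sum_congr rfl fun k _ => ?_
      field_simp
    simp only [kotaniDefect, Finset.sum_sub_distrib, Finset.sum_add_distrib, ← Finset.mul_sum]
    rw [e1, e1]
    have j1 := div_le_div_of_nonneg_right k1 hη.le
    have j2 := div_le_div_of_nonneg_right k2 hη.le
    have e2 : 4 / η * logDet v (N + 1) (E + η * Complex.I) + 4 * (1 - Real.log η) / η =
        (2 * logDet v (N + 1) (E + η * Complex.I) + 2 - 2 * Real.log η) / η +
        (2 * logDet v (N + 1) (E + η * Complex.I) + 2 - 2 * Real.log η) / η := by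
      field_simp; ring
    simp only [greenIm, greenDen]
    linarith
  refine (integral_mono (integrableOn_of_continuous hS (continuous_finsetSum _ fun k _ =>
    continuous_kotaniDefect_weyl v (N + 1) k hη)) ((hi1.sub hi2).add hi3) hle).trans (le_of_eq ?_)
  have e1 := integral_add (hi1.sub hi2) hi3
  have e2 := integral_sub hi1 hi2
  simp only [Pi.sub_apply, Pi.add_apply] at e1 e2 ⊢
  rw [e1, e2, integral_const_mul, integral_const_mul, setIntegral_const]
  simp only [smul_eq_mul, intLogDet, intGreen]
  ring

/-- The averaged Kotani defect is small at some height in a fixed range. -/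
lemma exists_height_kotaniDefect_le {S : Set ℝ} (hS : IsCompact S) {V : ℤ → ℝ}
    (hV : ∀ n, |V n| ≤ 1)
    (hgr : ∀ E ∈ S, ∀ ε > 0, ∀ᶠ n : ℕ in atTop,
      Real.log (entryNorm (transferProd V E 0 n)) ≤ ε * n) {ε η₂ : ℝ} (hε : 0 < ε) (hη₂ : 0 < η₂)
    (hη₂' : η₂ ≤ 1) :
    ∀ᶠ N : ℕ in atTop, ∃ η, 0 < η ∧ η ≤ η₂ ∧
      ∑ k ∈ Finset.range (N + 1), ∫ E in S,
        kotaniDefect η (weyl (fun k => V k) (E + η * Complex.I) k)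
          (rightTail (fun k => V k) (N + 1) (E + η * Complex.I) k) ≤ ε * (N + 1 : ℕ) := by
  set v : ℕ → ℝ := fun k => V k with hv
  set δ : ℝ := ε / 5 with hδ
  have hδ0 : 0 < δ := by positivity
  set η₁ : ℝ := η₂ * Real.exp (-((2 * Real.pi + 2) / δ)) with hη₁
  have hpi := Real.pi_pos
  have hη₁0 : 0 < η₁ := mul_pos hη₂ (Real.exp_pos _)
  have hη₁₂ : η₁ ≤ η₂ :=
    mul_le_of_le_one_right hη₂.le (Real.exp_le_one_iff.2 (neg_nonpos.2 (by positivity)))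
  have hlog : δ * (Real.log η₂ - Real.log η₁) = 2 * Real.pi + 2 := by
    rw [hη₁, Real.log_mul hη₂.ne' (Real.exp_pos _).ne', Real.log_exp]
    field_simp
    ring
  set A : ℝ := 4 * volume.real S * (1 - Real.log η₁) / η₁ with hA
  set B : ℝ := volume.real S * (Real.log η₂ - 1) / η₂ with hB
  have ev1 := (tendsto_add_atTop_nat 1).eventually
    (eventually_integral_log_le hS hV hgr hη₁0)
  have tend : Tendsto (fun N : ℕ => ((N + 1 : ℕ) : ℝ)) atTop atTop :=
    tendsto_natCast_atTop_atTop.comp (tendsto_add_atTop_nat 1)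
  filter_upwards [ev1, tend.eventually_ge_atTop (A / δ), tend.eventually_gt_atTop (-B)]
    with N h1 h2 h3
  set n : ℝ := ((N + 1 : ℕ) : ℝ) with hn
  have hn0 : 0 < n := by positivity
  have key : ∃ η ∈ Icc η₁ η₂, intLogDet S v (N + 1) η / η - intGreen S v (N + 1) η ≤ δ * n := by
    by_contra hcon
    push Not at hcon
    have hder : ∀ s ∈ Icc η₁ η₂, HasDerivAt
        (fun s => intLogDet S v (N + 1) s / s + δ * n * Real.log s)
        ((intGreen S v (N + 1) s * s - intLogDet S v (N + 1) s * 1) / s ^ 2 + δ * n * s⁻¹) s :=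
      fun s hs => by
        have hs0 := hη₁0.trans_le hs.1
        exact ((hasDerivAt_intLogDet hS v N hs0).div (hasDerivAt_id s) hs0.ne').add
          ((Real.hasDerivAt_log hs0.ne').const_mul _)
    have hanti := antitoneOn_of_deriv_nonpos (convex_Icc η₁ η₂)
      (fun s hs => (hder s hs).continuousAt.continuousWithinAt)
      (fun s hs => (hder s (interior_subset hs)).differentiableAt.differentiableWithinAt)
      (fun s hs => by
        have hs := interior_subset hs
        have hs0 := hη₁0.trans_le hs.1
        rw [(hder s hs).deriv]
        have e : (intGreen S v (N + 1) s * s - intLogDet S v (N + 1) s * 1) / s ^ 2 +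
            δ * n * s⁻¹ =
            -((intLogDet S v (N + 1) s / s - intGreen S v (N + 1) s - δ * n) / s) := by
          field_simp
          ring
        rw [e, neg_nonpos]
        exact div_nonneg (by linarith [hcon s hs]) hs0.le)
    have h := hanti (left_mem_Icc.2 hη₁₂) (right_mem_Icc.2 hη₁₂) hη₁₂
    simp only at h
    have u1 : intLogDet S v (N + 1) η₁ / η₁ ≤ 2 * Real.pi * n + n := by
      rw [div_le_iff₀ hη₁0]
      have := intLogDet_le hS v N hη₁0
      linarith
    have u2 : B ≤ intLogDet S v (N + 1) η₂ / η₂ :=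
      div_le_div_of_nonneg_right (le_intLogDet hS v N hη₂) hη₂.le
    have u3 : δ * n * Real.log η₂ - δ * n * Real.log η₁ = (2 * Real.pi + 2) * n := by
      rw [← hlog]; ring
    linarith
  obtain ⟨η, hη, hle⟩ := key
  have hη0 := hη₁0.trans_le hη.1
  refine ⟨η, hη0, hη.2, (sum_integral_kotaniDefect_le hS v N hη0).trans ?_⟩
  have hA' : 4 * volume.real S * (1 - Real.log η) / η ≤ A := by
    have hl := Real.log_le_log hη₁0 hη.1
    have hl2 : Real.log η₁ ≤ 0 := Real.log_nonpos hη₁0.le (hη₁₂.trans hη₂')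
    exact div_le_div₀ (mul_nonneg (by positivity) (by linarith))
      (mul_le_mul_of_nonneg_left (by linarith) (by positivity)) hη₁0 hη.1
  have hA2 : A ≤ δ * n := by
    rw [div_le_iff₀ hδ0] at h2
    linarith
  have e5 : ε * n = 5 * (δ * n) := by rw [hδ]; ring
  linarith

lemma sum_range_mul_eq (f : ℕ → ℝ) (J W : ℕ) :
    ∑ k ∈ Finset.range (J * W), f k =
      ∑ j ∈ Finset.range J, ∑ i ∈ Finset.range W, f (j * W + i) := by
  induction J with
  | zero => simp
  | succ J ih => rw [add_mul, one_mul, Finset.sum_range_add, ih, Finset.sum_range_succ]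

lemma exists_le_of_sum_le_of_syndetic {f : ℕ → ℝ} (hf : ∀ n, 0 ≤ f n) {P : ℕ → Prop} {W : ℕ}
    (hP : ∀ b : ℕ, ∃ n, b ≤ n ∧ n + 1 < b + W ∧ P n) {J : ℕ} (hJ : 0 < J) {ρ : ℝ}
    (hs : ∑ k ∈ Finset.range (J * W), f k ≤ ρ * (J * W : ℕ)) :
    ∃ n, n + 1 < J * W ∧ P n ∧ f n ≤ ρ * W := by
  have h : ∑ j ∈ Finset.range J, ∑ i ∈ Finset.range W, f (j * W + i) ≤
      ∑ j ∈ Finset.range J, ρ * W := by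
    rw [← sum_range_mul_eq]
    refine hs.trans (le_of_eq ?_)
    simp
    ring
  obtain ⟨j, hj, hle⟩ := Finset.exists_le_of_sum_le (Finset.nonempty_range_iff.2 hJ.ne') h
  obtain ⟨n, hn1, hn2, hPn⟩ := hP (j * W)
  refine ⟨n, hn2.trans_le ?_, hPn, le_trans ?_ hle⟩
  · have : (j + 1) * W ≤ J * W := Nat.mul_le_mul_right W (Finset.mem_range.1 hj)
    linarith
  · have e : f n = f (j * W + (n - j * W)) := by congr 1; omega
    rw [e]
    exact Finset.single_le_sum (f := fun i => f (j * W + i)) (fun i _ => hf _)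
      (Finset.mem_range.2 (by omega))

/-- The zero-measure conclusion of Kotani theory: a potential with recurrence and right special
words of every length cannot have vanishing growth on a set of positive measure. -/
lemma volume_eq_zero_of_growth {S : Set ℝ} (hS : IsCompact S) {V : ℤ → ℝ}
    (hV : ∀ n, V n = 0 ∨ V n = 1) {C : ℕ} (hR : RecurrentAtScales C V) (hRS : HasRightSpecial V)
    (hgr : ∀ E ∈ S, ∀ ε > 0, ∀ᶠ n : ℕ in atTop,
      Real.log (entryNorm (transferProd V E 0 n)) ≤ ε * n) : volume S = 0 := by
  by_contra hne
  have hpos : 0 < volume.real S := ENNReal.toReal_pos hne hS.measure_lt_top.ne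
  have hV1 : ∀ n, |V n| ≤ 1 := fun n => by rcases hV n with h | h <;> simp [h]
  have hpi := Real.pi_pos
  obtain ⟨y, e, hy, hy1, he, hmain⟩ :=
    exists_height_norm_lt hS hpos (show (0 : ℝ) < 1 / 300 by norm_num)
  obtain ⟨k, hk⟩ : ∃ k : ℕ, 2 / y ^ 2 * ((1 + y ^ 2) ^ k)⁻¹ ≤ e / 4 := by
    obtain ⟨k, hk⟩ := pow_unbounded_of_one_lt (8 / (y ^ 2 * e))
      (show 1 < 1 + y ^ 2 by linarith [pow_pos hy 2])
    refine ⟨k, ?_⟩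
    rw [← div_eq_mul_inv, div_le_iff₀ (by positivity)]
    calc 2 / y ^ 2 = e / 4 * (8 / (y ^ 2 * e)) := by field_simp; norm_num
      _ ≤ _ := mul_le_mul_of_nonneg_left hk.le (by positivity)
  set τ : ℝ := e / (8 * (1 + 2 / y)) with hτ
  have hτ0 : 0 < τ := by positivity
  set q : ℝ := e * (Real.pi * y * τ) / 8 with hq
  have hq0 : 0 < q := by positivity
  obtain ⟨a, a', haa, hne'⟩ := hRS (k + 1)
  obtain ⟨l, hl, -, hocc⟩ := hR (k + 2)
  set W : ℕ := C * l + k + 2 with hW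
  have hW0 : (0 : ℝ) < W := by positivity
  set v : ℕ → ℝ := fun k => V k with hv
  have hsyn : ∀ a : ℤ, ∀ b : ℕ, ∃ n, b ≤ n ∧ n + 1 < b + W ∧
      ∃ m : ℕ, n = m + k ∧ ∀ i : ℕ, i < k + 2 → v (m + i) = V (a + i) := fun a b => by
    obtain ⟨m, hm1, hm2, hm⟩ := hocc a b
    lift m to ℕ using (Int.natCast_nonneg b).trans hm1
    refine ⟨m + k, by omega, ?_, m, rfl, fun i hi => ?_⟩
    · have : m ≤ b + C * l := by exact_mod_cast hm2
      omega
    · rw [← hm i (by omega)]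
      simp [hv]
  have hev := exists_height_kotaniDefect_le hS hV1 hgr (div_pos hq0 hW0)
    (show 0 < min 1 (e / 8) by positivity) (min_le_left _ _)
  obtain ⟨N₀, hN₀⟩ := eventually_atTop.1 hev
  obtain ⟨N, hN, hNW⟩ : ∃ N, N₀ ≤ N ∧ N + 1 = (N₀ + 1) * W := by
    have : (N₀ + 1) * 1 ≤ (N₀ + 1) * W := Nat.mul_le_mul_left _ (by omega)
    exact ⟨(N₀ + 1) * W - 1, by omega, by omega⟩
  obtain ⟨η, hη, hη2, hsum⟩ := hN₀ N hN
  have hη1 : η ≤ 1 := hη2.trans (min_le_left _ _)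
  have hη8 : η ≤ e / 8 := hη2.trans (min_le_right _ _)
  set Q : ℕ → ℝ := fun n => ∫ E in S, kotaniDefect η (weyl v (E + η * Complex.I) n)
    (rightTail v (N + 1) (E + η * Complex.I) n) with hQ
  have hQ0 : ∀ n, 0 ≤ Q n := fun n => integral_nonneg fun E => by
    have hz : 0 < (E + η * Complex.I : ℂ).im := by simpa using hη
    refine (kotaniDefect_nonneg_and_bound hη ?_
      ((isHerglotz_rightTail v (N + 1) n).im_nonneg _ hz)).1
    simpa using im_le_weyl_im v hz n
  have hsum' : ∑ n ∈ Finset.range ((N₀ + 1) * W), Q n ≤ q / W * ((N₀ + 1) * W : ℕ) := by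
    rw [← hNW]
    exact hsum
  obtain ⟨n, hn, ⟨m, hnm, hm⟩, hQn⟩ :=
    exists_le_of_sum_le_of_syndetic hQ0 (hsyn a) N₀.succ_pos hsum'
  obtain ⟨n', hn', ⟨m', hnm', hm'⟩, hQn'⟩ :=
    exists_le_of_sum_le_of_syndetic hQ0 (hsyn a') N₀.succ_pos hsum'
  rw [div_mul_cancel₀ _ hW0.ne'] at hQn hQn'
  rw [← hNW] at hn hn'
  have hrefl : ∀ j : ℕ, Q j ≤ q → ∀ (x : ℝ) (z : ℂ), z = x + (y + η : ℝ) * Complex.I →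
      ‖chart (weyl v z j) + (starRingEnd ℂ) (chart (rightTail v (N + 1) z j))‖ ≤
        2 * (1 - harm S y x) + 3 * e / 8 := fun j hj x z hz => by
    refine (norm_chart_add_conj_le (isHerglotz_cfTail v j) (isHerglotz_rightTail v (N + 1) j)
      (v j) hS hη hτ0 hy hj x hz).trans ?_
    have b1 : τ * (η + 2 / y) ≤ e / 8 := by
      refine (mul_le_mul_of_nonneg_left (add_le_add_left hη1 _) hτ0.le).trans (le_of_eq ?_)
      rw [hτ]
      field_simp
    have b2 : q / (Real.pi * y * τ) = e / 8 := by
      rw [hq]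
      field_simp
    linarith
  set d : ℂ → ℂ := fun z => chart (rightTail v (N + 1) z n) - chart (rightTail v (N + 1) z n')
    with hd
  have hr := isHerglotz_rightTail v (N + 1)
  have hlt := hmain d η hη
    ((differentiableOn_chart (hr n).diff (hr n).im_nonneg).sub
      (differentiableOn_chart (hr n').diff (hr n').im_nonneg))
    (fun z hz => (norm_sub_le _ _).trans (by
      linarith [norm_chart_le ((hr n).im_nonneg z hz), norm_chart_le ((hr n').im_nonneg z hz)]))
    (fun x => by
      set z : ℂ := x + (y + η : ℝ) * Complex.I with hz
      have hzy : y ≤ z.im := by simp [hz, hη.le]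
      have c1 := hrefl n hQn x z hz
      have c2 := hrefl n' hQn' x z hz
      have c3 := chart_weyl_sub_le v hy hzy m m' k fun j hj => by
        rw [hm j (by omega), hm' j (by omega)]
        exact haa j (by omega)
      rw [← hnm, ← hnm'] at c3
      have e1 : (starRingEnd ℂ) (d z) =
          (chart (weyl v z n) + (starRingEnd ℂ) (chart (rightTail v (N + 1) z n))) -
          (chart (weyl v z n') + (starRingEnd ℂ) (chart (rightTail v (N + 1) z n'))) -
          (chart (weyl v z n) - chart (weyl v z n')) := by
        simp only [hd, map_sub]
        ring
      rw [← Complex.norm_conj, e1]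
      have t1 := norm_sub_le
        ((chart (weyl v z n) + (starRingEnd ℂ) (chart (rightTail v (N + 1) z n))) -
          (chart (weyl v z n') + (starRingEnd ℂ) (chart (rightTail v (N + 1) z n'))))
        (chart (weyl v z n) - chart (weyl v z n'))
      have t2 := norm_sub_le
        (chart (weyl v z n) + (starRingEnd ℂ) (chart (rightTail v (N + 1) z n)))
        (chart (weyl v z n') + (starRingEnd ℂ) (chart (rightTail v (N + 1) z n')))
      linarith)
  have hge := norm_chart_rightTail_sub_ge v (fun n => hV n) hn hn'
    (by
      have e1 := hm (k + 1) (by omega)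
      have e2 := hm' (k + 1) (by omega)
      rw [hnm, hnm', add_assoc, add_assoc, e1, e2]
      exact hne')
    (show 3 ≤ 3 + y + η by linarith) (show 3 + y + η ≤ 5 by linarith)
  exact absurd hlt (not_lt.2 hge)

end CircleMap

/-- for badly approximable irrational `α`, the circle map Schrödinger
operator has zero-measure Cantor spectrum for all `β`, `θ`. -/
theorem stmt3 (α : ℝ) (hα : α ∈ Set.Ioo (0 : ℝ) 1) (hirr : Irrational α)
    (hba : ∃ c > (0 : ℝ), ∀ q : ℕ, 0 < q →
      c / (q : ℝ) ≤ |(q : ℝ) * α - (round ((q : ℝ) * α) : ℝ)|) :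
    ∀ β ∈ Set.Ioo (0 : ℝ) 1, ∀ θ ∈ Set.Ioo (0 : ℝ) 1,
      ∀ H : lp (fun _ : ℤ => ℝ) 2 →L[ℝ] lp (fun _ : ℤ => ℝ) 2,
        IsSchrodingerOp (circleV α β θ) H →
          IsCantorSet (spectrum ℝ H) ∧ MeasureTheory.volume (spectrum ℝ H) = 0 := by
  intro β hβ θ _ H hH
  obtain ⟨c, hc, hba⟩ := hba
  have hB := CircleMap.badlyApprox_of_round hba
  obtain ⟨C, hR⟩ : ∃ C, CircleMap.RecurrentAtScales C (circleV α β θ) :=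
    CircleMap.exists_recurrentAtScales hc hB hβ θ
  have hRS : CircleMap.HasRightSpecial (circleV α β θ) := CircleMap.hasRightSpecial hc hB hβ θ
  have hV (n : ℤ) : circleV α β θ n = 0 ∨ circleV α β θ n = 1 := CircleMap.codingFn_mem β _
  have hIcc (n : ℤ) : circleV α β θ n ∈ Icc (0 : ℝ) 1 := by
    rcases hV n with h | h <;> simp [h]
  have hAbs (n : ℤ) : |circleV α β θ n| ≤ 1 := by
    rcases hV n with h | h <;> simp [h]
  have hS : IsCompact (spectrum ℝ H) := spectrum.isCompact H
  have h0 : volume (spectrum ℝ H) = 0 :=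
    CircleMap.volume_eq_zero_of_growth hS hV hR hRS fun E hE ε hε =>
      CircleMap.schrodinger_growth_le hH hAbs hR hE hε
  exact ⟨⟨hS, Measure.interior_eq_empty_of_null h0,
    fun x hx => CircleMap.schrodinger_accPt hH hIcc hR hx⟩, h0⟩
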